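/- Let X be a finite connected 2-dimensional simplicial complex such that every subcomplex Y of X with f^1Y ≥ 1 satisfies f^0Y / f^1Y > 1/3. Then the geometric realization |X| is homotopy equivalent to a wedge of finitely many (possibly zero) circles, 2-spheres and real projective planes (interpreted as a single point when the family is empty). -/

import Mathlib

open scoped BigOperators

/-- A finite 2-dimensional abstract simplicial complex on vertex set `Fin N`
(vertex `i ∈ {1,…,N}` corresponds to the element of `Fin N` with value `i-1`). -/
structure SimplicialComplex2 (N : ℕ) where
  faces : Finset (Finset (Fin N))
  nonempty_of_mem : ∀ σ ∈ faces, σ.Nonempty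
  card_le_three : ∀ σ ∈ faces, σ.card ≤ 3
  down_closed : ∀ σ ∈ faces, ∀ τ ⊆ σ, τ.Nonempty → τ ∈ faces

namespace SimplicialComplex2

variable {N : ℕ}

/-- `f i X` is the number of `i`-dimensional faces of `X`. -/
def f (i : ℕ) (X : SimplicialComplex2 N) : ℕ :=
  (X.faces.filter fun σ => σ.card = i + 1).card

/-- The Euler characteristic `χX = f⁰X − f¹X + f²X`. -/
def euler (X : SimplicialComplex2 N) : ℤ :=
  (f 0 X : ℤ) - f 1 X + f 2 X

/-- `Y` is a subcomplex of `X`. -/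
def IsSubcomplex (Y X : SimplicialComplex2 N) : Prop :=
  Y.faces ⊆ X.faces

/-- The `i`-th standard basis vector of `ℝ^N`. -/
def basisVec (i : Fin N) : Fin N → ℝ := Pi.single i 1

/-- The geometric realization of `X` as a subset of `ℝ^N`: the union over the
faces `σ` of `X` of the convex hulls of the corresponding sets of standard basis
vectors. -/
def realization (X : SimplicialComplex2 N) : Set (Fin N → ℝ) :=
  ⋃ σ ∈ X.faces, convexHull ℝ (basisVec '' (σ : Set (Fin N)))

lemma vertex_mem_realization (X : SimplicialComplex2 N) {x : Fin N}
    (hx : {x} ∈ X.faces) : basisVec x ∈ realization X := by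
  refine Set.mem_biUnion hx ?_
  exact subset_convexHull ℝ _ ⟨x, by simp⟩

/-- The point of the realization corresponding to a vertex. -/
def vertexPt (X : SimplicialComplex2 N) {x : Fin N} (hx : {x} ∈ X.faces) :
    ↥(realization X) :=
  ⟨basisVec x, X.vertex_mem_realization hx⟩

end SimplicialComplex2

noncomputable section

/-- The relation generating the wedge: an extra basepoint (`Sum.inl ()`) is glued to
the basepoint of each space in the family. -/
def wedgeRel {ι : Type*} (S : ι → Type*) (b : ∀ i, S i) :
    (Unit ⊕ Σ i, S i) → (Unit ⊕ Σ i, S i) → Prop :=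
  fun x y => x = Sum.inl () ∧ ∃ i, y = Sum.inr ⟨i, b i⟩

/-- The wedge of a family of pointed topological spaces: the quotient of the disjoint
union (together with an extra point) identifying all the basepoints with the extra
point.  When the family is empty this is a single point. -/
def Wedge {ι : Type*} (S : ι → Type*) [∀ i, TopologicalSpace (S i)] (b : ∀ i, S i) :
    Type _ :=
  Quot (wedgeRel S b)

instance {ι : Type*} (S : ι → Type*) [∀ i, TopologicalSpace (S i)] (b : ∀ i, S i) :
    TopologicalSpace (Wedge S b) := by
  unfold Wedge; infer_instance

/-- The unit circle `S¹ ⊂ ℝ²`. -/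
abbrev Circle2 : Type := Metric.sphere (0 : EuclideanSpace ℝ (Fin 2)) 1

/-- The unit sphere `S² ⊂ ℝ³`. -/
abbrev Sphere2 : Type := Metric.sphere (0 : EuclideanSpace ℝ (Fin 3)) 1

def Circle2.pt : Circle2 :=
  ⟨EuclideanSpace.single 0 1, by simp⟩

def Sphere2.pt : Sphere2 :=
  ⟨EuclideanSpace.single 0 1, by simp⟩

/-- The real projective plane: the quotient of `S² ⊂ ℝ³` by the antipodal map. -/
def RP2 : Type :=
  Quot (fun x y : Sphere2 =>
    (x : EuclideanSpace ℝ (Fin 3)) = -(y : EuclideanSpace ℝ (Fin 3)))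

instance : TopologicalSpace RP2 := by unfold RP2; infer_instance

def RP2.pt : RP2 := Quot.mk _ Sphere2.pt

/-- The three kinds of spaces allowed as wedge summands. -/
inductive WedgePiece : Type
  | circle : WedgePiece
  | sphere : WedgePiece
  | rp2 : WedgePiece

/-- The space associated to a wedge piece. -/
def WedgePiece.space : WedgePiece → Type
  | .circle => Circle2
  | .sphere => Sphere2
  | .rp2 => RP2

instance (p : WedgePiece) : TopologicalSpace p.space := by
  cases p <;> (unfold WedgePiece.space; infer_instance)

/-- The basepoint of a wedge piece. -/
def WedgePiece.pt : (p : WedgePiece) → p.space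
  | .circle => Circle2.pt
  | .sphere => Sphere2.pt
  | .rp2 => RP2.pt

noncomputable section

open scoped unitInterval ContinuousMap
set_option linter.unusedSectionVars false

/-- The generating relation of `Att φ`. -/
def attRel {S A : Type} [TopologicalSpace S] [TopologicalSpace A] (φ : C(S, A)) :
    (A ⊕ S × I) → (A ⊕ S × I) → Prop := fun x y =>
  (∃ s, x = .inl (φ s) ∧ y = .inr (s, 0)) ∨ (∃ s r, x = .inr (s, 1) ∧ y = .inr (r, 1))

/-- The mapping cone of `φ`: a cone on `S` attached to `A` along `φ`. -/
def Att {S A : Type} [TopologicalSpace S] [TopologicalSpace A] (φ : C(S, A)) : Type :=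
  Quot (attRel φ)

namespace Att

variable {S A B W : Type} [TopologicalSpace S] [TopologicalSpace A] [TopologicalSpace B]
  [TopologicalSpace W]

instance (φ : C(S, A)) : TopologicalSpace (Att φ) := by unfold Att; infer_instance

section basic

variable (φ : C(S, A))

def incl : C(A, Att φ) := ⟨fun a => Quot.mk _ (.inl a), continuous_quot_mk.comp continuous_inl⟩

def cellMap : C(S × I, Att φ) :=
  ⟨fun p => Quot.mk _ (.inr p), continuous_quot_mk.comp continuous_inr⟩

def apex [Inhabited S] : Att φ := cellMap φ (default, 1)

variable {φ}

lemma cellMap_zero (s : S) : cellMap φ (s, 0) = incl φ (φ s) :=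
  (Quot.sound (.inl ⟨s, rfl, rfl⟩)).symm

lemma cellMap_one [Inhabited S] (s : S) : cellMap φ (s, 1) = apex φ :=
  Quot.sound (.inr ⟨s, default, rfl, rfl⟩)

/-- The map out of a mapping cone. -/
def lift (f : C(A, W)) (k : C(S × I, W)) (h0 : ∀ s, k (s, 0) = f (φ s))
    (h1 : ∀ s s', k (s, 1) = k (s', 1)) : C(Att φ, W) where
  toFun := Quot.lift (Sum.elim f k) (by
    rintro _ _ (⟨s, rfl, rfl⟩ | ⟨s, s', rfl, rfl⟩)
    · exact (h0 s).symm
    · exact h1 s s')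
  continuous_toFun := continuous_quot_lift _ (f.continuous.sumElim k.continuous)

@[ext] lemma hom_ext {g g' : C(Att φ, W)} (h : ∀ a, g (incl φ a) = g' (incl φ a))
    (h' : ∀ p, g (cellMap φ p) = g' (cellMap φ p)) : g = g' := by
  ext x
  induction x using Quot.ind with
  | _ x => cases x with
    | inl a => exact h a
    | inr p => exact h' p

lemma homotopic_of {g₀ g₁ : C(Att φ, W)} (Fa : C(I × A, W)) (Fs : C(I × (S × I), W))
    (h0 : ∀ r s, Fs (r, (s, 0)) = Fa (r, φ s))
    (h1 : ∀ r s s', Fs (r, (s, 1)) = Fs (r, (s', 1)))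
    (a0 : ∀ a, Fa (0, a) = g₀ (incl φ a)) (a1 : ∀ a, Fa (1, a) = g₁ (incl φ a))
    (s0 : ∀ p, Fs (0, p) = g₀ (cellMap φ p)) (s1 : ∀ p, Fs (1, p) = g₁ (cellMap φ p)) :
    g₀.Homotopic g₁ := by
  let G : C(Att φ, C(I, W)) := lift (φ := φ) (Fa.comp .prodSwap).curry (Fs.comp .prodSwap).curry
    (fun s => by ext r; exact h0 r s) (fun s s' => by ext r; exact h1 r s s')
  refine ⟨⟨G.uncurry.comp .prodSwap, fun x => ?_, fun x => ?_⟩⟩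
  · induction x using Quot.ind with
    | _ x => cases x with
      | inl a => exact a0 a
      | inr p => exact s0 p
  · induction x using Quot.ind with
    | _ x => cases x with
      | inl a => exact a1 a
      | inr p => exact s1 p

end basic

section path

variable [LocallyCompactSpace S]

/-- A path in `C(S, W)` as a map on the cylinder. -/
def cyl {p q : C(S, W)} (K : Path p q) : C(S × I, W) where
  toFun x := K x.2 x.1
  continuous_toFun := by fun_prop

variable [Inhabited S] {φ : C(S, A)}

/-- The map out of a mapping cone given by a null homotopy. -/
def desc (f : C(A, W)) {w : W} (K : Path (f.comp φ) (.const S w)) : C(Att φ, W) :=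
  lift f (cyl K) (fun s => by simp [cyl]) (fun s s' => by simp [cyl])

/-- The tautological null homotopy of `φ` in its mapping cone. -/
def cell (φ : C(S, A)) : Path ((incl φ).comp φ) (.const S (apex φ)) where
  toFun := ((cellMap φ).comp .prodSwap).curry
  source' := by ext s; exact cellMap_zero s
  target' := by ext s; exact cellMap_one s

lemma continuous_postcomp (f : C(A, W)) : Continuous (fun g : C(S, A) => f.comp g) :=
  ContinuousMap.continuous_postcomp f

/-- Composition of a path in `C(S, A)` with a map. -/
def push (f : C(A, W)) {p q : C(S, A)} (K : Path p q) : Path (f.comp p) (f.comp q) :=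
  K.map (continuous_postcomp f)

lemma desc_homotopic {f : C(A, W)} {w : W} {K K' : Path (f.comp φ) (.const S w)}
    (h : K.Homotopic K') : (desc f K).Homotopic (desc f K') := by
  obtain ⟨H⟩ := h
  refine homotopic_of ⟨fun p => f p.2, by fun_prop⟩ ⟨fun p => H (p.1, p.2.2) p.2.1, by fun_prop⟩
    ?_ ?_ ?_ ?_ ?_ ?_
  · intro r s; simp
  · intro r s s'; simp
  · intro a; rfl
  · intro a; rfl
  · intro p; simp; rfl
  · intro p; simp; rfl

/-- A homotopy of maps gives a path after precomposition. -/
def hpath {f f' : C(A, W)} (D : f.Homotopy f') (φ : C(S, A)) : Path (f.comp φ) (f'.comp φ) where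
  toFun := ((D.toContinuousMap.comp (.prodMap (.id _) φ)).curry)
  source' := by ext s; simp
  target' := by ext s; simp

lemma desc_transport {f f' : C(A, W)} (D : f.Homotopy f') {w : W}
    (K : Path (f'.comp φ) (.const S w)) :
    (desc f ((hpath D φ).trans K)).Homotopic (desc f' K) := by
  set P := (hpath D φ).trans K with hP
  refine homotopic_of D.toContinuousMap
    ⟨fun p => P.extend ((p.1 : ℝ) / 2 + p.2.2 * (1 - p.1 / 2)) p.2.1, by fun_prop⟩
    ?_ ?_ ?_ ?_ ?_ ?_
  · intro r s
    have hr := r.2.2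
    simp only [ContinuousMap.coe_mk, Set.Icc.coe_zero, zero_mul, add_zero, hP]
    rw [Path.extend_trans_of_le_half _ _ (by linarith), mul_div_cancel₀ _ (by norm_num),
      Path.extend_extends']
    rfl
  · intro r s s'
    simp
  · intro a; simp; rfl
  · intro a; simp; rfl
  · rintro ⟨s, t⟩
    simp only [ContinuousMap.coe_mk, Set.Icc.coe_zero, zero_div, zero_add, sub_zero, mul_one]
    rw [Path.extend_extends']
    rfl
  · rintro ⟨s, t⟩
    simp only [ContinuousMap.coe_mk, Set.Icc.coe_one]
    rw [hP, Path.extend_trans_of_half_le _ _ (by have := t.2.1; linarith)]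
    rw [show (2 * (1 / 2 + (t : ℝ) * (1 - 1 / 2)) - 1) = t by ring, Path.extend_extends']
    rfl

/-- The map of mapping cones induced by a homotopy commutative square. -/
def mapAtt (f : C(A, B)) {ψ : C(S, B)} (H : Path (f.comp φ) ψ) : C(Att φ, Att ψ) :=
  desc ((incl ψ).comp f) ((push (incl ψ) H).trans (cell ψ))

lemma desc_cell : desc (incl φ) (cell φ) = .id _ := by
  ext x <;> rfl

lemma comp_desc {W' : Type} [TopologicalSpace W'] (f : C(A, W)) {w : W}
    (K : Path (f.comp φ) (.const S w)) (g : C(W, W')) {w' : W'}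
    (K' : Path ((g.comp f).comp φ) (.const S w')) (hK : ∀ t s, g (K t s) = K' t s) :
    g.comp (desc f K) = desc (g.comp f) K' := by
  ext x
  · rfl
  · exact hK _ _

lemma push_trans (f : C(A, W)) {p q r : C(S, A)} (K : Path p q) (L : Path q r) :
    push f (K.trans L) = (push f K).trans (push f L) := Path.map_trans _ _ _

lemma push_symm (f : C(A, W)) {p q : C(S, A)} (K : Path p q) :
    push f K.symm = (push f K).symm := rfl

lemma mapAtt_left_inv (f : C(A, B)) (g : C(B, A)) (hD : (g.comp f).Homotopic (.id A))
    {ψ : C(S, B)} (H : Path (f.comp φ) ψ) :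
    ∃ H' : Path (g.comp ψ) φ, ((mapAtt g H').comp (mapAtt f H)).Homotopic (.id (Att φ)) := by
  obtain ⟨D⟩ := hD
  let Dφ : Path ((g.comp f).comp φ) φ := hpath D φ
  let H' : Path (g.comp ψ) φ := (push g H).symm.trans Dφ
  refine ⟨H', ?_⟩
  have e1 : (mapAtt g H').comp (mapAtt f H) =
      desc (((incl φ).comp g).comp f)
        ((push (incl φ) (push g H)).trans ((push (incl φ) H').trans (cell φ))) := by
    refine comp_desc _ _ _ _ fun t s => ?_
    have := push_trans (mapAtt g H') (push (incl ψ) H) (cell ψ)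
    exact DFunLike.congr_fun (DFunLike.congr_fun this t) s
  rw [e1]
  let D' : (((incl φ).comp g).comp f).Homotopy (incl φ) :=
    (ContinuousMap.Homotopy.refl (incl φ)).comp D
  have e2 : hpath D' φ = push (incl φ) Dφ := rfl
  refine (desc_homotopic (K' := (hpath D' φ).trans (cell φ)) ?_).trans
    ((desc_transport D' (cell φ)).trans (by rw [desc_cell]))
  rw [e2, push_trans, push_symm]
  open Path.Homotopic.Quotient in
  rw [← eq]
  simp only [mk_trans, mk_symm]
  rw [← trans_assoc, ← trans_assoc, trans_symm, refl_trans]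

/-- Mapping cones of homotopy equivalent maps are homotopy equivalent. -/
lemma exists_equiv (e : A ≃ₕ B) {ψ : C(S, B)} (H : Path (e.toFun.comp φ) ψ) :
    ∃ E : Att φ ≃ₕ Att ψ, E.toFun = mapAtt e.toFun H := by
  obtain ⟨H', h1⟩ := mapAtt_left_inv e.toFun e.invFun e.left_inv H
  obtain ⟨H'', h2⟩ := mapAtt_left_inv e.invFun e.toFun e.right_inv H'
  set M := mapAtt e.toFun H
  set N := mapAtt e.invFun H'
  set M' := mapAtt e.toFun H''
  have h3 : M.Homotopic M' := by
    have a := ContinuousMap.Homotopic.comp h2 (ContinuousMap.Homotopic.refl M)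
    have b := ContinuousMap.Homotopic.comp (ContinuousMap.Homotopic.refl M') h1
    rw [ContinuousMap.id_comp] at a
    rw [ContinuousMap.comp_id, ← ContinuousMap.comp_assoc] at b
    exact a.symm.trans b
  exact ⟨⟨M, N, h1, (ContinuousMap.Homotopic.comp h3 (.refl N)).trans h2⟩, rfl⟩

/-- A homotopy as a path in the mapping space. -/
def toPath {p q : C(S, A)} (D : p.Homotopy q) : Path p q where
  toFun := D.toContinuousMap.curry
  source' := by ext s; simp
  target' := by ext s; simp

lemma equiv_of_homotopic (e : A ≃ₕ B) {ψ : C(S, B)} (h : (e.toFun.comp φ).Homotopic ψ) :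
    Nonempty (Att φ ≃ₕ Att ψ) := by
  obtain ⟨D⟩ := h
  obtain ⟨E, -⟩ := exists_equiv e (toPath D)
  exact ⟨E⟩

lemma lift_injective {X : Type} [TopologicalSpace X]
    (f : C(A, X)) (k : C(S × I, X)) (h0 : ∀ s, k (s, 0) = f (φ s))
    (h1 : ∀ s s', k (s, 1) = k (s', 1)) (hf : Function.Injective f)
    (hkf : ∀ s t a, k (s, t) = f a → t = 0)
    (hkk : ∀ s t s' t', k (s, t) = k (s', t') → t ≠ 0 → t' ≠ 0 → t = t' ∧ (t = 1 ∨ s = s')) :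
    Function.Injective (lift f k h0 h1) := by
  have key : ∀ x : Att φ, (∃ a, x = incl φ a) ∨ ∃ s t, t ≠ 0 ∧ x = cellMap φ (s, t) := by
    intro x
    induction x using Quot.ind with
    | _ x => rcases x with a | ⟨s, t⟩
             · exact .inl ⟨a, rfl⟩
             · by_cases ht : t = 0
               · subst ht; exact .inl ⟨φ s, cellMap_zero s⟩
               · exact .inr ⟨s, t, ht, rfl⟩
  intro x y hxy
  rcases key x with ⟨a, rfl⟩ | ⟨s, t, ht, rfl⟩ <;> rcases key y with ⟨b, rfl⟩ | ⟨s', t', ht', rfl⟩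
  · rw [hf hxy]
  · exact absurd (hkf s' t' a hxy.symm) ht'
  · exact absurd (hkf s t b hxy) ht
  · obtain ⟨rfl, h⟩ := hkk _ _ _ _ hxy ht ht'
    rcases h with rfl | rfl
    · rw [cellMap_one, cellMap_one]
    · rfl

instance [CompactSpace A] [CompactSpace S] : CompactSpace (Att φ) := by
  unfold Att; infer_instance

/-- Recognition of mapping cones among compact Hausdorff spaces. -/
def homeo {X : Type} [TopologicalSpace X] [T2Space X] [CompactSpace A] [CompactSpace S]
    (f : C(A, X)) (k : C(S × I, X)) (h0 : ∀ s, k (s, 0) = f (φ s))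
    (h1 : ∀ s s', k (s, 1) = k (s', 1)) (hf : Function.Injective f)
    (hkf : ∀ s t a, k (s, t) = f a → t = 0)
    (hkk : ∀ s t s' t', k (s, t) = k (s', t') → t ≠ 0 → t' ≠ 0 → t = t' ∧ (t = 1 ∨ s = s'))
    (hsurj : ∀ x, (∃ a, f a = x) ∨ ∃ p, k p = x) : Att φ ≃ₜ X :=
  Continuous.homeoOfEquivCompactToT2
    (f := Equiv.ofBijective (lift f k h0 h1) ⟨lift_injective f k h0 h1 hf hkf hkk, by
      intro x
      rcases hsurj x with ⟨a, ha⟩ | ⟨p, hp⟩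
      · exact ⟨incl φ a, ha⟩
      · exact ⟨cellMap φ p, hp⟩⟩) (lift f k h0 h1).continuous

end path

end Att

end

noncomputable section
open scoped unitInterval ContinuousMap

section loops

variable {A B : Type} [TopologicalSpace A] [TopologicalSpace B]

/-- The map on the circle given by a loop. -/
def loopMap {x : A} (p : Path x x) : C(UnitAddCircle, A) where
  toFun := AddCircle.liftIco 1 0 p.extend
  continuous_toFun := AddCircle.liftIco_continuous (by simp) p.continuous_extend.continuousOn

lemma loopMap_coe {x : A} (p : Path x x) (t : I) : loopMap p ((t : ℝ) : UnitAddCircle) = p t := by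
  rcases eq_or_lt_of_le t.2.2 with h | h
  · have : t = 1 := Subtype.ext h
    subst this
    have h1 : (((1 : I) : ℝ) : UnitAddCircle) = ((0 : ℝ) : UnitAddCircle) := by
      simp
    rw [h1]
    show AddCircle.liftIco 1 0 p.extend _ = _
    rw [AddCircle.liftIco_zero_coe_apply (by simp)]
    simp
  · show AddCircle.liftIco 1 0 p.extend _ = _
    rw [AddCircle.liftIco_zero_coe_apply ⟨t.2.1, h⟩, Path.extend_extends']

lemma exists_coe_eq (s : UnitAddCircle) : ∃ t : I, ((t : ℝ) : UnitAddCircle) = s ∧ (t : ℝ) < 1 := by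
  obtain ⟨t, ht, rfl⟩ : ∃ t ∈ Set.Ico (0 : ℝ) 1, ((t : ℝ) : UnitAddCircle) = s := by
    have := AddCircle.coe_image_Ico_eq (1 : ℝ) 0
    rw [zero_add] at this
    have h : s ∈ (Set.univ : Set UnitAddCircle) := trivial
    rw [← this] at h
    exact h
  exact ⟨⟨t, ht.1, ht.2.le⟩, rfl, ht.2⟩

lemma ext_circle {f g : C(UnitAddCircle, A)}
    (h : ∀ t : I, f ((t : ℝ) : UnitAddCircle) = g ((t : ℝ) : UnitAddCircle)) : f = g := by
  ext s
  obtain ⟨t, rfl, -⟩ := exists_coe_eq s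
  exact h t

lemma loopMap_refl (x : A) : loopMap (Path.refl x) = .const _ x :=
  ext_circle fun t => by rw [loopMap_coe]; rfl

lemma comp_loopMap {x : A} (p : Path x x) (f : C(A, B)) :
    f.comp (loopMap p) = loopMap (p.map f.continuous) :=
  ext_circle fun t => by
    rw [loopMap_coe, ContinuousMap.comp_apply, loopMap_coe]; rfl

lemma loopMap_homotopic {x : A} {p q : Path x x} (h : p.Homotopic q) :
    (loopMap p).Homotopic (loopMap q) := by
  obtain ⟨H⟩ := h
  let P : Path (ContinuousMap.const I x) (ContinuousMap.const I x) :=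
    { toFun := (H.toContinuousMap.comp .prodSwap).curry
      source' := by ext r; simp
      target' := by ext r; simp }
  refine ⟨⟨(loopMap P).uncurry.comp .prodSwap, fun s => ?_, fun s => ?_⟩⟩
  all_goals
    obtain ⟨t, rfl, -⟩ := exists_coe_eq s
    simp only [ContinuousMap.toFun_eq_coe, ContinuousMap.comp_apply, ContinuousMap.prodSwap_apply,
      ContinuousMap.uncurry_apply, Function.uncurry_apply_pair, loopMap_coe, P]
    simp

lemma loopMap_trans_comm {x y : A} (p : Path x y) (q : Path y x) :
    (loopMap (p.trans q)).Homotopic (loopMap (q.trans p)) := by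
  let H : C(I × UnitAddCircle, UnitAddCircle) :=
    ⟨fun z => z.2 + (((z.1 : ℝ) / 2 : ℝ) : UnitAddCircle), by
      have : Continuous fun z : I × UnitAddCircle => (((z.1 : ℝ) / 2 : ℝ) : UnitAddCircle) :=
        (AddCircle.continuous_mk' 1).comp (by fun_prop)
      fun_prop⟩
  refine ⟨⟨(loopMap (p.trans q)).comp H, fun s => ?_, fun s => ?_⟩⟩
  · simp [H]
  · obtain ⟨t, rfl, ht⟩ := exists_coe_eq s
    have h0 := t.2.1
    simp only [ContinuousMap.toFun_eq_coe, ContinuousMap.comp_apply, ContinuousMap.coe_mk, H,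
      Set.Icc.coe_one]
    rw [loopMap_coe, ← AddCircle.coe_add]
    by_cases h : (t : ℝ) ≤ 1 / 2
    · have := loopMap_coe (p.trans q) ⟨t + 1 / 2, by linarith, by linarith⟩
      rw [this, ← Path.extend_extends' (p.trans q), ← Path.extend_extends' (q.trans p),
        Path.extend_trans_of_half_le _ _ (by simpa using h0), Path.extend_trans_of_le_half _ _ h]
      congr 1; ring
    · push Not at h
      have h' : ((t + 1 / 2 : ℝ) : UnitAddCircle) = ((t - 1 / 2 : ℝ) : UnitAddCircle) := by
        have : (t + 1 / 2 : ℝ) = (t - 1 / 2) + 1 := by ring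
        rw [this, AddCircle.coe_add, AddCircle.coe_period, add_zero]
      rw [h']
      have := loopMap_coe (p.trans q) ⟨t - 1 / 2, by linarith, by linarith⟩
      rw [this, ← Path.extend_extends' (p.trans q), ← Path.extend_extends' (q.trans p),
        Path.extend_trans_of_le_half _ _ (by simp; linarith), Path.extend_trans_of_half_le _ _ h.le]
      congr 1; ring

lemma loopMap_conj {x y : A} (γ : Path y x) (q : Path x x) :
    (loopMap (γ.trans (q.trans γ.symm))).Homotopic (loopMap q) := by
  refine (loopMap_trans_comm _ _).trans (loopMap_homotopic ?_)
  open Path.Homotopic.Quotient in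
  rw [← eq]
  simp only [mk_trans, mk_symm]
  rw [trans_assoc, symm_trans, trans_refl]

lemma loopMap_eq_of_forall {x y : A} (p : Path x x) (q : Path y y) (h : ∀ t, p t = q t) :
    loopMap p = loopMap q :=
  ext_circle fun t => by rw [loopMap_coe, loopMap_coe, h]

end loops

end

noncomputable section
open scoped unitInterval ContinuousMap

namespace Wedge

variable {ι : Type} {S : ι → Type} [∀ i, TopologicalSpace (S i)] {b : ∀ i, S i}
  {Z : Type} [TopologicalSpace Z]

/-- The basepoint of a wedge. -/
def base (S : ι → Type) [∀ i, TopologicalSpace (S i)] (b : ∀ i, S i) : Wedge S b :=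
  Quot.mk _ (.inl ())

/-- The inclusion of a summand. -/
def inc (b : ∀ i, S i) (i : ι) : C(S i, Wedge S b) :=
  ⟨fun x => Quot.mk _ (.inr ⟨i, x⟩),
    continuous_quot_mk.comp (continuous_inr.comp continuous_sigmaMk)⟩

lemma inc_base (i : ι) : inc b i (b i) = base S b :=
  (Quot.sound ⟨rfl, i, rfl⟩).symm

/-- The universal property of the wedge. -/
def lift (z : Z) (f : ∀ i, C(S i, Z)) (h : ∀ i, f i (b i) = z) : C(Wedge S b, Z) where
  toFun := Quot.lift (Sum.elim (fun _ => z) fun p => f p.1 p.2) (by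
    rintro _ _ ⟨rfl, i, rfl⟩
    exact (h i).symm)
  continuous_toFun := continuous_quot_lift _
    (continuous_const.sumElim (continuous_sigma fun i => (f i).continuous))

lemma hom_ext {f g : C(Wedge S b, Z)} (h0 : f (base S b) = g (base S b))
    (h : ∀ i x, f (inc b i x) = g (inc b i x)) : f = g := by
  ext x
  induction x using Quot.ind with
  | _ x => rcases x with ⟨⟩ | ⟨i, x⟩
           · exact h0
           · exact h i x

end Wedge

/-- The wedge of a family of standard pieces. -/
abbrev PieceWedge {ι : Type} (c : ι → WedgePiece) : Type :=
  Wedge (fun i => (c i).space) (fun i => (c i).pt)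

/-- The basepoint of the wedge of a family of standard pieces. -/
abbrev PieceWedge.base {ι : Type} (c : ι → WedgePiece) : PieceWedge c :=
  Wedge.base (fun i => (c i).space) (fun i => (c i).pt)

/-- Extension of a family of pieces by one piece. -/
def addPiece {ι : Type} (c : ι → WedgePiece) (p : WedgePiece) : Option ι → WedgePiece
  | none => p
  | some i => c i

/-- A space with the universal property of the wedge of `PieceWedge c` and `p` is the wedge of
the extended family. -/
lemma homeo_addPiece {ι : Type} (c : ι → WedgePiece) (p : WedgePiece) {Y : Type}
    [TopologicalSpace Y] (i : C(PieceWedge c, Y)) (j : C(p.space, Y))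
    (hij : i (PieceWedge.base c) = j p.pt)
    (hlift : ∀ (f : C(PieceWedge c, PieceWedge (addPiece c p)))
      (g : C(p.space, PieceWedge (addPiece c p))), f (PieceWedge.base c) = g p.pt →
      ∃ h : C(Y, PieceWedge (addPiece c p)), h.comp i = f ∧ h.comp j = g)
    (hext : ∀ f g : C(Y, Y), f.comp i = g.comp i → f.comp j = g.comp j → f = g) :
    Nonempty (Y ≃ₜ PieceWedge (addPiece c p)) := by
  let b := PieceWedge.base (addPiece c p)
  let F : C(PieceWedge c, PieceWedge (addPiece c p)) :=
    Wedge.lift b (fun k => Wedge.inc (fun i => (addPiece c p i).pt) (some k))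
      (fun k => Wedge.inc_base (some k))
  let G : C(p.space, PieceWedge (addPiece c p)) :=
    Wedge.inc (fun i => (addPiece c p i).pt) none
  have hFG : F (PieceWedge.base c) = G p.pt :=
    (Wedge.inc_base (b := fun i => (addPiece c p i).pt) none).symm
  obtain ⟨h, h1, h2⟩ := hlift F G hFG
  let K : C(PieceWedge (addPiece c p), Y) :=
    Wedge.lift (i (PieceWedge.base c))
      (fun o => match o with
        | none => j
        | some k => i.comp (Wedge.inc (fun i => (c i).pt) k))
      (fun o => match o with
        | none => hij.symm
        | some k => congrArg i (Wedge.inc_base (b := fun i => (c i).pt) k))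
  have hK1 : h.comp K = .id _ := by
    refine Wedge.hom_ext ?_ ?_
    · show h (i (PieceWedge.base c)) = b
      exact DFunLike.congr_fun h1 _
    · rintro (_ | k) x
      · exact DFunLike.congr_fun h2 x
      · exact DFunLike.congr_fun h1 (Wedge.inc (fun i => (c i).pt) k x)
  have hK2 : K.comp h = .id _ := by
    refine hext _ _ ?_ ?_
    · rw [ContinuousMap.comp_assoc, h1]
      refine Wedge.hom_ext rfl fun k x => rfl
    · rw [ContinuousMap.comp_assoc, h2]
      rfl
  exact ⟨⟨⟨h, K, fun x => DFunLike.congr_fun hK2 x, fun x => DFunLike.congr_fun hK1 x⟩,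
    h.continuous, K.continuous⟩⟩

/-- The homotopy type of a finite wedge of standard pieces. -/
def IsWedge (A : Type) [TopologicalSpace A] : Prop :=
  ∃ (ι : Type) (_ : Finite ι) (c : ι → WedgePiece), Nonempty (A ≃ₕ PieceWedge c)

namespace IsWedge

variable {A B : Type} [TopologicalSpace A] [TopologicalSpace B]

lemma congr (e : A ≃ₕ B) (h : IsWedge B) : IsWedge A := by
  obtain ⟨ι, hι, c, ⟨E⟩⟩ := h
  exact ⟨ι, hι, c, ⟨e.trans E⟩⟩

lemma of_homeo_unit (e : A ≃ₕ Unit) : IsWedge A := by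
  let c : Empty → WedgePiece := fun i => i.elim
  refine ⟨Empty, inferInstance, c, ⟨e.trans ?_⟩⟩
  refine Homeomorph.toHomotopyEquiv ?_
  refine ⟨⟨fun _ => PieceWedge.base c, fun _ => (), fun _ => rfl, fun x => ?_⟩,
    continuous_const, continuous_const⟩
  induction x using Quot.ind with
  | _ x => rcases x with ⟨⟩ | ⟨i, x⟩
           · rfl
           · exact i.elim

end IsWedge

section attachPiece

set_option linter.unusedSectionVars false

variable {S : Type} [TopologicalSpace S] [LocallyCompactSpace S] [Inhabited S]

/-- Attaching the cone on `S` along a constant map adds a piece. -/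
lemma att_const_homeo {ι : Type} (c : ι → WedgePiece) (p : WedgePiece)
    (e : Att (.const S () : C(S, Unit)) ≃ₜ p.space)
    (he : e (Att.incl _ ()) = p.pt) :
    Nonempty (Att (.const S (PieceWedge.base c)) ≃ₜ PieceWedge (addPiece c p)) := by
  let w := PieceWedge.base c
  let φ : C(S, PieceWedge c) := .const S w
  let J : C(Att (.const S () : C(S, Unit)), Att φ) :=
    Att.lift ((Att.incl φ).comp (.const _ w)) (Att.cellMap φ)
      (fun s => Att.cellMap_zero s) (fun s s' => by rw [Att.cellMap_one, Att.cellMap_one])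
  let E : C(Att (.const S () : C(S, Unit)), p.space) := ⟨e, e.continuous⟩
  let E' : C(p.space, Att (.const S () : C(S, Unit))) := ⟨e.symm, e.symm.continuous⟩
  have hEE' : E'.comp E = .id _ := ContinuousMap.ext e.symm_apply_apply
  have hE'E : E.comp E' = .id _ := ContinuousMap.ext e.apply_symm_apply
  refine homeo_addPiece c p (Att.incl φ) (J.comp E') ?_ ?_ ?_
  · show Att.incl φ w = J (e.symm p.pt)
    rw [← he, e.symm_apply_apply]; rfl
  · intro f g hfg
    have hg : g.comp E ∘ Att.incl _ = fun _ => f w := by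
      funext u
      show g (e (Att.incl _ u)) = _
      rw [he, hfg]
    refine ⟨Att.lift f ((g.comp E).comp (Att.cellMap _)) ?_ ?_, ?_, ?_⟩
    · intro s
      rw [ContinuousMap.comp_apply, Att.cellMap_zero]
      exact congrFun hg ()
    · intro s s'
      show g (E (Att.cellMap _ (s, 1))) = g (E (Att.cellMap _ (s', 1)))
      rw [Att.cellMap_one, Att.cellMap_one]
    · rfl
    · rw [← ContinuousMap.comp_assoc]
      have : ∀ F : C(Att (.const S () : C(S, Unit)), PieceWedge (addPiece c p)),
          F = g.comp E → F.comp E' = g := by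
        rintro F rfl
        rw [ContinuousMap.comp_assoc, hE'E]; rfl
      apply this
      ext x
      · exact (congrFun hg ()).symm
      · rfl
  · intro f g h1 h2
    ext x
    · exact DFunLike.congr_fun h1 x
    · have := congrArg (fun F => F.comp E) h2
      simp only [ContinuousMap.comp_assoc] at this
      rw [hEE'] at this
      exact DFunLike.congr_fun this (Att.cellMap _ x)

lemma IsWedge.att_of_homotopic_const {A : Type} [TopologicalSpace A] [PathConnectedSpace A]
    (p : WedgePiece) (e : Att (.const S () : C(S, Unit)) ≃ₜ p.space)
    (he : e (Att.incl _ ()) = p.pt) (hA : IsWedge A) {φ : C(S, A)} {a : A}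
    (hφ : φ.Homotopic (.const S a)) : IsWedge (Att φ) := by
  obtain ⟨ι, hι, c, ⟨E⟩⟩ := hA
  obtain ⟨H⟩ := att_const_homeo c p e he
  have h : (E.toFun.comp φ).Homotopic (.const S (PieceWedge.base c)) := by
    have h1 : (E.toFun.comp φ).Homotopic (.const S (E.toFun a)) :=
      ContinuousMap.Homotopic.comp (.refl E.toFun) hφ
    obtain ⟨D⟩ := E.right_inv
    obtain ⟨γ⟩ := PathConnectedSpace.joined a (E.invFun (PieceWedge.base c))
    have γ' : Path (E.toFun a) (PieceWedge.base c) :=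
      (γ.map E.toFun.continuous).trans (D.evalAt (PieceWedge.base c))
    exact h1.trans ⟨γ'.toHomotopyConst⟩
  obtain ⟨E'⟩ := Att.equiv_of_homotopic E h
  exact ⟨Option ι, inferInstance, addPiece c p, ⟨E'.trans H.toHomotopyEquiv⟩⟩

end attachPiece

end

noncomputable section
open scoped unitInterval ContinuousMap

/-- A point of the unit circle from its coordinates. -/
def mkS1 (a b : ℝ) (h : a ^ 2 + b ^ 2 = 1) : Circle2 :=
  ⟨!₂[a, b], by simp [EuclideanSpace.norm_eq, Fin.sum_univ_two, h]⟩

/-- A point of the unit sphere from its coordinates. -/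
def mkS2 (a b c : ℝ) (h : a ^ 2 + b ^ 2 + c ^ 2 = 1) : Sphere2 :=
  ⟨!₂[a, b, c], by simp [EuclideanSpace.norm_eq, Fin.sum_univ_three, h]⟩

lemma exists_mkS1 (x : Circle2) : ∃ a b h, x = mkS1 a b h := by
  have h := x.2
  rw [mem_sphere_zero_iff_norm, EuclideanSpace.norm_eq, Real.sqrt_eq_one] at h
  simp only [Fin.sum_univ_two, Real.norm_eq_abs, sq_abs] at h
  refine ⟨_, _, h, Subtype.ext ?_⟩
  ext i; fin_cases i <;> rfl

lemma exists_mkS2 (x : Sphere2) : ∃ a b c h, x = mkS2 a b c h := by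
  have h := x.2
  rw [mem_sphere_zero_iff_norm, EuclideanSpace.norm_eq, Real.sqrt_eq_one] at h
  simp only [Fin.sum_univ_three, Real.norm_eq_abs, sq_abs] at h
  refine ⟨_, _, _, h, Subtype.ext ?_⟩
  ext i; fin_cases i <;> rfl

lemma Circle2.pt_eq : Circle2.pt = mkS1 1 0 (by norm_num) := by
  refine Subtype.ext ?_
  ext i; fin_cases i <;> simp [Circle2.pt, mkS1]

lemma Sphere2.pt_eq : Sphere2.pt = mkS2 1 0 0 (by norm_num) := by
  refine Subtype.ext ?_
  ext i; fin_cases i <;> simp [Sphere2.pt, mkS2]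

lemma continuous_mkS1 {T : Type} [TopologicalSpace T] {a b : T → ℝ} (ha : Continuous a)
    (hb : Continuous b) (h : ∀ t, a t ^ 2 + b t ^ 2 = 1) :
    Continuous fun t => mkS1 (a t) (b t) (h t) := by
  refine Continuous.subtype_mk ((PiLp.continuous_toLp 2 _).comp (continuous_pi fun i => ?_)) _
  fin_cases i <;> simpa

lemma continuous_mkS2 {T : Type} [TopologicalSpace T] {a b c : T → ℝ} (ha : Continuous a)
    (hb : Continuous b) (hc : Continuous c) (h : ∀ t, a t ^ 2 + b t ^ 2 + c t ^ 2 = 1) :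
    Continuous fun t => mkS2 (a t) (b t) (c t) (h t) := by
  refine Continuous.subtype_mk ((PiLp.continuous_toLp 2 _).comp (continuous_pi fun i => ?_)) _
  fin_cases i <;> simpa

/-- The sign of a boolean. -/
def bsgn (b : Bool) : ℝ := if b then 1 else -1

lemma bsgn_sq (b : Bool) : bsgn b ^ 2 = 1 := by cases b <;> simp [bsgn]

lemma continuous_bsgn : Continuous bsgn := continuous_of_discreteTopology

open Real in
lemma pi_mul_mem (t : I) : π * (t : ℝ) ∈ Set.Icc 0 π :=
  ⟨mul_nonneg pi_pos.le t.2.1, by have := pi_pos; have := t.2.2; nlinarith⟩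

open Real in
lemma cos_pi_mul_inj {t t' : I} (h : cos (π * t) = cos (π * t')) : t = t' := by
  have := injOn_cos (pi_mul_mem t) (pi_mul_mem t') h
  exact Subtype.ext (mul_left_cancel₀ pi_ne_zero this)

open Real in
lemma sin_pi_mul_pos {t : I} (h0 : t ≠ 0) (h1 : t ≠ 1) : 0 < sin (π * t) := by
  have a : 0 < (t : ℝ) := lt_of_le_of_ne t.2.1 fun h => h0 (Subtype.ext h.symm)
  have b : (t : ℝ) < 1 := lt_of_le_of_ne t.2.2 fun h => h1 (Subtype.ext h)
  exact sin_pos_of_pos_of_lt_pi (by positivity) (by have := pi_pos; nlinarith)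

open Real in
lemma exists_cos_pi_mul {a : ℝ} (h : a ^ 2 ≤ 1) :
    ∃ t : I, cos (π * t) = a ∧ sin (π * t) = √(1 - a ^ 2) := by
  have h1 : -1 ≤ a := by nlinarith
  have h2 : a ≤ 1 := by nlinarith
  refine ⟨⟨arccos a / π, div_nonneg (arccos_nonneg a) pi_pos.le,
    div_le_one_of_le₀ (arccos_le_pi a) pi_pos.le⟩, ?_, ?_⟩
  · rw [mul_div_cancel₀ _ pi_ne_zero, cos_arccos h1 h2]
  · rw [mul_div_cancel₀ _ pi_ne_zero, sin_arccos]

open Real in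
lemma exists_circle_homeo : ∃ e : Att (.const Bool () : C(Bool, Unit)) ≃ₜ WedgePiece.circle.space,
    e (Att.incl _ ()) = WedgePiece.circle.pt := by
  let f : C(Unit, Circle2) := .const _ Circle2.pt
  have hk : ∀ p : Bool × I, cos (π * p.2) ^ 2 + (bsgn p.1 * sin (π * p.2)) ^ 2 = 1 := fun p => by
    rw [mul_pow, bsgn_sq, one_mul, cos_sq_add_sin_sq]
  let k : C(Bool × I, Circle2) :=
    ⟨fun p => mkS1 (cos (π * p.2)) (bsgn p.1 * sin (π * p.2)) (hk p),
      continuous_mkS1 (by fun_prop) ((continuous_bsgn.comp continuous_fst).mul (by fun_prop)) hk⟩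
  refine ⟨Att.homeo (X := Circle2) f k ?_ ?_ ?_ ?_ ?_ ?_, rfl⟩
  · intro s; simp [f, k, Circle2.pt_eq]
  · intro s s'; simp [k]
  · intro a b _; rfl
  · intro s t _ h
    have h : k (s, t) = Circle2.pt := h
    rw [Circle2.pt_eq] at h
    have h1 : Real.cos (π * t) = 1 := congrArg (fun v : Circle2 => v.1 0) h
    exact cos_pi_mul_inj (by simpa using h1)
  · intro s t s' t' h h0 h0'
    have h1 : cos (π * t) = cos (π * t') := congrArg (fun v : Circle2 => v.1 0) h
    have h2 : bsgn s * sin (π * t) = bsgn s' * sin (π * t') :=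
      congrArg (fun v : Circle2 => v.1 1) h
    obtain rfl := cos_pi_mul_inj h1
    refine ⟨rfl, ?_⟩
    by_cases ht : t = 1
    · exact .inl ht
    · have := mul_right_cancel₀ (sin_pi_mul_pos h0 ht).ne' h2
      right
      cases s <;> cases s' <;> simp [bsgn] at this ⊢ <;> norm_num at this
  · intro x
    obtain ⟨a, b, h, rfl⟩ := exists_mkS1 x
    right
    obtain ⟨t, h1, h2⟩ := exists_cos_pi_mul (a := a) (by nlinarith)
    have hb : 1 - a ^ 2 = b ^ 2 := by linarith
    rw [hb, sqrt_sq_eq_abs] at h2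
    rcases le_total 0 b with h0 | h0
    · refine ⟨(true, t), ?_⟩
      simp only [k, ContinuousMap.coe_mk, h1, h2, abs_of_nonneg h0, bsgn]
      simp
    · refine ⟨(false, t), ?_⟩
      simp only [k, ContinuousMap.coe_mk, h1, h2, abs_of_nonpos h0, bsgn]
      simp

/-- The embedding of the additive circle in the complex plane. -/
def cexp (s : UnitAddCircle) : ℂ := AddCircle.toCircle s

lemma continuous_cexp : Continuous cexp :=
  continuous_subtype_val.comp AddCircle.continuous_toCircle

lemma cexp_sq (s : UnitAddCircle) : (cexp s).re ^ 2 + (cexp s).im ^ 2 = 1 := by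
  have : ‖cexp s‖ = 1 := Circle.norm_coe _
  rw [← sq_eq_sq₀ (norm_nonneg _) zero_le_one, Complex.sq_norm, Complex.normSq_apply] at this
  nlinarith

lemma cexp_inj {s s' : UnitAddCircle} (h1 : (cexp s).re = (cexp s').re)
    (h2 : (cexp s).im = (cexp s').im) : s = s' :=
  AddCircle.injective_toCircle one_ne_zero (Subtype.ext (Complex.ext h1 h2))

open Real in
lemma cexp_coe (t : ℝ) : (cexp t).re = cos (2 * π * t) ∧ (cexp t).im = sin (2 * π * t) := by
  simp only [cexp, AddCircle.toCircle_apply_mk, Circle.coe_exp]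
  rw [Complex.exp_ofReal_mul_I_re, Complex.exp_ofReal_mul_I_im]
  simp

lemma exists_cexp (a b : ℝ) : ∃ s : UnitAddCircle,
    √(a ^ 2 + b ^ 2) * (cexp s).re = a ∧ √(a ^ 2 + b ^ 2) * (cexp s).im = b := by
  set z : ℂ := ⟨a, b⟩ with hz
  refine ⟨((z.arg / (2 * Real.pi) : ℝ) : UnitAddCircle), ?_⟩
  obtain ⟨h1, h2⟩ := cexp_coe (z.arg / (2 * Real.pi))
  have : 2 * Real.pi * (z.arg / (2 * Real.pi)) = z.arg :=
    mul_div_cancel₀ _ (by have := Real.pi_pos; positivity)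
  rw [h1, h2, this]
  have hn : √(a ^ 2 + b ^ 2) = ‖z‖ := by
    rw [Complex.norm_eq_sqrt_sq_add_sq]
  rw [hn, Complex.norm_mul_cos_arg, Complex.norm_mul_sin_arg]
  exact ⟨rfl, rfl⟩

open Real in
lemma exists_sphere_homeo : ∃ e : Att (.const UnitAddCircle () : C(UnitAddCircle, Unit)) ≃ₜ
    WedgePiece.sphere.space, e (Att.incl _ ()) = WedgePiece.sphere.pt := by
  let f : C(Unit, Sphere2) := .const _ Sphere2.pt
  have hk : ∀ p : UnitAddCircle × I, cos (π * p.2) ^ 2 + (sin (π * p.2) * (cexp p.1).re) ^ 2 +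
      (sin (π * p.2) * (cexp p.1).im) ^ 2 = 1 := fun p => by
    have h1 := cexp_sq p.1
    have h2 := sin_sq_add_cos_sq (π * p.2)
    linear_combination sin (π * p.2) ^ 2 * h1 + h2
  let k : C(UnitAddCircle × I, Sphere2) :=
    ⟨fun p => mkS2 (cos (π * p.2)) (sin (π * p.2) * (cexp p.1).re) (sin (π * p.2) * (cexp p.1).im)
        (hk p),
      continuous_mkS2 (by fun_prop)
        (.mul (by fun_prop) (Complex.continuous_re.comp (continuous_cexp.comp continuous_fst)))
        (.mul (by fun_prop) (Complex.continuous_im.comp (continuous_cexp.comp continuous_fst))) hk⟩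
  refine ⟨Att.homeo (X := Sphere2) f k ?_ ?_ ?_ ?_ ?_ ?_, rfl⟩
  · intro s; simp [f, k, Sphere2.pt_eq]
  · intro s s'; simp [k]
  · intro a b _; rfl
  · intro s t _ h
    have h : k (s, t) = Sphere2.pt := h
    rw [Sphere2.pt_eq] at h
    have h1 : Real.cos (π * t) = 1 := congrArg (fun v : Sphere2 => v.1 0) h
    exact cos_pi_mul_inj (by simpa using h1)
  · intro s t s' t' h h0 h0'
    have h1 : cos (π * t) = cos (π * t') := congrArg (fun v : Sphere2 => v.1 0) h
    have h2 : sin (π * t) * (cexp s).re = sin (π * t') * (cexp s').re :=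
      congrArg (fun v : Sphere2 => v.1 1) h
    have h3 : sin (π * t) * (cexp s).im = sin (π * t') * (cexp s').im :=
      congrArg (fun v : Sphere2 => v.1 2) h
    obtain rfl := cos_pi_mul_inj h1
    refine ⟨rfl, ?_⟩
    by_cases ht : t = 1
    · exact .inl ht
    · have hs := (sin_pi_mul_pos h0 ht).ne'
      exact .inr (cexp_inj (mul_left_cancel₀ hs h2) (mul_left_cancel₀ hs h3))
  · intro x
    obtain ⟨a, b, c, h, rfl⟩ := exists_mkS2 x
    right
    obtain ⟨t, h1, h2⟩ := exists_cos_pi_mul (a := a) (by nlinarith)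
    obtain ⟨s, h3, h4⟩ := exists_cexp b c
    have hb : 1 - a ^ 2 = b ^ 2 + c ^ 2 := by linarith
    rw [hb] at h2
    refine ⟨(s, t), ?_⟩
    simp only [k, ContinuousMap.coe_mk, h1, h2, h3, h4]

end

noncomputable section
open scoped unitInterval ContinuousMap

/-- A point of the projective plane from homogeneous coordinates of norm one. -/
def mkRP (a b c : ℝ) (h : a ^ 2 + b ^ 2 + c ^ 2 = 1) : RP2 := Quot.mk _ (mkS2 a b c h)

lemma mkRP_congr {a b c a' b' c' : ℝ} {h h'} (ha : a = a') (hb : b = b') (hc : c = c') :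
    mkRP a b c h = mkRP a' b' c' h' := by subst ha hb hc; rfl

/-- The quadratic embedding of the projective plane. -/
def RP2.quad : RP2 → Fin 3 → Fin 3 → ℝ :=
  Quot.lift (fun x i j => x.1 i * x.1 j) (by
    intro x y h
    funext i j
    simp [h])

lemma RP2.continuous_quad : Continuous RP2.quad := by
  refine continuous_quot_lift _ (continuous_pi fun i => continuous_pi fun j => ?_)
  have : ∀ i : Fin 3, Continuous fun x : Sphere2 => x.1 i := fun i => by fun_prop
  exact (this i).mul (this j)

lemma mkRP_neg {a b c : ℝ} (h) (h') : mkRP (-a) (-b) (-c) h' = mkRP a b c h := by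
  refine Quot.sound ?_
  ext i; fin_cases i <;> simp [mkS2]

lemma quad_inj {a b c a' b' c' : ℝ} {h h'}
    (H : RP2.quad (mkRP a b c h) = RP2.quad (mkRP a' b' c' h')) :
    (a = a' ∧ b = b' ∧ c = c') ∨ (a = -a' ∧ b = -b' ∧ c = -c') := by
  have key : ∀ i j : Fin 3, ![a, b, c] i * ![a, b, c] j = ![a', b', c'] i * ![a', b', c'] j :=
    fun i j => congrFun (congrFun H i) j
  have h00 := key 0 0
  have h01 := key 0 1
  have h02 := key 0 2
  have h11 := key 1 1
  have h12 := key 1 2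
  have h22 := key 2 2
  simp at h00 h01 h02 h11 h12 h22
  have hs : (a * a' + b * b' + c * c' - 1) * (a * a' + b * b' + c * c' + 1) = 0 := by
    have : (a * a' + b * b' + c * c') ^ 2 = 1 := by
      calc _ = (a * a) * (a' * a') + (b * b) * (b' * b') + (c * c) * (c' * c')
            + 2 * ((a * b) * (a' * b') + (a * c) * (a' * c') + (b * c) * (b' * c')) := by ring
        _ = (a' ^ 2 + b' ^ 2 + c' ^ 2) ^ 2 := by
          rw [h00, h01, h02, h11, h12, h22]; ring
        _ = 1 := by rw [h']; norm_num
    linear_combination this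
  rcases mul_eq_zero.1 hs with h1 | h1
  · left
    have : (a - a') ^ 2 + (b - b') ^ 2 + (c - c') ^ 2 = 0 := by
      linear_combination h + h' - 2 * h1
    refine ⟨?_, ?_, ?_⟩ <;> nlinarith [sq_nonneg (a - a'), sq_nonneg (b - b'), sq_nonneg (c - c')]
  · right
    have : (a + a') ^ 2 + (b + b') ^ 2 + (c + c') ^ 2 = 0 := by
      linear_combination h + h' + 2 * h1
    refine ⟨?_, ?_, ?_⟩ <;> nlinarith [sq_nonneg (a + a'), sq_nonneg (b + b'), sq_nonneg (c + c')]

lemma mkRP_inj {a b c a' b' c' : ℝ} {h h'} (H : mkRP a b c h = mkRP a' b' c' h') :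
    (a = a' ∧ b = b' ∧ c = c') ∨ (a = -a' ∧ b = -b' ∧ c = -c') :=
  quad_inj (congrArg _ H)

lemma exists_mkRP (x : RP2) : ∃ a b c h, x = mkRP a b c h ∧ 0 ≤ c := by
  induction x using Quot.ind with
  | _ x =>
    obtain ⟨a, b, c, h, rfl⟩ := exists_mkS2 x
    rcases le_total 0 c with hc | hc
    · exact ⟨a, b, c, h, rfl, hc⟩
    · exact ⟨-a, -b, -c, by linarith, (mkRP_neg _ _).symm, by linarith⟩

instance : T2Space RP2 := by
  refine T2Space.of_injective_continuous (f := RP2.quad) ?_ RP2.continuous_quad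
  intro x y hxy
  obtain ⟨a, b, c, h, rfl, -⟩ := exists_mkRP x
  obtain ⟨a', b', c', h', rfl, -⟩ := exists_mkRP y
  rcases quad_inj hxy with ⟨rfl, rfl, rfl⟩ | ⟨rfl, rfl, rfl⟩
  · rfl
  · exact mkRP_neg _ _

lemma RP2.pt_eq : RP2.pt = mkRP 1 0 0 (by norm_num) := by
  rw [RP2.pt, Sphere2.pt_eq]; rfl

/-- Half angles on the unit interval. -/
abbrev hcos (t : I) : ℝ := Real.cos (Real.pi / 2 * t)
/-- Half angles on the unit interval. -/
abbrev hsin (t : I) : ℝ := Real.sin (Real.pi / 2 * t)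

open Real in
lemma half_mem (t : I) : π / 2 * (t : ℝ) ∈ Set.Icc (-(π / 2)) (π / 2) := by
  have := pi_pos; have h1 := t.2.1; have h2 := t.2.2
  constructor <;> nlinarith

lemma hsin_inj {t t' : I} (h : hsin t = hsin t') : t = t' := by
  have := Real.injOn_sin (half_mem t) (half_mem t') h
  exact Subtype.ext (mul_left_cancel₀ (by have := Real.pi_pos; positivity) this)

lemma hsin_pos {t : I} (h : t ≠ 0) : 0 < hsin t := by
  have a : 0 < (t : ℝ) := lt_of_le_of_ne t.2.1 fun h' => h (Subtype.ext h'.symm)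
  have := Real.pi_pos
  have := (half_mem t).2
  exact Real.sin_pos_of_pos_of_lt_pi (by positivity) (by linarith)

lemma hcos_pos {t : I} (h : t ≠ 1) : 0 < hcos t := by
  have a : (t : ℝ) < 1 := lt_of_le_of_ne t.2.2 fun h' => h (Subtype.ext h')
  have := Real.pi_pos
  have h1 := t.2.1
  refine Real.cos_pos_of_mem_Ioo ⟨?_, ?_⟩ <;> nlinarith

lemma rpArc_aux (p : Bool × I) : (bsgn p.1 * hcos p.2) ^ 2 + hsin p.2 ^ 2 + 0 ^ 2 = 1 := by
  rw [mul_pow, bsgn_sq, one_mul]; simp [hcos, hsin]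

/-- The two arcs of the projective line. -/
def rpArc : C(Bool × I, RP2) :=
  ⟨fun p => mkRP (bsgn p.1 * hcos p.2) (hsin p.2) 0 (rpArc_aux p),
    continuous_quot_mk.comp (continuous_mkS2
      ((continuous_bsgn.comp continuous_fst).mul (by fun_prop)) (by fun_prop) (by fun_prop)
      rpArc_aux)⟩

lemma rpArc_zero (b : Bool) : rpArc (b, 0) = RP2.pt := by
  rw [RP2.pt_eq]
  cases b
  · rw [← mkRP_neg (a := 1) (b := 0) (c := 0) (by norm_num) (by norm_num)]
    exact mkRP_congr (by simp [bsgn, hcos]) (by simp [hsin]) (by simp)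
  · exact mkRP_congr (by simp [bsgn, hcos]) (by simp [hsin]) (by simp)

lemma rpArc_one (b b' : Bool) : rpArc (b, 1) = rpArc (b', 1) :=
  mkRP_congr (by simp [hcos]) (by simp) rfl

lemma rpDisc_aux (p : UnitAddCircle × I) :
    (hcos p.2 * (cexp p.1).re) ^ 2 + (hcos p.2 * (cexp p.1).im) ^ 2 + hsin p.2 ^ 2 = 1 := by
  have h1 := cexp_sq p.1
  have h2 := Real.sin_sq_add_cos_sq (Real.pi / 2 * p.2)
  linear_combination hcos p.2 ^ 2 * h1 + h2

/-- The two-cell of the projective plane. -/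
def rpDisc : C(UnitAddCircle × I, RP2) :=
  ⟨fun p => mkRP (hcos p.2 * (cexp p.1).re) (hcos p.2 * (cexp p.1).im) (hsin p.2) (rpDisc_aux p),
    continuous_quot_mk.comp (continuous_mkS2
      (.mul (by fun_prop) (Complex.continuous_re.comp (continuous_cexp.comp continuous_fst)))
      (.mul (by fun_prop) (Complex.continuous_im.comp (continuous_cexp.comp continuous_fst)))
      (by fun_prop) rpDisc_aux)⟩

/-- The evaluation of a path in a mapping space. -/
def evalPath {S A : Type} [TopologicalSpace S] [TopologicalSpace A] {p q : C(S, A)}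
    (K : Path p q) (s : S) : Path (p s) (q s) :=
  K.map (f := fun g : C(S, A) => g s) (by fun_prop)

/-- The arc of the mapping cone of a map from two points. -/
def cellArc {A : Type} [TopologicalSpace A] (φ : C(Bool, A)) (b : Bool) :
    Path (Att.incl φ (φ b)) (Att.apex φ) :=
  evalPath (Att.cell φ) b

/-- The loop obtained by attaching an arc at two points. -/
def arcPath {A : Type} [TopologicalSpace A] (φ : C(Bool, A)) :
    Path (Att.incl φ (φ true)) (Att.incl φ (φ false)) :=
  (cellArc φ true).trans (cellArc φ false).symm

/-- The square of the loop obtained by attaching an arc at one point. -/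
def sqLoop {A : Type} [TopologicalSpace A] (a : A) :
    Path (Att.incl (.const Bool a) a) (Att.incl (.const Bool a) a) :=
  (arcPath (.const Bool a)).trans (arcPath (.const Bool a))

/-- The one-skeleton of the projective plane. -/
def rpLine : C(Att (.const Bool ()), RP2) :=
  Att.lift (.const _ RP2.pt) rpArc rpArc_zero rpArc_one

lemma arcPath_apply {A W : Type} [TopologicalSpace A] [TopologicalSpace W] (φ : C(Bool, A))
    (g : C(Att φ, W)) (t : I) : g (arcPath φ t) = if h : (t : ℝ) ≤ 1 / 2 then
      g (Att.cellMap φ (true, ⟨2 * t, by have := t.2.1; positivity, by linarith⟩)) else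
      g (Att.cellMap φ (false, ⟨2 - 2 * t, by have := t.2.2; linarith, by linarith⟩)) := by
  rw [arcPath, Path.trans_apply]
  split_ifs with h
  · rfl
  · have : (σ ⟨2 * (t : ℝ) - 1, unitInterval.two_mul_sub_one_mem_iff.2
        ⟨(not_le.1 h).le, t.2.2⟩⟩ : I) = ⟨2 - 2 * t, by have := t.2.2; linarith, by linarith⟩ :=
      Subtype.ext (by simp [unitInterval.symm]; ring)
    rw [← this]; rfl

open Real in
lemma rpLine_arcPath (t : I) : rpLine (arcPath _ t) =
    mkRP (cos (π * t)) (sin (π * t)) 0 (by simp) := by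
  rw [arcPath_apply]
  split_ifs with h
  · have e : π / 2 * (2 * (t : ℝ)) = π * t := by ring
    exact mkRP_congr (by simp [bsgn, hcos, e]) (by simp [hsin, e]) rfl
  · have e : π / 2 * (2 - 2 * (t : ℝ)) = π - π * t := by ring
    exact mkRP_congr (by simp [bsgn, hcos, e]) (by simp [hsin, e]) rfl

open Real in
lemma rpLine_sqLoop (t : I) :
    rpLine (sqLoop () t) = mkRP (cos (2 * π * t)) (sin (2 * π * t)) 0 (by simp) := by
  rw [sqLoop, Path.trans_apply]
  split_ifs with h
  · rw [rpLine_arcPath]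
    have e : π * (2 * (t : ℝ)) = 2 * π * t := by ring
    exact mkRP_congr (by simp only [e]) (by simp only [e]) rfl
  · rw [rpLine_arcPath]
    have e : π * (2 * (t : ℝ) - 1) = 2 * π * t - π := by ring
    rw [← mkRP_neg (a := cos (2 * π * t)) (b := sin (2 * π * t)) (c := 0) (by simp) (by simp)]
    exact mkRP_congr (by simp only [e, cos_sub_pi]) (by simp only [e, sin_sub_pi]) (by simp)

lemma rpLine_third (x : Att (.const Bool ())) : ∃ a b h, rpLine x = mkRP a b 0 h := by
  induction x using Quot.ind with
  | _ x =>
    rcases x with u | ⟨b, t⟩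
    · exact ⟨1, 0, by norm_num, RP2.pt_eq⟩
    · exact ⟨_, _, _, rfl⟩

lemma rpLine_injective : Function.Injective rpLine := by
  refine Att.lift_injective _ _ _ _ (fun _ _ _ => rfl) ?_ ?_
  · intro s t _ h
    have h : rpArc (s, t) = RP2.pt := h
    rw [RP2.pt_eq] at h
    by_contra h0
    have := hsin_pos h0
    rcases mkRP_inj h with ⟨-, h, -⟩ | ⟨-, h, -⟩ <;> simp only at h <;> linarith
  · intro s t s' t' h h0 h0'
    have a := hsin_pos h0
    have b := hsin_pos h0'
    rcases mkRP_inj h with ⟨h1, h2, -⟩ | ⟨-, h, -⟩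
    · obtain rfl := hsin_inj h2
      refine ⟨rfl, ?_⟩
      by_cases ht : t = 1
      · exact .inl ht
      · have := mul_right_cancel₀ (hcos_pos ht).ne' h1
        right
        cases s <;> cases s' <;> simp [bsgn] at this ⊢ <;> norm_num at this
    · simp only at h; linarith

open Real in
lemma exists_rp2_homeo : ∃ e : Att (loopMap (sqLoop ())) ≃ₜ RP2,
    (∀ x, e (Att.incl _ x) = rpLine x) ∧ ∀ p, e (Att.cellMap _ p) = rpDisc p := by
  refine ⟨Att.homeo rpLine rpDisc ?_ ?_ rpLine_injective ?_ ?_ ?_, fun x => rfl, fun p => rfl⟩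
  · intro s
    obtain ⟨t, rfl, -⟩ := exists_coe_eq s
    rw [loopMap_coe, rpLine_sqLoop]
    exact mkRP_congr (by simp [hcos, (cexp_coe t).1]) (by simp [hcos, (cexp_coe t).2])
      (by simp [hsin])
  · intro s s'
    exact mkRP_congr (by simp [hcos]) (by simp [hcos]) rfl
  · intro s t x h
    obtain ⟨a, b, h', e⟩ := rpLine_third x
    rw [e] at h
    by_contra h0
    have := hsin_pos h0
    rcases mkRP_inj h with ⟨-, -, h⟩ | ⟨-, -, h⟩ <;> simp only at h <;> linarith
  · intro s t s' t' h h0 h0'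
    have a := hsin_pos h0
    have b := hsin_pos h0'
    rcases mkRP_inj h with ⟨h1, h2, h3⟩ | ⟨-, -, h⟩
    · obtain rfl := hsin_inj h3
      refine ⟨rfl, ?_⟩
      by_cases ht : t = 1
      · exact .inl ht
      · have hs := (hcos_pos ht).ne'
        exact .inr (cexp_inj (mul_left_cancel₀ hs h1) (mul_left_cancel₀ hs h2))
    · simp only at h; linarith
  · intro x
    obtain ⟨a, b, c, h, rfl, hc⟩ := exists_mkRP x
    right
    have hc1 : c ≤ 1 := by nlinarith
    obtain ⟨s, h3, h4⟩ := exists_cexp a b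
    have hp := pi_pos
    let t : I := ⟨arcsin c / (π / 2), div_nonneg (arcsin_nonneg.2 hc) (by positivity),
      div_le_one_of_le₀ (arcsin_le_pi_div_two c) (by positivity)⟩
    have ht : π / 2 * (t : ℝ) = arcsin c := mul_div_cancel₀ _ (by positivity)
    have e1 : hsin t = c := by rw [hsin, ht, sin_arcsin (by linarith) hc1]
    have e2 : hcos t = √(a ^ 2 + b ^ 2) := by
      rw [hcos, ht, cos_arcsin]; congr 1; linarith
    refine ⟨(s, t), ?_⟩
    exact mkRP_congr (by simp only [e2, h3]) (by simp only [e2, h4]) e1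

end

noncomputable section
open scoped unitInterval ContinuousMap

section groupoidLemmas

variable {A : Type} [TopologicalSpace A] {x y z : A}

namespace Path.Homotopic.Quotient

lemma trans_symm_cancel (p : Path.Homotopic.Quotient x y) (q : Path.Homotopic.Quotient x z) :
    p.trans (p.symm.trans q) = q := by
  rw [← trans_assoc, trans_symm, refl_trans]

lemma symm_trans_cancel (p : Path.Homotopic.Quotient x y) (q : Path.Homotopic.Quotient y z) :
    p.symm.trans (p.trans q) = q := by
  rw [← trans_assoc, symm_trans, refl_trans]

lemma symm_of_trans (p : Path.Homotopic.Quotient x y) (q : Path.Homotopic.Quotient y z) :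
    (p.trans q).symm = q.symm.trans p.symm := by
  induction p using Quotient.ind with | mk p =>
  induction q using Quotient.ind with | mk q =>
  rw [← mk_trans, ← mk_symm, Path.trans_symm]; rfl

lemma symm_of_symm (p : Path.Homotopic.Quotient x y) : p.symm.symm = p := by
  induction p using Quotient.ind with | mk p =>
  rw [← mk_symm, ← mk_symm, Path.symm_symm]

lemma symm_of_refl : (refl x).symm = refl x := by
  rw [← mk_refl, ← mk_symm, Path.refl_symm]

end Path.Homotopic.Quotient

open Path.Homotopic.Quotient in
lemma Path.homotopic_conj_sq {a b p q : A} (j : Path b p) (v : Path a b) (c d : Path p q) :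
    ((((j.trans c).trans ((v.trans j).trans d).symm).trans v).trans
      (((j.trans c).trans ((v.trans j).trans d).symm).trans v)).Homotopic
    (j.trans (((c.trans d.symm).trans (c.trans d.symm)).trans j.symm)) := by
  rw [← eq]
  simp only [mk_trans, mk_symm, symm_of_trans, trans_assoc, symm_trans_cancel, symm_trans,
    trans_refl]

end groupoidLemmas

/-- Attaching a disc along the square of a new loop adds a projective plane. -/
lemma att_sqLoop_homeo {ι : Type} (c : ι → WedgePiece) :
    Nonempty (Att (loopMap (sqLoop (PieceWedge.base c))) ≃ₜ PieceWedge (addPiece c .rp2)) := by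
  obtain ⟨e, he1, he2⟩ := exists_rp2_homeo
  let w := PieceWedge.base c
  let φ : C(Bool, PieceWedge c) := .const Bool w
  let ψ := loopMap (sqLoop w)
  let φ0 : C(Bool, Unit) := .const Bool ()
  let ψ0 := loopMap (sqLoop ())
  let J1 : C(Att φ0, Att φ) :=
    Att.lift ((Att.incl φ).comp (.const _ w)) (Att.cellMap φ)
      (fun s => Att.cellMap_zero s) (fun s s' => by rw [Att.cellMap_one, Att.cellMap_one])
  have hJ : J1.comp ψ0 = ψ := by
    rw [comp_loopMap]
    refine loopMap_eq_of_forall _ _ fun t => ?_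
    have h1 : (arcPath φ0).map J1.continuous = arcPath φ := by
      rw [arcPath, Path.map_trans]; rfl
    have h2 : (sqLoop ()).map J1.continuous = sqLoop w := by
      rw [sqLoop, Path.map_trans]
      show ((arcPath φ0).map J1.continuous).trans ((arcPath φ0).map J1.continuous) = _
      rw [h1]; rfl
    exact DFunLike.congr_fun h2 t
  let J : C(Att ψ0, Att ψ) :=
    Att.lift ((Att.incl ψ).comp J1) (Att.cellMap ψ)
      (fun s => by rw [Att.cellMap_zero]; exact congrArg _ (DFunLike.congr_fun hJ s).symm)
      (fun s s' => by rw [Att.cellMap_one, Att.cellMap_one])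
  let E : C(Att ψ0, WedgePiece.rp2.space) := ⟨e, e.continuous⟩
  let E' : C(WedgePiece.rp2.space, Att ψ0) := ⟨e.symm, e.symm.continuous⟩
  have hEE' : E'.comp E = .id _ := ContinuousMap.ext e.symm_apply_apply
  have hE'E : E.comp E' = .id _ := ContinuousMap.ext e.apply_symm_apply
  have hpt : E (Att.incl _ (Att.incl _ ())) = RP2.pt := he1 _
  refine homeo_addPiece c .rp2 ((Att.incl ψ).comp (Att.incl φ)) (J.comp E') ?_ ?_ ?_
  · show Att.incl ψ (Att.incl φ w) = J (E' RP2.pt)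
    rw [← hpt]
    have := DFunLike.congr_fun hEE' (Att.incl ψ0 (Att.incl φ0 ()))
    exact (congrArg J this).symm
  · intro f g hfg
    have hg : g (E (Att.incl _ (Att.incl _ ()))) = f w := by rw [hpt]; exact hfg.symm
    let g1 := (g.comp E).comp (Att.incl ψ0)
    let F1 : C(Att φ, PieceWedge (addPiece c .rp2)) :=
      Att.lift f (g1.comp (Att.cellMap φ0)) (by
        intro s
        show g1 (Att.cellMap φ0 (s, 0)) = f w
        rw [Att.cellMap_zero]; exact hg) (by
        intro s s'
        show g1 (Att.cellMap φ0 (s, 1)) = g1 (Att.cellMap φ0 (s', 1))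
        rw [Att.cellMap_one, Att.cellMap_one])
    have hF1 : F1.comp J1 = g1 := by
      ext x
      · exact hg.symm
      · rfl
    let F : C(Att ψ, PieceWedge (addPiece c .rp2)) :=
      Att.lift F1 ((g.comp E).comp (Att.cellMap ψ0)) (by
        intro s
        show g (E (Att.cellMap ψ0 (s, 0))) = F1 (ψ s)
        rw [Att.cellMap_zero, ← hJ]
        exact (DFunLike.congr_fun hF1 (ψ0 s)).symm) (by
        intro s s'
        show g (E (Att.cellMap ψ0 (s, 1))) = g (E (Att.cellMap ψ0 (s', 1)))
        rw [Att.cellMap_one, Att.cellMap_one])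
    refine ⟨F, rfl, ?_⟩
    have hF : F.comp J = g.comp E := by
      ext x
      · exact DFunLike.congr_fun hF1 x
      · rfl
    rw [← ContinuousMap.comp_assoc, hF, ContinuousMap.comp_assoc, hE'E]; rfl
  · intro f g h1 h2
    have h3 : f.comp J = g.comp J := by
      have := congrArg (fun F => F.comp E) h2
      simp only [ContinuousMap.comp_assoc] at this
      rwa [hEE'] at this
    ext x
    · have h4 : f.comp (Att.incl ψ) = g.comp (Att.incl ψ) := by
        ext y
        · exact DFunLike.congr_fun h1 y
        · exact DFunLike.congr_fun h3 (Att.incl ψ0 (Att.cellMap φ0 y))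
      exact DFunLike.congr_fun h4 x
    · exact DFunLike.congr_fun h3 (Att.cellMap ψ0 x)

/-- A family of paths indexed by the booleans. -/
def boolPath {A : Type} [TopologicalSpace A] {p q : C(Bool, A)} (h : ∀ b, Path (p b) (q b)) :
    Path p q where
  toFun t := ⟨fun b => h b t, continuous_of_discreteTopology⟩
  continuous_toFun := by
    refine ContinuousMap.continuous_of_continuous_uncurry _ ?_
    refine continuous_prod_of_discrete_right.2 fun b => ?_
    exact (h b).continuous
  source' := by ext b; simp
  target' := by ext b; simp

lemma Path.trans_symm_congr {A : Type} [TopologicalSpace A] {x y y' z : A} {p : Path x y}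
    {q : Path z y} {p' : Path x y'} {q' : Path z y'} (hp : ∀ t, p t = p' t)
    (hq : ∀ t, q t = q' t) : p.trans q.symm = p'.trans q'.symm := by
  have h : y = y' := by simpa using hp 1
  subst h
  obtain rfl : p = p' := Path.ext (funext hp)
  obtain rfl : q = q' := Path.ext (funext hq)
  rfl

lemma cellArc_map {A B : Type} [TopologicalSpace A] [TopologicalSpace B] {φ : C(Bool, A)}
    {f : C(A, B)} {ψ : C(Bool, B)} (h : ∀ b, Path (f (φ b)) (ψ b)) (b : Bool) (t : I) :
    ((cellArc φ b).map (Att.mapAtt f (boolPath h (p := f.comp φ))).continuous) t =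
      (((h b).map (Att.incl ψ).continuous).trans (cellArc ψ b)) t :=
  DFunLike.congr_fun (Path.map_trans (Att.push (Att.incl ψ) (boolPath h (p := f.comp φ)))
    (Att.cell ψ) (f := fun g : C(Bool, Att ψ) => g b) (by fun_prop)) t

/-- Attaching a disc along the square of a loop running once through a new arc. -/
lemma IsWedge.att_rp2 {A : Type} [TopologicalSpace A] [PathConnectedSpace A] (hA : IsWedge A)
    {φ : C(Bool, A)} (u : Path (φ false) (φ true)) :
    IsWedge (Att (loopMap (((arcPath φ).trans (u.map (Att.incl φ).continuous)).trans
      ((arcPath φ).trans (u.map (Att.incl φ).continuous))))) := by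
  obtain ⟨ι, hι, c, ⟨E⟩⟩ := hA
  let w := PieceWedge.base c
  let ψ : C(Bool, PieceWedge c) := .const Bool w
  obtain ⟨D⟩ := E.right_inv
  obtain ⟨γ⟩ := PathConnectedSpace.joined (φ true) (E.invFun w)
  let ha : Path (E.toFun (φ true)) (ψ true) := (γ.map E.toFun.continuous).trans (D.evalAt w)
  let v := u.map E.toFun.continuous
  let h : ∀ b, Path (E.toFun (φ b)) (ψ b) := fun b => match b with
    | true => ha
    | false => v.trans ha
  obtain ⟨E', hE'⟩ := Att.exists_equiv E (boolPath h (p := E.toFun.comp φ))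
  obtain ⟨H⟩ := att_sqLoop_homeo c
  set W := (arcPath φ).trans (u.map (Att.incl φ).continuous) with hW
  have key : (E'.toFun.comp (loopMap (W.trans W))).Homotopic (loopMap (sqLoop w)) := by
    rw [hE', comp_loopMap]
    set Φ := Att.mapAtt E.toFun (boolPath h (p := E.toFun.comp φ)) with hΦ
    let ja : Path (Φ (Att.incl φ (φ true))) (Att.incl ψ w) := ha.map (Att.incl ψ).continuous
    let jv : Path (Φ (Att.incl φ (φ false))) (Φ (Att.incl φ (φ true))) :=
      v.map (Att.incl ψ).continuous
    have e3 : (u.map (Att.incl φ).continuous).map Φ.continuous = jv := rfl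
    let c1 : Path (Att.incl ψ w) (Att.apex ψ) := cellArc ψ true
    let c0 : Path (Att.incl ψ w) (Att.apex ψ) := cellArc ψ false
    have e4 : (arcPath φ).map Φ.continuous =
        (ja.trans c1).trans ((jv.trans ja).trans c0).symm := by
      rw [arcPath, Path.map_trans]
      refine Path.trans_symm_congr (q := (cellArc φ false).map Φ.continuous) (p' := ja.trans c1)
        (q' := (jv.trans ja).trans c0) (cellArc_map h true) fun t => ?_
      refine (cellArc_map h false t).trans ?_
      have : (v.trans ha).map (Att.incl ψ).continuous = jv.trans ja := Path.map_trans _ _ _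
      exact congrArg (fun P : Path (Att.incl ψ (E.toFun (φ false))) (Att.incl ψ w) =>
        (P.trans c0) t) this
    have e5 : W.map Φ.continuous =
        ((ja.trans c1).trans ((jv.trans ja).trans c0).symm).trans jv := by
      rw [hW, Path.map_trans, e4, e3]
    rw [Path.map_trans, e5]
    exact ContinuousMap.Homotopic.trans (loopMap_homotopic (Path.homotopic_conj_sq ja jv c1 c0))
      (loopMap_conj ja (sqLoop w))
  obtain ⟨E''⟩ := Att.equiv_of_homotopic E' key
  exact ⟨Option ι, inferInstance, addPiece c .rp2, ⟨E''.trans H.toHomotopyEquiv⟩⟩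

end

noncomputable section
open scoped ContinuousMap

variable {N : ℕ}

/-- The support of a point. -/
def supp (x : Fin N → ℝ) : Finset (Fin N) := Finset.univ.filter fun i => x i ≠ 0

@[simp] lemma mem_supp {x : Fin N → ℝ} {i : Fin N} : i ∈ supp x ↔ x i ≠ 0 := by simp [supp]

/-- The families of faces of complexes of dimension at most two. -/
structure IsCx (F : Finset (Finset (Fin N))) : Prop where
  nonempty : ∀ σ ∈ F, σ.Nonempty
  card_le : ∀ σ ∈ F, σ.card ≤ 3
  down : ∀ σ ∈ F, ∀ τ ⊆ σ, τ.Nonempty → τ ∈ F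

/-- The realization of a family of faces in barycentric coordinates. -/
def real (F : Finset (Finset (Fin N))) : Set (Fin N → ℝ) :=
  {x | (∀ i, 0 ≤ x i) ∧ ∑ i, x i = 1 ∧ supp x ∈ F}

lemma real_mono {F G : Finset (Finset (Fin N))} (h : F ⊆ G) : real F ⊆ real G :=
  fun _ hx => ⟨hx.1, hx.2.1, h hx.2.2⟩

lemma supp_nonempty {x : Fin N → ℝ} (h : ∑ i, x i = 1) : (supp x).Nonempty := by
  by_contra h0
  rw [Finset.not_nonempty_iff_eq_empty] at h0
  have : ∀ i, x i = 0 := fun i => by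
    by_contra hi
    have : i ∈ supp x := mem_supp.2 hi
    simp [h0] at this
  simp [this] at h

lemma mem_real_of_subset {F : Finset (Finset (Fin N))} (hF : IsCx F) {x : Fin N → ℝ}
    (h0 : ∀ i, 0 ≤ x i) (h1 : ∑ i, x i = 1) {σ} (hσ : σ ∈ F) (h : ∀ i, i ∉ σ → x i = 0) :
    x ∈ real F := by
  refine ⟨h0, h1, hF.down σ hσ _ (fun i hi => ?_) (supp_nonempty h1)⟩
  by_contra hi'
  exact mem_supp.1 hi (h i hi')

lemma sum_supp (x : Fin N → ℝ) {σ : Finset (Fin N)} (h : ∀ i, i ∉ σ → x i = 0) :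
    ∑ i ∈ σ, x i = ∑ i, x i :=
  Finset.sum_subset (Finset.subset_univ _) fun i _ hi => h i hi

lemma mem_convexHull_basis {σ : Finset (Fin N)} {x : Fin N → ℝ} :
    x ∈ convexHull ℝ (SimplicialComplex2.basisVec '' (σ : Set (Fin N))) ↔
      (∀ i, 0 ≤ x i) ∧ ∑ i, x i = 1 ∧ ∀ i, i ∉ σ → x i = 0 := by
  constructor
  · intro h
    let C : Set (Fin N → ℝ) := {x | (∀ i, 0 ≤ x i) ∧ ∑ i, x i = 1 ∧ ∀ i, i ∉ σ → x i = 0}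
    suffices convexHull ℝ (SimplicialComplex2.basisVec '' (σ : Set (Fin N))) ⊆ C from this h
    refine convexHull_min ?_ ?_
    · rintro _ ⟨i, hi, rfl⟩
      refine ⟨fun j => ?_, ?_, fun j hj => ?_⟩
      · by_cases h : j = i <;> simp [SimplicialComplex2.basisVec, h]
      · simp [SimplicialComplex2.basisVec]
      · have : j ≠ i := fun e => hj (e ▸ hi)
        simp [SimplicialComplex2.basisVec, this]
    · intro x hx y hy a b ha hb hab
      refine ⟨fun i => ?_, ?_, fun i hi => ?_⟩
      · have := hx.1 i; have := hy.1 i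
        simp only [Pi.add_apply, Pi.smul_apply, smul_eq_mul]; positivity
      · simp [Finset.sum_add_distrib, ← Finset.mul_sum, hx.2.1, hy.2.1, hab]
      · simp [hx.2.2 i hi, hy.2.2 i hi]
  · rintro ⟨h0, h1, h2⟩
    have hx : x = ∑ i ∈ σ, x i • SimplicialComplex2.basisVec i := by
      funext j
      by_cases hj : j ∈ σ <;>
        simp [SimplicialComplex2.basisVec, Finset.sum_apply, Pi.single_apply, hj]
      exact h2 j hj
    rw [hx]
    refine (convex_convexHull ℝ _).sum_mem (fun i _ => h0 i) ((sum_supp x h2).trans h1)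
      fun i hi => subset_convexHull ℝ _ ⟨i, hi, rfl⟩

lemma isCx_faces (X : SimplicialComplex2 N) : IsCx X.faces :=
  ⟨X.nonempty_of_mem, X.card_le_three, X.down_closed⟩

lemma realization_eq (X : SimplicialComplex2 N) : X.realization = real X.faces := by
  ext x
  simp only [SimplicialComplex2.realization, Set.mem_iUnion, mem_convexHull_basis, exists_prop]
  constructor
  · rintro ⟨σ, hσ, h0, h1, h2⟩
    exact mem_real_of_subset (isCx_faces X) h0 h1 hσ h2
  · rintro ⟨h0, h1, h2⟩
    exact ⟨_, h2, h0, h1, fun i hi => by simpa using hi⟩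

lemma isCompact_real {F : Finset (Finset (Fin N))} (hF : IsCx F) : IsCompact (real F) := by
  have : real F = ⋃ σ ∈ F, convexHull ℝ (SimplicialComplex2.basisVec '' (σ : Set (Fin N))) := by
    let X : SimplicialComplex2 N := ⟨F, hF.1, hF.2, hF.3⟩
    exact (realization_eq X).symm
  rw [this]
  refine F.finite_toSet.isCompact_biUnion fun σ _ => ?_
  exact (σ.finite_toSet.image _).isCompact_convexHull ℝ

lemma compactSpace_real {F : Finset (Finset (Fin N))} (hF : IsCx F) : CompactSpace (real F) :=
  isCompact_iff_compactSpace.1 (isCompact_real hF)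

/-- A set deforming in itself into a subset. -/
lemma exists_equiv_of_deformation {E : Type} [TopologicalSpace E] {S S' : Set E} (hS : S' ⊆ S)
    (r : unitInterval → E → E) (hr : Continuous fun p : unitInterval × E => r p.1 p.2)
    (h0 : ∀ x ∈ S, r 0 x = x)
    (hm : ∀ t, ∀ x ∈ S, r t x ∈ S) (h1 : ∀ x ∈ S, r 1 x ∈ S') (hf : ∀ t, ∀ x ∈ S', r t x = x) :
    ∃ e : S' ≃ₕ S, ∀ x : S', ((e.toFun x : S) : E) = x := by
  let i : C(S', S) := ⟨Set.inclusion hS, continuous_inclusion hS⟩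
  let g : C(S, S') := ⟨fun x => ⟨r 1 x, h1 x x.2⟩, by fun_prop⟩
  refine ⟨⟨i, g, ?_, ?_⟩, fun x => rfl⟩
  · have : g.comp i = .id _ := by
      ext x; exact hf 1 x x.2
    rw [this]
  · refine ContinuousMap.Homotopic.symm
      ⟨⟨⟨fun p => ⟨r p.1 p.2, hm p.1 p.2 p.2.2⟩, by fun_prop⟩, ?_, ?_⟩⟩
    · intro x; exact Subtype.ext (h0 x x.2)
    · intro x; rfl

/-- The inclusion of realizations is a homotopy equivalence. -/
def InclHE (F' F : Finset (Finset (Fin N))) : Prop :=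
  ∃ e : real F' ≃ₕ real F, ∀ x : real F', ((e.toFun x : real F) : Fin N → ℝ) = x

lemma InclHE.refl (F : Finset (Finset (Fin N))) : InclHE F F := ⟨.refl _, fun _ => rfl⟩

lemma InclHE.trans {F G H : Finset (Finset (Fin N))} (h : InclHE F G) (h' : InclHE G H) :
    InclHE F H := by
  obtain ⟨e, he⟩ := h
  obtain ⟨e', he'⟩ := h'
  exact ⟨e.trans e', fun x => (he' _).trans (he x)⟩

lemma erase_isCx {F : Finset (Finset (Fin N))} (hF : IsCx F) {σ : Finset (Fin N)}
    (hmax : ∀ ρ ∈ F, σ ⊆ ρ → ρ = σ) : IsCx (F.erase σ) := by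
  refine ⟨fun ρ h => hF.1 ρ (Finset.mem_of_mem_erase h),
    fun ρ h => hF.2 ρ (Finset.mem_of_mem_erase h),
    fun ρ h τ hτ hn => Finset.mem_erase.2 ⟨?_, hF.3 ρ (Finset.mem_of_mem_erase h) τ hτ hn⟩⟩
  rintro rfl
  exact (Finset.mem_erase.1 h).1 (hmax ρ (Finset.mem_of_mem_erase h) hτ)

/-- Elementary collapse. -/
lemma inclHE_collapse {F : Finset (Finset (Fin N))} (hF : IsCx F) {ε : Finset (Fin N)} {c : Fin N}
    (hε : ε.Nonempty) (hc : c ∉ ε) (hτ : insert c ε ∈ F)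
    (hfree : ∀ σ ∈ F, ε ⊆ σ → σ = ε ∨ σ = insert c ε) :
    InclHE ((F.erase (insert c ε)).erase ε) F := by
  let m : (Fin N → ℝ) → ℝ := fun x => ε.inf' hε x
  have hmc : Continuous m := Continuous.finset_inf'_apply hε fun i _ => continuous_apply i
  let d : Fin N → ℝ := fun i => if i = c then ε.card else if i ∈ ε then -1 else 0
  have hd : ∑ i, d i = 0 := by
    have h1 : ∀ i, d i = (if i = c then (ε.card : ℝ) else 0) + (if i ∈ ε then -1 else 0) := by
      intro i
      by_cases h : i = c
      · subst h; simp [d, hc]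
      · simp [d, h]
    simp [h1, Finset.sum_add_distrib]
  have m_le : ∀ x i, i ∈ ε → m x ≤ x i := fun x i hi => Finset.inf'_le _ hi
  have m_nonneg : ∀ x : Fin N → ℝ, (∀ i, 0 ≤ x i) → 0 ≤ m x := fun x hx =>
    Finset.le_inf' _ _ fun i _ => hx i
  have m_zero : ∀ x : Fin N → ℝ, (∀ i, 0 ≤ x i) → (¬ ε ⊆ supp x) → m x = 0 := by
    intro x hx h
    obtain ⟨i, hi, hi'⟩ := Finset.not_subset.1 h
    have h2 : x i = 0 := by simpa using hi'
    exact le_antisymm (h2 ▸ m_le x i hi) (m_nonneg x hx)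
  let r : unitInterval → (Fin N → ℝ) → (Fin N → ℝ) := fun t x i => x i + t * m x * d i
  have hsub : (F.erase (insert c ε)).erase ε ⊆ F :=
    (Finset.erase_subset _ _).trans (Finset.erase_subset _ _)
  have hmaps : ∀ t, ∀ x ∈ real F, r t x ∈ real F := by
    intro t x hx
    by_cases h : ε ⊆ supp x
    · have h3 : supp x ⊆ insert c ε := by
        rcases hfree _ hx.2.2 h with e | e
        · rw [e]; exact Finset.subset_insert _ _
        · rw [e]
      refine mem_real_of_subset hF (fun i => ?_) ?_ hτ fun i hi => ?_
      · have hm := m_nonneg x hx.1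
        have ht := t.2.1
        have ht1 := t.2.2
        have hxi := hx.1 i
        simp only [r, d]
        split_ifs with h1 h2
        · positivity
        · have := m_le x i h2
          nlinarith
        · simpa using hxi
      · simp only [r, Finset.sum_add_distrib, ← Finset.mul_sum, hd, hx.2.1]; simp
      · have h4 : x i = 0 := by
          by_contra h5
          exact hi (h3 (mem_supp.2 h5))
        have h5 : i ≠ c := fun e => hi (by simp [e])
        have h6 : i ∉ ε := fun e => hi (by simp [e])
        simp [r, d, h4, h5, h6]
    · have : r t x = x := by funext i; simp [r, m_zero x hx.1 h]
      rwa [this]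
  refine exists_equiv_of_deformation (real_mono hsub) r ?_ ?_ hmaps ?_ ?_
  · refine continuous_pi fun i => ?_
    have := hmc.comp (continuous_snd (X := unitInterval) (Y := Fin N → ℝ))
    have h2 : Continuous fun p : unitInterval × (Fin N → ℝ) => p.2 i := by fun_prop
    have h3 : Continuous fun p : unitInterval × (Fin N → ℝ) => (p.1 : ℝ) := by fun_prop
    exact h2.add ((h3.mul this).mul continuous_const)
  · intro x _; funext i; simp [r]
  · intro x hx
    have h := hmaps 1 x hx
    refine ⟨h.1, h.2.1, ?_⟩
    obtain ⟨j, hj, hj'⟩ := Finset.exists_mem_eq_inf' hε x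
    have hz : r 1 x j = 0 := by
      have h5 : j ≠ c := fun e => hc (e ▸ hj)
      simp only [r, d, h5, hj, if_true, if_false, m]
      rw [hj']; simp
    have hz' : j ∉ supp (r 1 x) := by simpa using hz
    refine Finset.mem_erase.2 ⟨fun e => hz' (e ▸ hj), Finset.mem_erase.2 ⟨fun e => hz' ?_, h.2.2⟩⟩
    rw [e]; exact Finset.mem_insert_of_mem hj
  · intro t x hx
    have h : ¬ ε ⊆ supp x := fun h => by
      have h2 := hx.2.2
      simp only [Finset.mem_erase] at h2
      rcases hfree _ h2.2.2 h with e | e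
      · exact h2.1 e
      · exact h2.2.1 e
    funext i; simp [r, m_zero x hx.1 h]

/-- The realization is obtained from that without a maximal face by attaching a cone on the
boundary of this face. -/
lemma exists_att_homeo {F : Finset (Finset (Fin N))} (hF : IsCx F) {σ : Finset (Fin N)}
    (hσ : σ ∈ F) (hmax : ∀ ρ ∈ F, σ ⊆ ρ → ρ = σ) {S : Type} [TopologicalSpace S] [CompactSpace S]
    [LocallyCompactSpace S] [Inhabited S] (φ : C(S, real (F.erase σ))) (hinj : Function.Injective φ)
    (hφ : ∀ s, supp (φ s : Fin N → ℝ) ⊆ σ)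
    (hsurj : ∀ x : real (F.erase σ), supp (x : Fin N → ℝ) ⊆ σ → ∃ s, φ s = x) :
    ∃ e : Att φ ≃ₜ real F, (∀ x : real (F.erase σ), (e (Att.incl φ x) : Fin N → ℝ) = x) ∧
      ∀ p, supp (e (Att.cellMap φ p) : Fin N → ℝ) ⊆ σ := by
  have hG := erase_isCx hF hmax
  have := compactSpace_real hG
  have hn : 0 < (σ.card : ℝ) := by exact_mod_cast (hF.1 σ hσ).card_pos
  let b : Fin N → ℝ := fun i => if i ∈ σ then 1 / σ.card else 0
  have hb0 : ∀ i, 0 ≤ b i := fun i => by simp only [b]; split_ifs <;> positivity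
  have hb1 : ∑ i, b i = 1 := by simp [b]; field_simp
  have hb : ∀ i, i ∈ σ → b i = 1 / σ.card := fun i hi => by simp [b, hi]
  have hb' : ∀ i, i ∉ σ → b i = 0 := fun i hi => by simp [b, hi]
  have hφ0 : ∀ s i, i ∉ σ → (φ s : Fin N → ℝ) i = 0 := fun s i hi => by
    by_contra h
    exact hi (hφ s (mem_supp.2 h))
  let f : C(real (F.erase σ), real F) :=
    ⟨Set.inclusion (real_mono (Finset.erase_subset _ _)), continuous_inclusion _⟩
  have hk : ∀ p : S × unitInterval, (fun i => (1 - (p.2 : ℝ)) * (φ p.1 : Fin N → ℝ) i + p.2 * b i) ∈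
      real F := by
    intro p
    have ht := p.2.2.1
    have ht1 := p.2.2.2
    refine mem_real_of_subset hF (fun i => ?_) ?_ hσ fun i hi => ?_
    · have := (φ p.1).2.1 i
      have := hb0 i
      have : 0 ≤ 1 - (p.2 : ℝ) := by linarith
      positivity
    · rw [Finset.sum_add_distrib, ← Finset.mul_sum, ← Finset.mul_sum, hb1, (φ p.1).2.2.1]; ring
    · rw [hφ0 _ i hi, hb' i hi]; simp
  let k : C(S × unitInterval, real F) := ⟨fun p => ⟨_, hk p⟩, by
    refine Continuous.subtype_mk (continuous_pi fun i => ?_) _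
    have : Continuous fun p : S × unitInterval => (φ p.1 : Fin N → ℝ) i :=
      (continuous_apply i).comp (continuous_subtype_val.comp (φ.continuous.comp continuous_fst))
    have h3 : Continuous fun p : S × unitInterval => (p.2 : ℝ) :=
      continuous_subtype_val.comp continuous_snd
    exact ((continuous_const.sub h3).mul this).add (h3.mul continuous_const)⟩
  have kval : ∀ s t i, (k (s, t) : Fin N → ℝ) i = (1 - (t : ℝ)) * (φ s : Fin N → ℝ) i + t * b i :=
    fun s t i => rfl
  have hzero : ∀ s, ∃ i ∈ σ, (φ s : Fin N → ℝ) i = 0 := by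
    intro s
    by_contra! h
    have h1 : supp (φ s : Fin N → ℝ) = σ :=
      Finset.Subset.antisymm (hφ s) fun i hi => mem_supp.2 (h i hi)
    have h2 := (φ s).2.2.2
    rw [h1] at h2
    simp at h2
  refine ⟨Att.homeo f k ?_ ?_ ?_ ?_ ?_ ?_, fun x => rfl, fun p i hi => ?_⟩
  · intro s
    refine Subtype.ext (funext fun i => ?_)
    rw [kval]; simp [f]
  · intro s s'
    refine Subtype.ext (funext fun i => ?_)
    rw [kval, kval]; simp
  · intro x y h
    exact Subtype.ext (congrArg (fun z : real F => (z : Fin N → ℝ)) h)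
  · intro s t x h
    by_contra ht
    have ht0 : 0 < (t : ℝ) := lt_of_le_of_ne t.2.1 fun h => ht (Subtype.ext h.symm)
    have ht1 := t.2.2
    have h1 : supp (x : Fin N → ℝ) = σ := by
      have hx : ∀ i, (x : Fin N → ℝ) i = (1 - (t : ℝ)) * (φ s : Fin N → ℝ) i +
          t * b i := fun i => by
        rw [← kval, h]; rfl
      ext i
      rw [mem_supp, hx]
      constructor
      · intro h
        by_contra hi
        exact h (by rw [hφ0 s i hi, hb' i hi]; simp)
      · intro hi
        have := (φ s).2.1 i
        rw [hb i hi]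
        have : 0 ≤ (1 - (t : ℝ)) := by linarith
        positivity
    have h2 := x.2.2.2
    rw [h1] at h2
    simp at h2
  · intro s t s' t' h h0 h0'
    have e : ∀ i, (1 - (t : ℝ)) * (φ s : Fin N → ℝ) i + t * b i =
        (1 - (t' : ℝ)) * (φ s' : Fin N → ℝ) i + t' * b i := fun i => by
      rw [← kval, ← kval, h]
    have key : ∀ {s t s' t'}, (∀ i, (1 - ((t : unitInterval) : ℝ)) * (φ s : Fin N → ℝ) i + t * b i =
        (1 - ((t' : unitInterval) : ℝ)) * (φ s' : Fin N → ℝ) i + t' * b i) → (t' : ℝ) ≤ t := by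
      intro s t s' t' e
      obtain ⟨i, hi, hz⟩ := hzero s
      have h1 := e i
      have h2 := (φ s').2.1 i
      have h3 := t'.2.2
      have h4 : 0 < b i := by rw [hb i hi]; positivity
      rw [hz, mul_zero, zero_add] at h1
      have : 0 ≤ (1 - (t' : ℝ)) * (φ s' : Fin N → ℝ) i := mul_nonneg (by linarith) h2
      by_contra h5
      push Not at h5
      nlinarith
    have ht : t = t' := Subtype.ext (le_antisymm (key fun i => (e i).symm) (key e))
    subst ht
    refine ⟨rfl, ?_⟩
    by_cases h1 : t = 1
    · exact .inl h1
    · right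
      have h2 : (1 - (t : ℝ)) ≠ 0 := fun h => h1 (Subtype.ext (show (t : ℝ) = 1 by linarith))
      refine hinj (Subtype.ext (funext fun i => mul_left_cancel₀ h2 ?_))
      have := e i
      linarith
  · intro x
    by_cases hx : supp (x : Fin N → ℝ) = σ
    · right
      have hne := hF.1 σ hσ
      set m := σ.inf' hne (x : Fin N → ℝ) with hm
      have hm0 : 0 ≤ m := Finset.le_inf' _ _ fun i _ => x.2.1 i
      have hx0 : ∀ i, i ∉ σ → (x : Fin N → ℝ) i = 0 := fun i hi => by
        rw [← hx] at hi; simpa using hi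
      have hmle : ∀ i ∈ σ, m ≤ (x : Fin N → ℝ) i := fun i hi => Finset.inf'_le _ hi
      have hs : ∑ i ∈ σ, ((x : Fin N → ℝ) i - m) = 1 - σ.card * m := by
        rw [Finset.sum_sub_distrib, sum_supp _ hx0, x.2.2.1]; simp
      have hge : 0 ≤ 1 - σ.card * m := by
        rw [← hs]; exact Finset.sum_nonneg fun i hi => sub_nonneg.2 (hmle i hi)
      have hmb : ∀ i, i ∈ σ → σ.card * m * b i = m := fun i hi => by
        rw [hb i hi]; field_simp
      let t : unitInterval := ⟨σ.card * m, by positivity, by linarith⟩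
      by_cases h1 : (σ.card : ℝ) * m = 1
      · refine ⟨(default, t), Subtype.ext (funext fun i => ?_)⟩
        rw [kval]
        show (1 - (σ.card : ℝ) * m) * _ + (σ.card : ℝ) * m * b i = _
        by_cases hi : i ∈ σ
        · rw [hmb i hi, h1]
          rw [h1, sub_self] at hs
          have := (Finset.sum_eq_zero_iff_of_nonneg fun i hi => sub_nonneg.2 (hmle i hi)).1 hs i hi
          linarith
        · rw [hb' i hi, hx0 i hi, h1]; simp
      · have h2 : 0 < 1 - (σ.card : ℝ) * m := lt_of_le_of_ne hge fun h => h1 (by linarith)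
        let y : Fin N → ℝ := fun i => ((x : Fin N → ℝ) i - σ.card * m * b i) / (1 - σ.card * m)
        have hy0 : ∀ i, i ∉ σ → y i = 0 := fun i hi => by simp [y, hx0 i hi, hb' i hi]
        have hysum : ∑ i, y i = 1 := by
          simp only [y]
          rw [← Finset.sum_div, Finset.sum_sub_distrib, ← Finset.mul_sum, hb1, x.2.2.1, mul_one,
            div_self h2.ne']
        have hyn : ∀ i, 0 ≤ y i := fun i => by
          by_cases hi : i ∈ σ
          · have := hmle i hi
            simp only [y]; rw [hmb i hi]
            exact div_nonneg (by linarith) h2.le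
          · rw [hy0 i hi]
        have hyF := mem_real_of_subset hF hyn hysum hσ hy0
        have hys : supp y ⊆ σ := fun i hi => by
          by_contra h
          exact mem_supp.1 hi (hy0 i h)
        have hyne : supp y ≠ σ := by
          obtain ⟨j, hj, hj'⟩ := Finset.exists_mem_eq_inf' hne (x : Fin N → ℝ)
          intro h
          rw [← h] at hj
          refine mem_supp.1 hj ?_
          rw [h] at hj
          simp only [y]
          rw [hmb j hj, hm, hj']; simp
        obtain ⟨s, hs'⟩ := hsurj ⟨y, hyn, hysum, Finset.mem_erase.2 ⟨hyne, hyF.2.2⟩⟩ hys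
        refine ⟨(s, t), Subtype.ext (funext fun i => ?_)⟩
        rw [kval, hs']
        show (1 - (σ.card : ℝ) * m) * (((x : Fin N → ℝ) i - σ.card * m * b i) / (1 - σ.card * m)) +
          (σ.card : ℝ) * m * b i = _
        rw [mul_div_cancel₀ _ h2.ne']; ring
    · left
      exact ⟨⟨x, x.2.1, x.2.2.1, Finset.mem_erase.2 ⟨hx, x.2.2.2⟩⟩, rfl⟩
  · by_contra hiσ
    refine mem_supp.1 hi ?_
    show (1 - (p.2 : ℝ)) * (φ p.1 : Fin N → ℝ) i + p.2 * b i = 0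
    rw [hφ0 _ i hiσ, hb' i hiσ]; simp

end

noncomputable section
open scoped ContinuousMap

variable {N : ℕ} {F G : Finset (Finset (Fin N))}

lemma IsCx.left (hG : IsCx G) {a b : Fin N} (h : {a, b} ∈ G) : {a} ∈ G :=
  hG.down _ h _ (by simp) (by simp)

lemma IsCx.right (hG : IsCx G) {a b : Fin N} (h : {a, b} ∈ G) : {b} ∈ G :=
  hG.down _ h _ (by simp) (by simp)

/-- A vertex as a point of the realization. -/
def vtx (hG : IsCx G) {a : Fin N} (h : {a} ∈ G) : real G :=
  ⟨Pi.single a 1, mem_real_of_subset hG (fun i => by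
    by_cases hi : i = a <;> simp [hi]) (by simp) h
    (fun i hi => by simp only [Finset.mem_singleton] at hi; simp [hi])⟩

/-- The path along an edge. -/
def edgePath (hG : IsCx G) {a b : Fin N} (h : {a, b} ∈ G) :
    Path (vtx hG (hG.left h)) (vtx hG (hG.right h)) where
  toFun t := ⟨fun i => (1 - (t : ℝ)) * (Pi.single a 1 : Fin N → ℝ) i +
      t * (Pi.single b 1 : Fin N → ℝ) i, by
    have h0 := t.2.1
    have h1 : 0 ≤ 1 - (t : ℝ) := sub_nonneg.2 t.2.2
    refine mem_real_of_subset hG (fun i => ?_) ?_ h fun i hi => ?_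
    · refine add_nonneg (mul_nonneg h1 ?_) (mul_nonneg h0 ?_) <;>
      · rw [Pi.single_apply]; split_ifs <;> norm_num
    · rw [Finset.sum_add_distrib, ← Finset.mul_sum, ← Finset.mul_sum]; simp
    · simp only [Finset.mem_insert, Finset.mem_singleton, not_or] at hi
      simp [hi.1, hi.2]⟩
  continuous_toFun := by
    refine Continuous.subtype_mk (continuous_pi fun i => ?_) _
    fun_prop
  source' := Subtype.ext (funext fun i => by simp [vtx])
  target' := Subtype.ext (funext fun i => by simp [vtx])

lemma edgePath_apply (hG : IsCx G) {a b : Fin N} (h : {a, b} ∈ G) (t : unitInterval) (i : Fin N) :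
    (edgePath hG h t : Fin N → ℝ) i = (1 - (t : ℝ)) * (Pi.single a 1 : Fin N → ℝ) i +
      t * (Pi.single b 1 : Fin N → ℝ) i := rfl

lemma supp_edgePath (hG : IsCx G) {a b : Fin N} (h : {a, b} ∈ G) (t : unitInterval) :
    supp (edgePath hG h t : Fin N → ℝ) ⊆ {a, b} := by
  intro i hi
  by_contra h'
  simp only [Finset.mem_insert, Finset.mem_singleton, not_or] at h'
  rw [mem_supp, edgePath_apply] at hi
  simp [h'.1, h'.2] at hi

lemma edgePath_symm (hG : IsCx G) {a b : Fin N} (h : {a, b} ∈ G) (h' : {b, a} ∈ G) :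
    (edgePath hG h).symm = edgePath hG h' := by
  refine Path.ext (funext fun t => Subtype.ext (funext fun i => ?_))
  rw [Path.symm_apply, Function.comp_apply, edgePath_apply, edgePath_apply]
  simp [unitInterval.symm]; ring

lemma homotopic_of_supp (hG : IsCx G) {ρ : Finset (Fin N)} (hρ : ρ ∈ G) {x y : real G}
    (p q : Path x y) (hp : ∀ t, supp (p t : Fin N → ℝ) ⊆ ρ)
    (hq : ∀ t, supp (q t : Fin N → ℝ) ⊆ ρ) : p.Homotopic q := by
  have hz : ∀ (p : Path x y), (∀ t, supp (p t : Fin N → ℝ) ⊆ ρ) → ∀ t i, i ∉ ρ →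
      (p t : Fin N → ℝ) i = 0 := fun p hp t i hi => by
    by_contra h
    exact hi (hp t (mem_supp.2 h))
  have hc : ∀ (p : Path x y) (i : Fin N), Continuous fun z : unitInterval × unitInterval =>
      (p z.2 : Fin N → ℝ) i := fun p i =>
    (continuous_apply i).comp (continuous_subtype_val.comp (p.continuous.comp continuous_snd))
  have h1 : Continuous fun z : unitInterval × unitInterval => (z.1 : ℝ) :=
    continuous_subtype_val.comp continuous_fst
  refine ⟨⟨⟨⟨fun z => ⟨fun i => (1 - (z.1 : ℝ)) * (p z.2 : Fin N → ℝ) i +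
      z.1 * (q z.2 : Fin N → ℝ) i, ?_⟩, ?_⟩, fun t => ?_, fun t => ?_⟩, fun t s hs => ?_⟩⟩
  · have h0 := z.1.2.1
    have h1 : 0 ≤ 1 - (z.1 : ℝ) := sub_nonneg.2 z.1.2.2
    refine mem_real_of_subset hG (fun i => ?_) ?_ hρ fun i hi => ?_
    · exact add_nonneg (mul_nonneg h1 ((p z.2).2.1 i)) (mul_nonneg h0 ((q z.2).2.1 i))
    · rw [Finset.sum_add_distrib, ← Finset.mul_sum, ← Finset.mul_sum, (p z.2).2.2.1,
        (q z.2).2.2.1]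
      ring
    · rw [hz p hp _ i hi, hz q hq _ i hi]; simp
  · refine Continuous.subtype_mk (continuous_pi fun i => ?_) _
    exact ((continuous_const.sub h1).mul (hc p i)).add (h1.mul (hc q i))
  · exact Subtype.ext (funext fun i => by simp)
  · exact Subtype.ext (funext fun i => by simp)
  · refine Subtype.ext (funext fun i => ?_)
    have hpq : p s = q s := by
      rcases hs with rfl | hs
      · simp
      · rw [Set.mem_singleton_iff.1 hs]; simp
    show (1 - (t : ℝ)) * (p s : Fin N → ℝ) i + t * (q s : Fin N → ℝ) i = (p s : Fin N → ℝ) i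
    rw [hpq]; ring

lemma supp_trans {x y z : real G} {p : Path x y} {q : Path y z} {ρ : Finset (Fin N)}
    (hp : ∀ t, supp (p t : Fin N → ℝ) ⊆ ρ) (hq : ∀ t, supp (q t : Fin N → ℝ) ⊆ ρ)
    (t : unitInterval) : supp (p.trans q t : Fin N → ℝ) ⊆ ρ := by
  rw [Path.trans_apply]
  split_ifs
  · exact hp _
  · exact hq _

lemma edgePath_trans (hG : IsCx G) {a b c : Fin N} (habc : {a, b, c} ∈ G) (hab : {a, b} ∈ G)
    (hbc : {b, c} ∈ G) (hac : {a, c} ∈ G) :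
    ((edgePath hG hab).trans (edgePath hG hbc)).Homotopic (edgePath hG hac) := by
  refine homotopic_of_supp hG habc _ _ (supp_trans (fun t => (supp_edgePath hG hab t).trans ?_)
    fun t => (supp_edgePath hG hbc t).trans ?_) fun t => (supp_edgePath hG hac t).trans ?_ <;>
  · intro i hi; simp only [Finset.mem_insert, Finset.mem_singleton] at hi ⊢; tauto

/-- The inclusion of realizations. -/
def realIncl (h : F ⊆ G) : C(real F, real G) :=
  ⟨Set.inclusion (real_mono h), continuous_inclusion _⟩

/-- The boundary loop of a triangle. -/
def triLoop (hG : IsCx G) {a b c : Fin N} (hab : {a, b} ∈ G) (hbc : {b, c} ∈ G)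
    (hca : {c, a} ∈ G) : Path (vtx hG (hG.left hab)) (vtx hG (hG.left hab)) :=
  (edgePath hG hab).trans ((edgePath hG hbc).trans (edgePath hG hca))

lemma triLoop_map (hF : IsCx F) (hG : IsCx G) (hFG : F ⊆ G) {a b c : Fin N} (hab : {a, b} ∈ F)
    (hbc : {b, c} ∈ F) (hca : {c, a} ∈ F) :
    (triLoop hF hab hbc hca).map (realIncl hFG).continuous =
      triLoop hG (hFG hab) (hFG hbc) (hFG hca) := by
  rw [triLoop, Path.map_trans, Path.map_trans]; rfl

lemma triLoop_apply (hG : IsCx G) {a b c : Fin N} (hab : {a, b} ∈ G) (hbc : {b, c} ∈ G)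
    (hca : {c, a} ∈ G) (t : unitInterval) (i : Fin N) :
    (triLoop hG hab hbc hca t : Fin N → ℝ) i =
      if (t : ℝ) ≤ 1 / 2 then (1 - 2 * t) * (Pi.single a 1 : Fin N → ℝ) i +
        2 * t * (Pi.single b 1 : Fin N → ℝ) i
      else if (t : ℝ) ≤ 3 / 4 then (3 - 4 * t) * (Pi.single b 1 : Fin N → ℝ) i +
        (4 * t - 2) * (Pi.single c 1 : Fin N → ℝ) i
      else (4 - 4 * t) * (Pi.single c 1 : Fin N → ℝ) i +
        (4 * t - 3) * (Pi.single a 1 : Fin N → ℝ) i := by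
  rw [triLoop, Path.trans_apply]
  split_ifs with h1 h2
  · rw [edgePath_apply]
  · rw [Path.trans_apply, dif_pos (show (2 * (t : ℝ) - 1) ≤ 1 / 2 by linarith), edgePath_apply]
    dsimp only; ring
  · rw [Path.trans_apply, dif_neg (show ¬ (2 * (t : ℝ) - 1) ≤ 1 / 2 by linarith), edgePath_apply]
    dsimp only; ring


lemma IsCx.eq_of_card_three (hF : IsCx F) {ρ : Finset (Fin N)} (h : ρ.card = 3) :
    ∀ τ ∈ F, ρ ⊆ τ → τ = ρ := fun τ hτ hs =>
  (Finset.eq_of_subset_of_card_le hs (h ▸ hF.card_le τ hτ)).symm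

lemma exists_triangle_homeo (hF : IsCx F) {a b c : Fin N} (hab : a ≠ b) (hac : a ≠ c) (hbc : b ≠ c)
    (h : {a, b, c} ∈ F) (hG : IsCx (F.erase {a, b, c})) (h1 : {a, b} ∈ F.erase {a, b, c})
    (h2 : {b, c} ∈ F.erase {a, b, c}) (h3 : {c, a} ∈ F.erase {a, b, c}) :
    Nonempty (Att (loopMap (triLoop hG h1 h2 h3)) ≃ₜ real F) := by
  have hcard : ({a, b, c} : Finset (Fin N)).card = 3 := Finset.card_eq_three.2
    ⟨a, b, c, hab, hac, hbc, rfl⟩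
  set p := triLoop hG h1 h2 h3 with hp
  have ha : ∀ t : unitInterval, (p t : Fin N → ℝ) a = if (t : ℝ) ≤ 1 / 2 then 1 - 2 * (t : ℝ) else
      if (t : ℝ) ≤ 3 / 4 then 0 else 4 * t - 3 := fun t => by
    rw [hp, triLoop_apply]; simp [hab, hac]
  have hb : ∀ t : unitInterval, (p t : Fin N → ℝ) b = if (t : ℝ) ≤ 1 / 2 then 2 * (t : ℝ) else
      if (t : ℝ) ≤ 3 / 4 then 3 - 4 * t else 0 := fun t => by
    rw [hp, triLoop_apply]; simp [hab.symm, hbc]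
  have hc : ∀ t : unitInterval, (p t : Fin N → ℝ) c = if (t : ℝ) ≤ 1 / 2 then 0 else
      if (t : ℝ) ≤ 3 / 4 then 4 * (t : ℝ) - 2 else 4 - 4 * t := fun t => by
    rw [hp, triLoop_apply]; simp [hac.symm, hbc.symm]
  have hz : ∀ (t : unitInterval) i, i ≠ a → i ≠ b → i ≠ c → (p t : Fin N → ℝ) i = 0 :=
    fun t i h1 h2 h3 => by
      rw [hp, triLoop_apply]; simp [h1, h2, h3]
  refine ⟨(exists_att_homeo hF h (hF.eq_of_card_three hcard) (loopMap p) ?_ ?_ ?_).choose⟩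
  · intro s s' hss
    obtain ⟨t, rfl, ht⟩ := exists_coe_eq s
    obtain ⟨t', rfl, ht'⟩ := exists_coe_eq s'
    rw [loopMap_coe, loopMap_coe] at hss
    have ea := ha t
    have eb := hb t
    have ec := hc t
    rw [hss, ha t'] at ea
    rw [hss, hb t'] at eb
    rw [hss, hc t'] at ec
    have h0 := t.2.1
    have h0' := t'.2.1
    have : (t : ℝ) = t' := by
      split_ifs at ea eb ec <;> linarith
    rw [this]
  · intro s i hi
    obtain ⟨t, rfl, ht⟩ := exists_coe_eq s
    rw [loopMap_coe, mem_supp] at hi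
    by_contra hi'
    simp only [Finset.mem_insert, Finset.mem_singleton, not_or] at hi'
    exact hi (hz t i hi'.1 hi'.2.1 hi'.2.2)
  · intro x hx
    have hx0 : ∀ i, i ≠ a → i ≠ b → i ≠ c → (x : Fin N → ℝ) i = 0 := fun i h1 h2 h3 => by
      by_contra h
      have := hx (mem_supp.2 h)
      simp [h1, h2, h3] at this
    have hsum : (x : Fin N → ℝ) a + (x : Fin N → ℝ) b + (x : Fin N → ℝ) c = 1 := by
      rw [← x.2.2.1, ← sum_supp (x : Fin N → ℝ) (σ := {a, b, c}) (fun i hi => by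
        simp only [Finset.mem_insert, Finset.mem_singleton, not_or] at hi
        exact hx0 i hi.1 hi.2.1 hi.2.2), Finset.sum_insert (by simp [hab, hac]),
        Finset.sum_insert (by simp [hbc]), Finset.sum_singleton, add_assoc]
    have hna := x.2.1 a
    have hnb := x.2.1 b
    have hnc := x.2.1 c
    have key : ∀ t : unitInterval, (p t : Fin N → ℝ) a = (x : Fin N → ℝ) a →
        (p t : Fin N → ℝ) b = (x : Fin N → ℝ) b → (p t : Fin N → ℝ) c = (x : Fin N → ℝ) c →
        ∃ s, loopMap p s = x := fun t e1 e2 e3 => by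
      refine ⟨((t : ℝ) : UnitAddCircle), ?_⟩
      rw [loopMap_coe]
      refine Subtype.ext (funext fun i => ?_)
      by_cases i1 : i = a
      · rw [i1, e1]
      by_cases i2 : i = b
      · rw [i2, e2]
      by_cases i3 : i = c
      · rw [i3, e3]
      rw [hz t i i1 i2 i3, hx0 i i1 i2 i3]
    have hsome : (x : Fin N → ℝ) a = 0 ∨ (x : Fin N → ℝ) b = 0 ∨ (x : Fin N → ℝ) c = 0 := by
      by_contra! hne
      refine (Finset.mem_erase.1 x.2.2.2).1 (Finset.Subset.antisymm hx fun i hi => ?_)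
      simp only [Finset.mem_insert, Finset.mem_singleton] at hi
      rw [mem_supp]
      rcases hi with rfl | rfl | rfl
      exacts [hne.1, hne.2.1, hne.2.2]
    rcases hsome with h0 | h0 | h0
    · refine key ⟨((x : Fin N → ℝ) c + 2) / 4, by linarith, by linarith⟩ ?_ ?_ ?_
      · rw [ha]; dsimp only; split_ifs <;> linarith
      · rw [hb]; dsimp only; split_ifs <;> linarith
      · rw [hc]; dsimp only; split_ifs <;> linarith
    · refine key ⟨((x : Fin N → ℝ) a + 3) / 4, by linarith, by linarith⟩ ?_ ?_ ?_
      · rw [ha]; dsimp only; split_ifs <;> linarith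
      · rw [hb]; dsimp only; split_ifs <;> linarith
      · rw [hc]; dsimp only; split_ifs <;> linarith
    · refine key ⟨(x : Fin N → ℝ) b / 2, by linarith, by linarith⟩ ?_ ?_ ?_
      · rw [ha]; dsimp only; split_ifs <;> linarith
      · rw [hb]; dsimp only; split_ifs <;> linarith
      · rw [hc]; dsimp only; split_ifs <;> linarith

/-- The two ends of an edge. -/
def endsMap (hG : IsCx G) {a b : Fin N} (ha : {a} ∈ G) (hb : {b} ∈ G) : C(Bool, real G) :=
  ⟨fun s => if s then vtx hG ha else vtx hG hb, continuous_of_discreteTopology⟩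

lemma exists_edge_homeo (hF : IsCx F) {a b : Fin N} (hab : a ≠ b) (h : {a, b} ∈ F)
    (hmax : ∀ ρ ∈ F, {a, b} ⊆ ρ → ρ = {a, b}) (hG : IsCx (F.erase {a, b}))
    (ha : {a} ∈ F.erase {a, b}) (hb : {b} ∈ F.erase {a, b}) :
    ∃ e : Att (endsMap hG ha hb) ≃ₜ real F,
      (∀ x : real (F.erase {a, b}), (e (Att.incl _ x) : Fin N → ℝ) = x) ∧
      ∀ p, supp (e (Att.cellMap _ p) : Fin N → ℝ) ⊆ {a, b} := by
  refine exists_att_homeo hF h hmax (endsMap hG ha hb) ?_ ?_ ?_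
  · have hne : vtx hG ha ≠ vtx hG hb := fun e => by
      have := congrArg (fun z : real (F.erase {a, b}) => (z : Fin N → ℝ) a) e
      simp [vtx, hab] at this
    intro s t hst
    rcases s <;> rcases t <;> simp [endsMap, hne, hne.symm] at hst ⊢
  · intro s i hi
    rcases s
    · have : i = b := by
        by_contra h; simp [endsMap, vtx, h] at hi
      simp [this]
    · have : i = a := by
        by_contra h; simp [endsMap, vtx, h] at hi
      simp [this]
  · intro x hx
    have hx0 : ∀ i, i ≠ a → i ≠ b → (x : Fin N → ℝ) i = 0 := fun i h1 h2 => by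
      by_contra h
      have := hx (mem_supp.2 h)
      simp [h1, h2] at this
    have hsum : (x : Fin N → ℝ) a + (x : Fin N → ℝ) b = 1 := by
      rw [← x.2.2.1, ← sum_supp (x : Fin N → ℝ) (σ := {a, b}) (fun i hi => by
        simp only [Finset.mem_insert, Finset.mem_singleton, not_or] at hi
        exact hx0 i hi.1 hi.2), Finset.sum_insert (by simp [hab]), Finset.sum_singleton]
    by_cases h0 : (x : Fin N → ℝ) a = 0
    · refine ⟨false, Subtype.ext (funext fun i => ?_)⟩
      show (Pi.single b 1 : Fin N → ℝ) i = _
      by_cases hi : i = b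
      · subst hi; simp; linarith
      by_cases hia : i = a
      · subst hia; simp [hi, h0]
      · simp [hi, hx0 i hia hi]
    · have h1 : (x : Fin N → ℝ) b = 0 := by
        by_contra h1
        refine (Finset.mem_erase.1 x.2.2.2).1 (Finset.Subset.antisymm hx fun i hi => ?_)
        simp only [Finset.mem_insert, Finset.mem_singleton] at hi
        rw [mem_supp]
        rcases hi with rfl | rfl
        exacts [h0, h1]
      refine ⟨true, Subtype.ext (funext fun i => ?_)⟩
      show (Pi.single a 1 : Fin N → ℝ) i = _
      by_cases hi : i = a
      · subst hi; simp; linarith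
      by_cases hib : i = b
      · subst hib; simp [hi, h1]
      · simp [hi, hx0 i hi hib]

end

noncomputable section
open scoped ContinuousMap

variable {N : ℕ} {F G : Finset (Finset (Fin N))}

/-- Two vertices joined by an edge path. -/
def Reach (F : Finset (Finset (Fin N))) : Fin N → Fin N → Prop :=
  Relation.ReflTransGen fun x y => {x, y} ∈ F

/-- Combinatorial connectedness. -/
def Conn (F : Finset (Finset (Fin N))) : Prop :=
  (∃ a, {a} ∈ F) ∧ ∀ a b, {a} ∈ F → {b} ∈ F → Reach F a b

lemma Reach.mono (h : F ⊆ G) {a b : Fin N} (hab : Reach F a b) : Reach G a b :=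
  Relation.ReflTransGen.mono (fun _ _ hxy => h hxy) _ _ hab

lemma Reach.symm {a b : Fin N} (hab : Reach F a b) : Reach F b a := by
  induction hab with
  | refl => exact .refl
  | tail _ hbc ih => exact .head (by rwa [Finset.pair_comm]) ih

lemma joined_of_supp (hG : IsCx G) {ρ : Finset (Fin N)} (hρ : ρ ∈ G) (x y : real G)
    (hx : supp (x : Fin N → ℝ) ⊆ ρ) (hy : supp (y : Fin N → ℝ) ⊆ ρ) : Joined x y := by
  have hz : ∀ (p : real G), supp (p : Fin N → ℝ) ⊆ ρ → ∀ i, i ∉ ρ →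
      (p : Fin N → ℝ) i = 0 := fun p hp i hi => by
    by_contra h
    exact hi (hp (mem_supp.2 h))
  refine ⟨⟨⟨fun t => ⟨fun i => (1 - (t : ℝ)) * (x : Fin N → ℝ) i + t * (y : Fin N → ℝ) i, ?_⟩, ?_⟩,
    ?_, ?_⟩⟩
  · have h0 := t.2.1
    have h1 : 0 ≤ 1 - (t : ℝ) := sub_nonneg.2 t.2.2
    refine mem_real_of_subset hG (fun i => ?_) ?_ hρ fun i hi => ?_
    · exact add_nonneg (mul_nonneg h1 (x.2.1 i)) (mul_nonneg h0 (y.2.1 i))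
    · rw [Finset.sum_add_distrib, ← Finset.mul_sum, ← Finset.mul_sum, x.2.2.1, y.2.2.1]
      ring
    · rw [hz x hx _ hi, hz y hy _ hi]; simp
  · refine Continuous.subtype_mk (continuous_pi fun i => ?_) _
    fun_prop
  · exact Subtype.ext (funext fun i => by simp)
  · exact Subtype.ext (funext fun i => by simp)

lemma supp_vtx (hG : IsCx G) {a : Fin N} (h : {a} ∈ G) :
    supp (vtx hG h : Fin N → ℝ) ⊆ {a} := by
  intro i hi
  by_contra h'
  simp only [Finset.mem_singleton] at h'
  simp [vtx, h'] at hi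

lemma Conn.pathConnectedSpace (hF : IsCx F) (h : Conn F) : PathConnectedSpace (real F) := by
  obtain ⟨⟨a, ha⟩, hr⟩ := h
  have key : ∀ b, Reach F a b → ∀ hb : {b} ∈ F, Joined (vtx hF ha) (vtx hF hb) := by
    intro b hab
    induction hab with
    | refl => intro hb; exact Joined.refl _
    | tail _ hbc ih =>
      intro hc
      exact (ih (hF.left hbc)).trans ⟨edgePath hF hbc⟩
  have key2 : ∀ x : real F, Joined (vtx hF ha) x := by
    intro x
    obtain ⟨b, hb⟩ := supp_nonempty x.2.2.1
    have hb' : {b} ∈ F := hF.down _ x.2.2.2 _ (by simpa using hb) (by simp)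
    refine (key b (hr a b ha hb') hb').trans (joined_of_supp hF x.2.2.2 _ _ ?_ subset_rfl)
    exact (supp_vtx hF hb').trans (Finset.singleton_subset_iff.2 hb)
  exact ⟨⟨vtx hF ha⟩, fun x y => (key2 x).symm.trans (key2 y)⟩

lemma conn_of_isConnected (hF : IsCx F) (h : IsConnected (real F)) : Conn F := by
  classical
  obtain ⟨x, hx⟩ := h.1
  obtain ⟨a₀, ha₀⟩ := supp_nonempty hx.2.1
  refine ⟨⟨a₀, hF.down _ hx.2.2 _ (by simpa using ha₀) (by simp)⟩, fun a b ha hb => ?_⟩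
  by_contra hab
  let A := F.filter fun ρ => ∀ i ∈ ρ, Reach F a i
  let B := F.filter fun ρ => ∀ i ∈ ρ, ¬ Reach F a i
  have hA : IsCx A := ⟨fun σ hσ => hF.1 σ (Finset.mem_filter.1 hσ).1,
    fun σ hσ => hF.2 σ (Finset.mem_filter.1 hσ).1, fun σ hσ τ hτ hn =>
      Finset.mem_filter.2 ⟨hF.3 σ (Finset.mem_filter.1 hσ).1 τ hτ hn,
        fun i hi => (Finset.mem_filter.1 hσ).2 i (hτ hi)⟩⟩
  have hB : IsCx B := ⟨fun σ hσ => hF.1 σ (Finset.mem_filter.1 hσ).1,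
    fun σ hσ => hF.2 σ (Finset.mem_filter.1 hσ).1, fun σ hσ τ hτ hn =>
      Finset.mem_filter.2 ⟨hF.3 σ (Finset.mem_filter.1 hσ).1 τ hτ hn,
        fun i hi => (Finset.mem_filter.1 hσ).2 i (hτ hi)⟩⟩
  have hAB : F ⊆ A ∪ B := fun ρ hρ => by
    obtain ⟨i, hi⟩ := hF.1 ρ hρ
    have hpair : ∀ j ∈ ρ, ∀ k ∈ ρ, Reach F a j → Reach F a k := fun j hj k hk hr =>
      Relation.ReflTransGen.tail hr (hF.3 ρ hρ _ (by
        intro l hl; simp only [Finset.mem_insert, Finset.mem_singleton] at hl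
        rcases hl with rfl | rfl <;> assumption) (by simp))
    by_cases h : Reach F a i
    · exact Finset.mem_union_left _ (Finset.mem_filter.2 ⟨hρ, fun j hj => hpair i hi j hj h⟩)
    · exact Finset.mem_union_right _
        (Finset.mem_filter.2 ⟨hρ, fun j hj hr => h (hpair j hj i hi hr)⟩)
  obtain ⟨y, -, hyA, hyB⟩ := isPreconnected_closed_iff.1 h.2 (real A) (real B)
    (isCompact_real hA).isClosed (isCompact_real hB).isClosed
    (fun x hx => by
      rcases Finset.mem_union.1 (hAB hx.2.2) with h | h
      · exact .inl ⟨hx.1, hx.2.1, h⟩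
      · exact .inr ⟨hx.1, hx.2.1, h⟩)
    ⟨vtx hF ha, (vtx hF ha).2, (vtx hA (a := a) (Finset.mem_filter.2 ⟨ha, fun i hi => by
      rw [Finset.mem_singleton.1 hi]; exact .refl⟩)).2⟩
    ⟨vtx hF hb, (vtx hF hb).2, (vtx hB (a := b) (Finset.mem_filter.2 ⟨hb, fun i hi => by
      rw [Finset.mem_singleton.1 hi]; exact hab⟩)).2⟩
  obtain ⟨i, hi⟩ := supp_nonempty hyA.2.1
  exact (Finset.mem_filter.1 hyB.2.2).2 i hi ((Finset.mem_filter.1 hyA.2.2).2 i hi)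

lemma InclHE.isWedge (h : InclHE F G) (hF : IsWedge (real F)) : IsWedge (real G) := by
  obtain ⟨e, -⟩ := h
  exact .congr e.symm hF

lemma InclHE.contractible (h : InclHE F G) (hF : ContractibleSpace (real F)) :
    ContractibleSpace (real G) := by
  obtain ⟨e, -⟩ := h
  exact e.symm.contractibleSpace

/-- The realization of a single vertex. -/
def realSingletonHomeo (a : Fin N) : real ({{a}} : Finset (Finset (Fin N))) ≃ₜ Unit where
  toFun _ := ()
  invFun _ := ⟨Pi.single a 1, fun i => by
    by_cases hi : i = a <;> simp [hi], by simp, by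
      rw [Finset.mem_singleton]; ext i; by_cases hi : i = a <;> simp [hi]⟩
  left_inv x := by
    have hx := Finset.mem_singleton.1 x.2.2.2
    have h0 : ∀ i, i ≠ a → (x : Fin N → ℝ) i = 0 := fun i hi => by
      by_contra h
      have := mem_supp.2 h
      rw [hx] at this
      exact hi (Finset.mem_singleton.1 this)
    have h1 := x.2.2.1
    rw [Fintype.sum_eq_single a h0] at h1
    refine Subtype.ext (funext fun i => ?_)
    by_cases hi : i = a
    · subst hi; simp [h1]
    · simp [hi, h0 i hi]
  right_inv _ := rfl
  continuous_toFun := by fun_prop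
  continuous_invFun := by fun_prop

lemma isWedge_singleton (a : Fin N) : IsWedge (real ({{a}} : Finset (Finset (Fin N)))) :=
  .of_homeo_unit (realSingletonHomeo a).toHomotopyEquiv

lemma contractible_singleton (a : Fin N) :
    ContractibleSpace (real ({{a}} : Finset (Finset (Fin N)))) :=
  (realSingletonHomeo a).contractibleSpace

lemma IsWedge.circle_attach (hF : IsCx F) {a b : Fin N} (hab : a ≠ b) (h : {a, b} ∈ F)
    (hmax : ∀ ρ ∈ F, {a, b} ⊆ ρ → ρ = {a, b}) (hc : Conn (F.erase {a, b}))
    (hw : IsWedge (real (F.erase {a, b}))) : IsWedge (real F) := by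
  have hG := erase_isCx hF hmax
  have hne : ∀ c : Fin N, ({c} : Finset (Fin N)) ≠ {a, b} := fun c e => by
    have := congrArg Finset.card e
    rw [Finset.card_pair hab] at this
    simp at this
  obtain ⟨e, -⟩ := exists_edge_homeo hF hab h hmax hG
    (Finset.mem_erase.2 ⟨hne a, hF.left h⟩) (Finset.mem_erase.2 ⟨hne b, hF.right h⟩)
  have := hc.pathConnectedSpace hG
  obtain ⟨x₀⟩ : Nonempty (real (F.erase {a, b})) := PathConnectedSpace.nonempty
  obtain ⟨E, hE⟩ := exists_circle_homeo
  refine .congr e.symm.toHomotopyEquiv (.att_of_homotopic_const .circle E hE hw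
    (a := x₀) ?_)
  let p : Path (endsMap hG (Finset.mem_erase.2 ⟨hne a, hF.left h⟩)
      (Finset.mem_erase.2 ⟨hne b, hF.right h⟩)) (.const Bool x₀) :=
    boolPath fun s => PathConnectedSpace.somePath _ x₀
  exact ⟨⟨p.toContinuousMap.uncurry, fun s => by simp [p], fun s => by simp [p]⟩⟩

lemma IsWedge.sphere_attach (hF : IsCx F) {a b c : Fin N} (hab : a ≠ b) (hac : a ≠ c) (hbc : b ≠ c)
    (h : {a, b, c} ∈ F) (hG : IsCx (F.erase {a, b, c})) (h1 : {a, b} ∈ F.erase {a, b, c})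
    (h2 : {b, c} ∈ F.erase {a, b, c}) (h3 : {c, a} ∈ F.erase {a, b, c})
    (hc : Conn (F.erase {a, b, c})) (hw : IsWedge (real (F.erase {a, b, c})))
    (hn : (triLoop hG h1 h2 h3).Homotopic (.refl _)) : IsWedge (real F) := by
  obtain ⟨e⟩ := exists_triangle_homeo hF hab hac hbc h hG h1 h2 h3
  have := hc.pathConnectedSpace hG
  obtain ⟨E, hE⟩ := exists_sphere_homeo
  refine .congr e.symm.toHomotopyEquiv (.att_of_homotopic_const .sphere E hE hw
    (a := vtx hG (hG.left h1)) ?_)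
  exact (loopMap_homotopic hn).trans (by rw [loopMap_refl])

end

noncomputable section
open scoped ContinuousMap

variable {N : ℕ} {F G K D : Finset (Finset (Fin N))}

lemma loopMap_sq_congr {A : Type} [TopologicalSpace A] {x y x' y' : A} {p : Path x y}
    {q : Path y x} {p' : Path x' y'} {q' : Path y' x'} (hp : ∀ t, p t = p' t)
    (hq : ∀ t, q t = q' t) : loopMap ((p.trans q).trans (p.trans q)) =
      loopMap ((p'.trans q').trans (p'.trans q')) := by
  have h : y = y' := by simpa using hp 1
  have h' : x = x' := by simpa using hp 0
  subst h h'
  obtain rfl : p = p' := Path.ext (funext hp)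
  obtain rfl : q = q' := Path.ext (funext hq)
  rfl

/-- A path between vertices, viewed in a larger complex. -/
def incPath (hF : IsCx F) (hG : IsCx G) (h : F ⊆ G) {a b : Fin N} {ha : {a} ∈ F} {hb : {b} ∈ F}
    (u : Path (vtx hF ha) (vtx hF hb)) : Path (vtx hG (h ha)) (vtx hG (h hb)) :=
  u.map (realIncl h).continuous

lemma incPath_trans (hF : IsCx F) (hG : IsCx G) (h : F ⊆ G) {a b c : Fin N} {ha : {a} ∈ F}
    {hb : {b} ∈ F} {hc : {c} ∈ F} (u : Path (vtx hF ha) (vtx hF hb))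
    (w : Path (vtx hF hb) (vtx hF hc)) :
    incPath hF hG h (u.trans w) = (incPath hF hG h u).trans (incPath hF hG h w) :=
  Path.map_trans u w _

lemma incPath_homotopic (hF : IsCx F) (hG : IsCx G) (h : F ⊆ G) {a b : Fin N} {ha : {a} ∈ F}
    {hb : {b} ∈ F} {u w : Path (vtx hF ha) (vtx hF hb)} (huw : u.Homotopic w) :
    (incPath hF hG h u).Homotopic (incPath hF hG h w) := huw.map (realIncl h)

/-- Attaching a triangle along the square of a loop through an edge. -/
lemma IsWedge.rp2_attach (hF : IsCx F) {a b c : Fin N} {ρ : Finset (Fin N)} (hρ : ρ = {a, b, c})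
    (hab : a ≠ b) (hac : a ≠ c) (hbc : b ≠ c) (h : ρ ∈ F) (hG : IsCx (F.erase ρ))
    (h1 : {a, b} ∈ F.erase ρ) (h2 : {b, c} ∈ F.erase ρ) (h3 : {c, a} ∈ F.erase ρ)
    (hK : IsCx K) (hKG : K ⊆ F.erase ρ) (hHE : InclHE K (F.erase ρ)) {p q : Fin N} (hpq : p ≠ q)
    (hpqK : {p, q} ∈ K) (hmax : ∀ τ ∈ K, {p, q} ⊆ τ → τ = {p, q}) (hA : IsCx (K.erase {p, q}))
    (hc : Conn (K.erase {p, q})) (hw : IsWedge (real (K.erase {p, q})))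
    (hp : {p} ∈ K.erase {p, q}) (hq : {q} ∈ K.erase {p, q}) (u : Path (vtx hA hq) (vtx hA hp))
    (hsq : (loopMap (triLoop hG h1 h2 h3)).Homotopic
      (loopMap (incPath hK hG hKG
        (((edgePath hK hpqK).trans (incPath hA hK (Finset.erase_subset {p, q} K) u)).trans
          ((edgePath hK hpqK).trans (incPath hA hK (Finset.erase_subset {p, q} K) u)))))) :
    IsWedge (real F) := by
  subst hρ
  obtain ⟨e0⟩ := exists_triangle_homeo hF hab hac hbc h hG h1 h2 h3
  obtain ⟨E, hE⟩ := hHE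
  set φ := endsMap hA hp hq with hφ
  obtain ⟨ee, hee, hee'⟩ : ∃ e : Att φ ≃ₜ real K,
      (∀ x : real (K.erase {p, q}), (e (Att.incl _ x) : Fin N → ℝ) = x) ∧
      ∀ t, supp (e (Att.cellMap _ t) : Fin N → ℝ) ⊆ {p, q} :=
    exists_edge_homeo hK hpq hpqK hmax hA hp hq
  have := hc.pathConnectedSpace hA
  have hE' : E.toFun = realIncl hKG := ContinuousMap.ext fun x => Subtype.ext (hE x)
  set U := incPath hA hK (Finset.erase_subset {p, q} K) u
  let uA : Path (Att.incl φ (φ false)) (Att.incl φ (φ true)) := u.map (Att.incl φ).continuous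
  let W' := (arcPath φ).trans uA
  have hw2 : IsWedge (Att (loopMap (W'.trans W'))) := IsWedge.att_rp2 hw (φ := φ) u
  have hp' : vtx hK (hK.left hpqK) = ee (Att.incl φ (φ true)) := 
    Subtype.ext (hee (vtx hA hp)).symm
  have hq' : vtx hK (hK.right hpqK) = ee (Att.incl φ (φ false)) :=
    Subtype.ext (hee (vtx hA hq)).symm
  have eeq : Path.Homotopic (((arcPath φ).map ee.continuous).cast hp' hq') (edgePath hK hpqK) := by
    refine homotopic_of_supp hK hpqK _ _ (fun t => ?_) (supp_edgePath hK hpqK)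
    have : (((arcPath φ).map ee.continuous).cast hp' hq') t = ee (arcPath φ t) := rfl
    rw [this]
    have := arcPath_apply φ (ee : C(Att φ, real K)) t
    change ee (arcPath φ t) = _ at this
    rw [this]
    split_ifs <;> exact hee' _
  have hloop : ((ee : C(Att φ, real K)).comp (loopMap (W'.trans W'))).Homotopic
      (loopMap (((edgePath hK hpqK).trans U).trans ((edgePath hK hpqK).trans U))) := by
    rw [comp_loopMap, Path.map_trans, Path.map_trans,
      loopMap_sq_congr (p' := ((arcPath φ).map ee.continuous).cast hp' hq') (q' := U)]
    · exact loopMap_homotopic ((eeq.hcomp (.refl U)).hcomp (eeq.hcomp (.refl U)))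
    · intro t; rfl
    · intro t; exact Subtype.ext (hee _)
  obtain ⟨E1⟩ := Att.equiv_of_homotopic ee.toHomotopyEquiv hloop
  have hloop2 : (E.toFun.comp (loopMap (((edgePath hK hpqK).trans U).trans
      ((edgePath hK hpqK).trans U)))).Homotopic (loopMap (triLoop hG h1 h2 h3)) := by
    rw [hE', comp_loopMap]
    exact hsq.symm
  obtain ⟨E2⟩ := Att.equiv_of_homotopic E hloop2
  exact .congr (e0.symm.toHomotopyEquiv.trans (E1.trans E2).symm) hw2

/-- Loop classes form a group. -/
@[reducible] def loopGroup {A : Type} [TopologicalSpace A] (x : A) :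
    Group (Path.Homotopic.Quotient x x) where
  mul p q := p.trans q
  one := .refl x
  inv p := p.symm
  mul_assoc p q r := Path.Homotopic.Quotient.trans_assoc p q r
  one_mul p := Path.Homotopic.Quotient.refl_trans p
  mul_one p := Path.Homotopic.Quotient.trans_refl p
  inv_mul_cancel p := Path.Homotopic.Quotient.symm_trans p

/-- The boundary word of a triangle is trivial or the square of an edge in the groups attached to
edge paths. -/
def SqWord (G D : Finset (Finset (Fin N))) (a b c p q : Fin N) : Prop :=
  ∀ (H : Type) [Group H] (x : Fin N → Fin N → H),
    (∀ i j, {i, j} ∈ G → x i j * x j i = 1) →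
    (∀ i j k, {i, j, k} ∈ G → x i j * x j k = x i k) →
    (∀ i j, {i, j} ∈ D → x i j = 1) →
    x a b * x b c * x c a = 1 ∨ x a b * x b c * x c a = x p q * x p q ∨
      (x a b * x b c * x c a) * (x p q * x p q) = 1

open Path.Homotopic.Quotient in
lemma IsWedge.of_sqWord (hF : IsCx F) {a b c : Fin N}
    (hab : a ≠ b) (hac : a ≠ c) (hbc : b ≠ c) (h : {a, b, c} ∈ F)
    (hcG : Conn (F.erase {a, b, c})) (hwG : IsWedge (real (F.erase {a, b, c})))
    (hK : IsCx K) (hKG : K ⊆ F.erase {a, b, c}) (hHE : InclHE K (F.erase {a, b, c}))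
    {p q : Fin N} (hpq : p ≠ q)
    (hpqK : {p, q} ∈ K) (hmax : ∀ τ ∈ K, {p, q} ⊆ τ → τ = {p, q})
    (hc : Conn (K.erase {p, q})) (hw : IsWedge (real (K.erase {p, q})))
    (hD : IsCx D) (hDA : D ⊆ K.erase {p, q}) (hDc : ContractibleSpace (real D)) (hp : {p} ∈ D)
    (hq : {q} ∈ D) (hsq : SqWord (F.erase {a, b, c}) D a b c p q) : IsWedge (real F) := by
  have hcard : ({a, b, c} : Finset (Fin N)).card = 3 := Finset.card_eq_three.2
    ⟨a, b, c, hab, hac, hbc, rfl⟩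
  have hG := erase_isCx hF (hF.eq_of_card_three hcard)
  have hA := erase_isCx hK hmax
  have hedge : ∀ i j, i ∈ ({a, b, c} : Finset (Fin N)) → j ∈ ({a, b, c} : Finset (Fin N)) →
      {i, j} ∈ F.erase {a, b, c} := fun i j hi hj => by
    refine Finset.mem_erase.2 ⟨fun e => ?_, hF.down _ h _ ?_ (by simp)⟩
    · have := Finset.card_le_two (a := i) (b := j)
      rw [e, hcard] at this; omega
    · intro l hl
      simp only [Finset.mem_insert, Finset.mem_singleton] at hl
      rcases hl with rfl | rfl <;> assumption
  have h1 := hedge a b (by simp) (by simp)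
  have h2 := hedge b c (by simp) (by simp)
  have h3 := hedge c a (by simp) (by simp)
  have h1' := hedge b a (by simp) (by simp)
  have h2' := hedge c b (by simp) (by simp)
  have h3' := hedge a c (by simp) (by simp)
  have hpc := hcG.pathConnectedSpace hG
  have hsc : SimplyConnectedSpace (real D) := inferInstance
  have hDG : D ⊆ F.erase {a, b, c} := (hDA.trans (Finset.erase_subset _ _)).trans hKG
  set v := vtx hG (hDG hp) with hv
  let P : ∀ i (hi : {i} ∈ F.erase {a, b, c}), Path v (vtx hG hi) := fun i hi =>
    if hiD : {i} ∈ D then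
      incPath hD hG hDG (PathConnectedSpace.somePath (vtx hD hp) (vtx hD hiD))
    else PathConnectedSpace.somePath _ _
  have hP : ∀ i (hi : {i} ∈ D), P i (hDG hi) =
      incPath hD hG hDG (PathConnectedSpace.somePath (vtx hD hp) (vtx hD hi)) :=
    fun i hi => dif_pos hi
  let : Group (Path.Homotopic.Quotient v v) := loopGroup v
  let x : Fin N → Fin N → Path.Homotopic.Quotient v v := fun i j =>
    if hij : {i, j} ∈ F.erase {a, b, c} then
      (mk (P i (hG.left hij))).trans ((mk (edgePath hG hij)).trans (mk (P j (hG.right hij))).symm)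
    else 1
  have hx : ∀ i j (hij : {i, j} ∈ F.erase {a, b, c}), x i j =
      (mk (P i (hG.left hij))).trans ((mk (edgePath hG hij)).trans
        (mk (P j (hG.right hij))).symm) := fun i j hij => dif_pos hij
  have hmul : ∀ y z : Path.Homotopic.Quotient v v, y * z = y.trans z := fun _ _ => rfl
  have hone : (1 : Path.Homotopic.Quotient v v) = .refl v := rfl
  have hx1 : ∀ i j, {i, j} ∈ F.erase {a, b, c} → x i j * x j i = 1 := by
    intro i j hij
    have hji : {j, i} ∈ F.erase {a, b, c} := by rwa [Finset.pair_comm j i]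
    rw [hx i j hij, hx j i hji, ← edgePath_symm hG hij hji, hmul, hone]
    simp only [trans_assoc, symm_trans_cancel, mk_symm, trans_symm_cancel, trans_symm]
  have hx2 : ∀ i j k, {i, j, k} ∈ F.erase {a, b, c} → x i j * x j k = x i k := by
    intro i j k hijk
    have hij : {i, j} ∈ F.erase {a, b, c} := hG.down _ hijk _ (by
      intro l; simp only [Finset.mem_insert, Finset.mem_singleton]; tauto) (by simp)
    have hjk : {j, k} ∈ F.erase {a, b, c} := hG.down _ hijk _ (by
      intro l; simp only [Finset.mem_insert, Finset.mem_singleton]; tauto) (by simp)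
    have hik : {i, k} ∈ F.erase {a, b, c} := hG.down _ hijk _ (by
      intro l; simp only [Finset.mem_insert, Finset.mem_singleton]; tauto) (by simp)
    have := eq.2 (edgePath_trans hG hijk hij hjk hik)
    rw [hx i j hij, hx j k hjk, hx i k hik, hmul, ← this, mk_trans]
    simp only [trans_assoc, symm_trans_cancel]
  have hPD : ∀ i j (hij : {i, j} ∈ D), mk (P j (hDG (hD.right hij))) =
      (mk (P i (hDG (hD.left hij)))).trans (mk (edgePath hG (hDG hij))) := by
    intro i j hij
    have := incPath_homotopic hD hG hDG (SimplyConnectedSpace.paths_homotopic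
      (PathConnectedSpace.somePath (vtx hD hp) (vtx hD (hD.right hij)))
      ((PathConnectedSpace.somePath (vtx hD hp) (vtx hD (hD.left hij))).trans
        (edgePath hD hij)))
    rw [incPath_trans] at this
    rw [hP i (hD.left hij), hP j (hD.right hij), ← mk_trans]
    exact eq.2 this
  have hx3 : ∀ i j, {i, j} ∈ D → x i j = 1 := by
    intro i j hij
    rw [hx i j (hDG hij), hPD i j hij, hone, ← trans_assoc, trans_symm]
  let u0 : Path (vtx hD hq) (vtx hD hp) := PathConnectedSpace.somePath _ _
  let u : Path (vtx hA (hDA hq)) (vtx hA (hDA hp)) := incPath hD hA hDA u0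
  let W := (edgePath hK hpqK).trans (incPath hA hK (Finset.erase_subset {p, q} K) u)
  let W' : Path v v := incPath hK hG hKG W
  have hxpq : x p q = mk W' := by
    have e1 : mk (P p (hG.left (hKG hpqK))) = .refl v := by
      have := incPath_homotopic hD hG hDG (SimplyConnectedSpace.paths_homotopic
        (PathConnectedSpace.somePath (vtx hD hp) (vtx hD hp)) (.refl _))
      rw [hP p hp, ← mk_refl]
      exact eq.2 this
    have e2 : (mk (P q (hG.right (hKG hpqK)))).symm = mk (incPath hD hG hDG u0) := by
      have := incPath_homotopic hD hG hDG (SimplyConnectedSpace.paths_homotopic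
        (PathConnectedSpace.somePath (vtx hD hp) (vtx hD hq)).symm u0)
      rw [hP q hq, ← mk_symm]
      exact eq.2 this
    have e3 : W' = (edgePath hG (hKG hpqK)).trans (incPath hD hG hDG u0) :=
      incPath_trans _ _ _ _ _
    rw [hx p q (hKG hpqK), e1, e2, refl_trans, e3, mk_trans]
  have hword : ∀ i j k (hij : {i, j} ∈ F.erase {a, b, c}) (hjk : {j, k} ∈ F.erase {a, b, c})
      (hki : {k, i} ∈ F.erase {a, b, c}), x i j * x j k * x k i =
      (mk (P i (hG.left hij))).trans ((mk (triLoop hG hij hjk hki)).trans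
        (mk (P i (hG.left hij))).symm) := by
    intro i j k hij hjk hki
    rw [hx i j hij, hx j k hjk, hx k i hki, hmul, hmul, triLoop, mk_trans, mk_trans]
    simp only [trans_assoc, symm_trans_cancel]
  have key : ∀ i j k (hij : {i, j} ∈ F.erase {a, b, c}) (hjk : {j, k} ∈ F.erase {a, b, c})
      (hki : {k, i} ∈ F.erase {a, b, c}), {a, b, c} = ({i, j, k} : Finset (Fin N)) → i ≠ j →
      i ≠ k → j ≠ k → x i j * x j k * x k i = x p q * x p q → IsWedge (real F) := by
    intro i j k hij hjk hki he n1 n2 n3 hsq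
    refine .rp2_attach hF he n1 n2 n3 h hG hij hjk hki hK hKG hHE hpq hpqK hmax hA hc hw
      (hDA hp) (hDA hq) u ?_
    rw [hword i j k hij hjk hki, hxpq, hmul, ← mk_symm, ← mk_trans, ← mk_trans, ← mk_trans,
      eq] at hsq
    refine (loopMap_conj (P i (hG.left hij)) _).symm.trans ?_
    refine (loopMap_homotopic hsq).trans ?_
    have : incPath hK hG hKG (W.trans W) = W'.trans W' := incPath_trans _ _ _ _ _
    rw [this]
  rcases hsq _ x hx1 hx2 hx3 with hs | hs | hs
  · refine .sphere_attach hF hab hac hbc h hG h1 h2 h3 hcG hwG ?_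
    rw [hword a b c h1 h2 h3, hone] at hs
    have := congrArg (fun z => (mk (P a (hG.left h1))).symm.trans
      (z.trans (mk (P a (hG.left h1))))) hs
    simp only [trans_assoc, symm_trans_cancel, symm_trans, refl_trans, trans_refl] at this
    rw [← eq, this, mk_refl]
  · exact key a b c h1 h2 h3 rfl hab hac hbc hs
  · refine key a c b h3' h2' h1' ?_ hac hab hbc.symm ?_
    · ext l; simp only [Finset.mem_insert, Finset.mem_singleton]; tauto
    · have i1 := eq_inv_of_mul_eq_one_left (hx1 a c h3')
      have i2 := eq_inv_of_mul_eq_one_left (hx1 c b h2')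
      have i3 := eq_inv_of_mul_eq_one_left (hx1 b a h1')
      rw [i1, i2, i3, ← mul_eq_one_iff_inv_eq.1 hs]
      simp only [mul_inv_rev, mul_assoc]

end

noncomputable section
open scoped ContinuousMap

variable {N : ℕ} {F G K D : Finset (Finset (Fin N))}

/-- The vertices of a complex, as singleton faces. -/
def verts (F : Finset (Finset (Fin N))) : Finset (Finset (Fin N)) := F.filter fun τ => τ.card = 1

/-- The edges of a complex. -/
def edges (F : Finset (Finset (Fin N))) : Finset (Finset (Fin N)) := F.filter fun τ => τ.card = 2

/-- The triangles of a complex. -/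
def tris (F : Finset (Finset (Fin N))) : Finset (Finset (Fin N)) := F.filter fun τ => τ.card = 3

lemma mem_verts {σ : Finset (Fin N)} : σ ∈ verts F ↔ σ ∈ F ∧ σ.card = 1 := Finset.mem_filter

lemma mem_edges {σ : Finset (Fin N)} : σ ∈ edges F ↔ σ ∈ F ∧ σ.card = 2 := Finset.mem_filter

lemma mem_tris {σ : Finset (Fin N)} : σ ∈ tris F ↔ σ ∈ F ∧ σ.card = 3 := Finset.mem_filter

/-- The number of triangles of `F` that contain `ε`. -/
def dg (F : Finset (Finset (Fin N))) (ε : Finset (Fin N)) : ℕ :=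
  ((tris F).filter fun τ => ε ⊆ τ).card

/-- The Euler characteristic. -/
def eul (F : Finset (Finset (Fin N))) : ℤ := ∑ σ ∈ F, (-1) ^ (σ.card + 1)

lemma eul_union_inter (A B : Finset (Finset (Fin N))) :
    eul (A ∪ B) + eul (A ∩ B) = eul A + eul B := Finset.sum_union_inter

lemma eul_erase {σ : Finset (Fin N)} (h : σ ∈ F) :
    eul F = eul (F.erase σ) + (-1) ^ (σ.card + 1) := (Finset.sum_erase_add _ _ h).symm

lemma eul_eq (hF : IsCx F) : eul F = (verts F).card - (edges F).card + (tris F).card := by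
  have : ∀ σ ∈ F, ((-1 : ℤ) ^ (σ.card + 1)) = (if σ.card = 1 then 1 else 0) -
      (if σ.card = 2 then 1 else 0) + (if σ.card = 3 then 1 else 0) := by
    intro σ h
    have h1 := (hF.nonempty σ h).card_pos
    have h2 := hF.card_le σ h
    have : σ.card = 1 ∨ σ.card = 2 ∨ σ.card = 3 := by omega
    rcases this with e | e | e <;> rw [e] <;> norm_num
  rw [eul, Finset.sum_congr rfl this, Finset.sum_add_distrib, Finset.sum_sub_distrib]
  simp only [Finset.sum_boole]
  rfl

lemma dg_mono {A B : Finset (Finset (Fin N))} (h : A ⊆ B) (ε : Finset (Fin N)) :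
    dg A ε ≤ dg B ε :=
  Finset.card_le_card (Finset.filter_subset_filter _ (Finset.filter_subset_filter _ h))

lemma sum_dg (hF : IsCx F) : ∑ ε ∈ edges F, dg F ε = 3 * (tris F).card := by
  have := Finset.sum_card_bipartiteAbove_eq_sum_card_bipartiteBelow (s := edges F) (t := tris F)
    (fun ε τ => ε ⊆ τ)
  rw [show ∑ ε ∈ edges F, dg F ε = ∑ ε ∈ edges F,
    (Finset.bipartiteAbove (fun ε τ => ε ⊆ τ) (tris F) ε).card from rfl, this,
    Finset.sum_const_nat (m := 3), mul_comm]
  intro τ hτ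
  obtain ⟨h, h3⟩ := mem_tris.1 hτ
  have : Finset.bipartiteBelow (fun ε τ => ε ⊆ τ) (edges F) τ = τ.powersetCard 2 := by
    ext ε
    simp only [Finset.bipartiteBelow, Finset.mem_filter, mem_edges, Finset.mem_powersetCard]
    refine ⟨fun h => ⟨h.2, h.1.2⟩, fun ⟨h1, h2⟩ => ⟨⟨hF.down τ h ε h1 ?_, h2⟩, h1⟩⟩
    exact Finset.card_pos.1 (by omega)
  rw [this, Finset.card_powersetCard, h3]
  rfl

/-- The total excess of the edge degrees over two. -/
def exc (F : Finset (Finset (Fin N))) : ℤ := ∑ ε ∈ edges F, ((dg F ε : ℤ) - 2)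

lemma three_mul_eul (hF : IsCx F) :
    3 * eul F = 3 * (verts F).card - (edges F).card + exc F := by
  have h := sum_dg hF
  have h' : (∑ ε ∈ edges F, (dg F ε : ℤ)) = 3 * (tris F).card := by exact_mod_cast h
  rw [exc, Finset.sum_sub_distrib, h', eul_eq hF]
  simp only [Finset.sum_const, nsmul_eq_mul]
  ring

/-- Every nonempty subcomplex has fewer than three times as many edges as vertices. -/
def Sparse (F : Finset (Finset (Fin N))) : Prop :=
  ∀ Y ⊆ F, IsCx Y → Y.Nonempty → (edges Y).card + 1 ≤ 3 * (verts Y).card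

lemma Sparse.mono (h : Sparse F) (hG : G ⊆ F) : Sparse G := fun Y hY => h Y (hY.trans hG)

lemma Sparse.exc_le (h : Sparse F) (hF : IsCx F) (hne : F.Nonempty) : exc F + 1 ≤ 3 * eul F := by
  have := h F subset_rfl hF hne
  have := three_mul_eul hF
  omega

/-- A set of edges meeting every vertex evenly. -/
def IsCyc (C : Finset (Finset (Fin N))) : Prop :=
  (∀ ε ∈ C, ε.card = 2) ∧ ∀ v, Even (C.filter (v ∈ ·)).card

lemma IsCyc.symm_diff {C C' : Finset (Finset (Fin N))} (h : IsCyc C) (h' : IsCyc C') :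
    IsCyc (symmDiff C C') := by
  refine ⟨fun ε hε => ?_, fun v => ?_⟩
  · rcases Finset.mem_symmDiff.1 hε with hε | hε
    exacts [h.1 _ hε.1, h'.1 _ hε.1]
  · have h1 := Finset.card_sdiff_add_card_inter (C.filter (v ∈ ·)) (C'.filter (v ∈ ·))
    have h2 := Finset.card_sdiff_add_card_inter (C'.filter (v ∈ ·)) (C.filter (v ∈ ·))
    rw [Finset.inter_comm] at h2
    have h3 : (symmDiff C C').filter (v ∈ ·) = (C.filter (v ∈ ·) \ C'.filter (v ∈ ·)) ∪
        (C'.filter (v ∈ ·) \ C.filter (v ∈ ·)) := by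
      ext ε
      simp only [Finset.mem_filter, Finset.mem_symmDiff, Finset.mem_union, Finset.mem_sdiff]
      tauto
    have h4 := h.2 v
    have h5 := h'.2 v
    rw [h3, Finset.card_union_of_disjoint (disjoint_sdiff_sdiff), Nat.even_iff]
    rw [Nat.even_iff] at h4 h5
    omega

lemma IsCyc.exists_other {C : Finset (Finset (Fin N))} (h : IsCyc C) {a b : Fin N}
    (hab : {a, b} ∈ C) : ∃ c, c ≠ b ∧ c ≠ a ∧ {a, c} ∈ C := by
  have h1 := h.2 a
  have hm : ({a, b} : Finset (Fin N)) ∈ C.filter (a ∈ ·) := by simp [hab]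
  have h2 : 1 < (C.filter (a ∈ ·)).card := by
    have := Finset.card_pos.2 ⟨_, hm⟩
    rw [Nat.even_iff] at h1
    omega
  obtain ⟨η, hη, hne⟩ := Finset.exists_mem_ne h2 {a, b}
  rw [Finset.mem_filter] at hη
  obtain ⟨x, y, hxy, rfl⟩ := Finset.card_eq_two.1 (h.1 _ hη.1)
  simp only [Finset.mem_insert, Finset.mem_singleton] at hη
  rcases hη.2 with rfl | rfl
  · exact ⟨y, fun e => hne (by rw [e]), hxy.symm, hη.1⟩
  · rw [Finset.pair_comm] at hη hne
    exact ⟨x, fun e => hne (by rw [e]), hxy, hη.1⟩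

lemma IsCyc.three_le {C : Finset (Finset (Fin N))} (h : IsCyc C) (hne : C.Nonempty) :
    3 ≤ C.card := by
  obtain ⟨ε, hε⟩ := hne
  obtain ⟨a, b, hab, rfl⟩ := Finset.card_eq_two.1 (h.1 _ hε)
  obtain ⟨c, hcb, hca, hc⟩ := h.exists_other hε
  obtain ⟨d, hda, hdb, hd⟩ := h.exists_other (Finset.pair_comm a b ▸ hε)
  have n1 : ({a, b} : Finset (Fin N)) ≠ {a, c} := fun e => by
    have : c ∈ ({a, b} : Finset (Fin N)) := by rw [e]; simp
    simp [hca, hcb] at this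
  have n2 : ({a, b} : Finset (Fin N)) ≠ {b, d} := fun e => by
    have : d ∈ ({a, b} : Finset (Fin N)) := by rw [e]; simp
    simp [hda, hdb] at this
  have n3 : ({a, c} : Finset (Fin N)) ≠ {b, d} := fun e => by
    have : b ∈ ({a, c} : Finset (Fin N)) := by rw [e]; simp
    simp [hab.symm, hcb.symm] at this
  have : ({{a, b}, {a, c}, {b, d}} : Finset (Finset (Fin N))) ⊆ C := by
    intro x hx
    simp only [Finset.mem_insert, Finset.mem_singleton] at hx
    rcases hx with rfl | rfl | rfl <;> assumption
  rw [← Finset.card_eq_three.2 ⟨_, _, _, n1, n2, n3, rfl⟩]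
  exact Finset.card_le_card this

/-- The edges of odd degree form a cycle. -/
lemma isCyc_odd (hF : IsCx F) : IsCyc ((edges F).filter fun ε => Odd (dg F ε)) := by
  refine ⟨fun ε hε => (mem_edges.1 (Finset.mem_filter.1 hε).1).2, fun v => ?_⟩
  rw [Finset.filter_comm, ← Finset.even_sum_iff_even_card_odd]
  have := Finset.sum_card_bipartiteAbove_eq_sum_card_bipartiteBelow
    (s := (edges F).filter (v ∈ ·)) (t := tris F) (fun ε τ => ε ⊆ τ)
  rw [show ∑ ε ∈ (edges F).filter (v ∈ ·), dg F ε = ∑ ε ∈ (edges F).filter (v ∈ ·),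
    (Finset.bipartiteAbove (fun ε τ => ε ⊆ τ) (tris F) ε).card from rfl, this]
  refine Finset.even_sum _ fun τ hτ => ?_
  obtain ⟨h, h3⟩ := mem_tris.1 hτ
  by_cases hv : v ∈ τ
  · have : Finset.bipartiteBelow (fun ε τ => ε ⊆ τ) ((edges F).filter (v ∈ ·)) τ =
        (τ.erase v).image fun w => {v, w} := by
      ext ε
      simp only [Finset.bipartiteBelow, Finset.mem_filter, mem_edges, Finset.mem_image,
        Finset.mem_erase]
      constructor
      · rintro ⟨⟨⟨h1, h2⟩, h4⟩, h5⟩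
        obtain ⟨x, y, hxy, rfl⟩ := Finset.card_eq_two.1 h2
        simp only [Finset.mem_insert, Finset.mem_singleton] at h4
        rcases h4 with rfl | rfl
        · exact ⟨y, ⟨hxy.symm, h5 (by simp)⟩, rfl⟩
        · exact ⟨x, ⟨hxy, h5 (by simp)⟩, Finset.pair_comm _ _⟩
      · rintro ⟨w, ⟨h1, h2⟩, rfl⟩
        have : ({v, w} : Finset (Fin N)) ⊆ τ := by
          intro l hl
          simp only [Finset.mem_insert, Finset.mem_singleton] at hl
          rcases hl with rfl | rfl <;> assumption
        exact ⟨⟨⟨hF.down τ h _ this (by simp), Finset.card_pair h1.symm⟩, by simp⟩, this⟩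
    rw [this, Finset.card_image_of_injOn, Finset.card_erase_of_mem hv, h3]
    · decide
    · intro x hx y hy e
      have : x ∈ ({v, y} : Finset (Fin N)) := by
        rw [← show ({v, x} : Finset (Fin N)) = {v, y} from e]; simp
      simp only [Finset.coe_erase, Set.mem_sdiff, Set.mem_singleton_iff] at hx
      simpa [hx.2] using this
  · have : Finset.bipartiteBelow (fun ε τ => ε ⊆ τ) ((edges F).filter (v ∈ ·)) τ = ∅ := by
      refine Finset.filter_eq_empty_iff.2 fun ε hε h => hv (h (Finset.mem_filter.1 hε).2)
    rw [this]
    simp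

/-- A graph with at least as many edges as vertices contains a cycle. -/
lemma exists_cyc {E : Finset (Finset (Fin N))} {V : Finset (Fin N)} (hE : ∀ ε ∈ E, ε.card = 2)
    (hEV : ∀ ε ∈ E, ε ⊆ V) (hV : V.Nonempty) (h : V.card ≤ E.card) :
    ∃ C ⊆ E, C.Nonempty ∧ IsCyc C := by
  obtain ⟨v0, hv0⟩ := hV
  have hlt : ((V.erase v0).powerset).card < E.powerset.card := by
    rw [Finset.card_powerset, Finset.card_powerset, Finset.card_erase_of_mem hv0]
    have := Finset.card_pos.2 ⟨v0, hv0⟩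
    exact Nat.pow_lt_pow_right (by norm_num) (by omega)
  obtain ⟨S, hS, S', hS', hne, heq⟩ := Finset.exists_ne_map_eq_of_card_lt_of_maps_to hlt
    (f := fun S => (V.erase v0).filter fun v => Odd (S.filter (v ∈ ·)).card)
    (fun S _ => Finset.mem_coe.2 (Finset.mem_powerset.2 (Finset.filter_subset _ _)))
  rw [Finset.mem_powerset] at hS hS'
  have hsub : symmDiff S S' ⊆ E := fun ε hε => by
    rcases Finset.mem_symmDiff.1 hε with hε | hε
    exacts [hS hε.1, hS' hε.1]
  have hev : ∀ v ≠ v0, Even ((symmDiff S S').filter (v ∈ ·)).card := by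
    intro v hv
    by_cases hvV : v ∈ V
    · have h0 := Finset.ext_iff.1 heq v
      simp only [Finset.mem_filter, Finset.mem_erase, hv, hvV, ne_eq, not_false_eq_true, true_and]
        at h0
      have h1 := Finset.card_sdiff_add_card_inter (S.filter (v ∈ ·)) (S'.filter (v ∈ ·))
      have h2 := Finset.card_sdiff_add_card_inter (S'.filter (v ∈ ·)) (S.filter (v ∈ ·))
      rw [Finset.inter_comm] at h2
      have h3 : (symmDiff S S').filter (v ∈ ·) = (S.filter (v ∈ ·) \ S'.filter (v ∈ ·)) ∪
          (S'.filter (v ∈ ·) \ S.filter (v ∈ ·)) := by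
        ext ε
        simp only [Finset.mem_filter, Finset.mem_symmDiff, Finset.mem_union, Finset.mem_sdiff]
        tauto
      rw [h3, Finset.card_union_of_disjoint (disjoint_sdiff_sdiff), Nat.even_iff]
      rw [Nat.odd_iff, Nat.odd_iff] at h0
      omega
    · have : (symmDiff S S').filter (v ∈ ·) = ∅ :=
        Finset.filter_eq_empty_iff.2 fun ε hε hvε => hvV (hEV ε (hsub hε) hvε)
      rw [this]
      simp
  refine ⟨symmDiff S S', hsub, ?_, fun ε hε => hE _ (hsub hε), fun v => ?_⟩
  · rw [Finset.nonempty_iff_ne_empty]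
    intro e
    exact hne (symmDiff_eq_bot.1 e)
  · by_cases hv : v = v0
    swap
    · exact hev v hv
    subst hv
    have := Finset.sum_card_bipartiteAbove_eq_sum_card_bipartiteBelow
      (s := (Finset.univ : Finset (Fin N))) (t := symmDiff S S') (fun v ε => v ∈ ε)
    have h2 : ∑ ε ∈ symmDiff S S', (Finset.bipartiteBelow (fun (v : Fin N) ε => v ∈ ε)
        Finset.univ ε).card = (symmDiff S S').card * 2 := by
      refine Finset.sum_const_nat fun ε hε => ?_
      rw [show Finset.bipartiteBelow (fun (v : Fin N) ε => v ∈ ε) Finset.univ ε = ε by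
        ext; simp [Finset.bipartiteBelow]]
      exact hE _ (hsub hε)
    rw [h2, ← Finset.add_sum_erase _ _ (Finset.mem_univ v)] at this
    have h3 : Even (∑ x ∈ Finset.univ.erase v, (Finset.bipartiteAbove (fun (v : Fin N) ε => v ∈ ε)
        (symmDiff S S') x).card) :=
      Finset.even_sum _ fun x hx => hev x (Finset.ne_of_mem_erase hx)
    have h4 : Even ((Finset.bipartiteAbove (fun (v : Fin N) ε => v ∈ ε)
        (symmDiff S S') v).card) := by
      rw [Nat.even_iff] at h3 ⊢
      omega
    exact h4

end

noncomputable section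
open scoped ContinuousMap

variable {N : ℕ} {F G K D : Finset (Finset (Fin N))}

lemma IsCx.union (hF : IsCx F) (hG : IsCx G) : IsCx (F ∪ G) := by
  refine ⟨fun σ h => ?_, fun σ h => ?_, fun σ h τ ht hn => ?_⟩ <;>
    rcases Finset.mem_union.1 h with h | h
  · exact hF.nonempty σ h
  · exact hG.nonempty σ h
  · exact hF.card_le σ h
  · exact hG.card_le σ h
  · exact Finset.mem_union_left _ (hF.down σ h τ ht hn)
  · exact Finset.mem_union_right _ (hG.down σ h τ ht hn)

lemma IsCx.inter (hF : IsCx F) (hG : IsCx G) : IsCx (F ∩ G) := by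
  refine ⟨fun σ h => hF.nonempty σ (Finset.mem_inter.1 h).1,
    fun σ h => hF.card_le σ (Finset.mem_inter.1 h).1, fun σ h τ ht hn => ?_⟩
  exact Finset.mem_inter.2 ⟨hF.down σ (Finset.mem_inter.1 h).1 τ ht hn,
    hG.down σ (Finset.mem_inter.1 h).2 τ ht hn⟩

lemma IsCx.vertex_mem (hF : IsCx F) {τ : Finset (Fin N)} (h : τ ∈ F) {v : Fin N} (hv : v ∈ τ) :
    {v} ∈ F := hF.down τ h _ (Finset.singleton_subset_iff.2 hv) (Finset.singleton_nonempty v)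

lemma IsCx.pair_mem (hF : IsCx F) {τ : Finset (Fin N)} (h : τ ∈ F) {v w : Fin N} (hv : v ∈ τ)
    (hw : w ∈ τ) : {v, w} ∈ F := by
  refine hF.down τ h _ (fun l hl => ?_) (by simp)
  simp only [Finset.mem_insert, Finset.mem_singleton] at hl
  rcases hl with rfl | rfl <;> assumption

lemma IsCx.erase_tri (hF : IsCx F) {ρ : Finset (Fin N)} (h : ρ.card = 3) : IsCx (F.erase ρ) :=
  erase_isCx hF (hF.eq_of_card_three h)

lemma InclHE.conn (hF : IsCx F) (hG : IsCx G) (h : InclHE F G) (hc : Conn G) : Conn F := by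
  obtain ⟨e, -⟩ := h
  have := hc.pathConnectedSpace hG
  obtain ⟨y0⟩ : Nonempty (real G) := PathConnectedSpace.nonempty
  have hj : ∀ x, Joined x (e.invFun (e.toFun x)) := by
    intro x
    obtain ⟨H⟩ := e.left_inv
    exact ⟨(H.evalAt x).symm⟩
  have : PathConnectedSpace (real F) := by
    refine ⟨⟨e.invFun y0⟩, fun x y => (hj x).trans (Joined.trans ?_ (hj y).symm)⟩
    exact ⟨(PathConnectedSpace.somePath (e.toFun x) (e.toFun y)).map e.invFun.continuous⟩
  exact conn_of_isConnected hF (isConnected_iff_connectedSpace.2 inferInstance)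

section Collapse

variable {ε : Finset (Fin N)} {c : Fin N}

lemma collapse_isCx (hF : IsCx F) (hc : c ∉ ε)
    (hfree : ∀ σ ∈ F, ε ⊆ σ → σ = ε ∨ σ = insert c ε) :
    IsCx ((F.erase (insert c ε)).erase ε) := by
  have h1 : IsCx (F.erase (insert c ε)) := by
    refine erase_isCx hF fun ρ hρ h => ?_
    rcases hfree ρ hρ ((Finset.subset_insert _ _).trans h) with rfl | h'
    · exact absurd (h (Finset.mem_insert_self _ _)) hc
    · exact h'
  refine erase_isCx h1 fun ρ hρ h => ?_
  rw [Finset.mem_erase] at hρ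
  exact (hfree ρ hρ.2 h).resolve_right hρ.1

lemma collapse_eul (hc : c ∉ ε) (hε : ε ∈ F) (hτ : insert c ε ∈ F) :
    eul ((F.erase (insert c ε)).erase ε) = eul F := by
  have hne : ε ≠ insert c ε := fun e => hc (by rw [e]; exact Finset.mem_insert_self _ _)
  rw [eul_erase hτ, eul_erase (Finset.mem_erase.2 ⟨hne, hε⟩), Finset.card_insert_of_notMem hc]
  ring

lemma collapse_subset : (F.erase (insert c ε)).erase ε ⊆ F :=
  (Finset.erase_subset _ _).trans (Finset.erase_subset _ _)

lemma collapse_ssubset (hτ : insert c ε ∈ F) : (F.erase (insert c ε)).erase ε ⊂ F :=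
  (Finset.erase_subset _ _).trans_ssubset (Finset.erase_ssubset hτ)

end Collapse

/-- An edge in exactly one triangle is a free face. -/
lemma exists_free (hF : IsCx F) {ε : Finset (Fin N)} (h2 : ε.card = 2) (hd : dg F ε = 1) :
    ∃ c, c ∉ ε ∧ insert c ε ∈ F ∧ ∀ σ ∈ F, ε ⊆ σ → σ = ε ∨ σ = insert c ε := by
  obtain ⟨τ, hτ⟩ := Finset.card_eq_one.1 hd
  have hm : τ ∈ (tris F).filter fun τ => ε ⊆ τ := by rw [hτ]; simp
  rw [Finset.mem_filter, mem_tris] at hm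
  obtain ⟨c, hc⟩ : ∃ c, τ \ ε = {c} := by
    rw [← Finset.card_eq_one, Finset.card_sdiff_of_subset hm.2]
    omega
  have hcm : c ∈ τ \ ε := by rw [hc]; simp
  rw [Finset.mem_sdiff] at hcm
  have he : insert c ε = τ := by
    rw [Finset.insert_eq, ← hc, Finset.sdiff_union_of_subset hm.2]
  refine ⟨c, hcm.2, he ▸ hm.1.1, fun σ hσ hs => ?_⟩
  have h3 := hF.card_le σ hσ
  have h4 := Finset.card_le_card hs
  by_cases h5 : σ.card = 3
  · right
    have : σ ∈ (tris F).filter fun τ => ε ⊆ τ := by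
      rw [Finset.mem_filter, mem_tris]; exact ⟨⟨hσ, h5⟩, hs⟩
    rw [hτ, Finset.mem_singleton] at this
    rw [this, he]
  · left
    exact (Finset.eq_of_subset_of_card_le hs (by omega)).symm

lemma eq_of_dg_zero (hF : IsCx F) {ε : Finset (Fin N)} (h2 : ε.card = 2) (hd : dg F ε = 0) :
    ∀ ρ ∈ F, ε ⊆ ρ → ρ = ε := by
  intro ρ hρ h
  have h3 := hF.card_le ρ hρ
  have h4 := Finset.card_le_card h
  by_cases h5 : ρ.card = 3
  · exact absurd (Finset.mem_filter.2 ⟨mem_tris.2 ⟨hρ, h5⟩, h⟩)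
      (by rw [Finset.card_eq_zero.1 hd]; simp)
  · exact (Finset.eq_of_subset_of_card_le h (by omega)).symm

lemma Reach.refl (a : Fin N) : Reach F a a := Relation.ReflTransGen.refl

lemma Reach.trans {a b c : Fin N} (h : Reach F a b) (h' : Reach F b c) : Reach F a c :=
  Relation.ReflTransGen.trans h h'

lemma Reach.of_edge {a b : Fin N} (h : {a, b} ∈ F) : Reach F a b := Relation.ReflTransGen.single h

lemma IsCx.reach (hF : IsCx F) {τ : Finset (Fin N)} (h : τ ∈ F) {v w : Fin N} (hv : v ∈ τ)
    (hw : w ∈ τ) : Reach F v w := .of_edge (hF.pair_mem h hv hw)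

lemma Conn.of_center {a : Fin N} (ha : {a} ∈ F) (h : ∀ b, {b} ∈ F → Reach F a b) : Conn F :=
  ⟨⟨a, ha⟩, fun b c hb hc => (h b hb).symm.trans (h c hc)⟩

lemma Conn.union {v : Fin N} (hF : Conn F) (hG : Conn G) (h1 : {v} ∈ F) (h2 : {v} ∈ G) :
    Conn (F ∪ G) := by
  refine .of_center (Finset.mem_union_left _ h1) fun b hb => ?_
  rcases Finset.mem_union.1 hb with hb | hb
  · exact (hF.2 v b h1 hb).mono Finset.subset_union_left
  · exact (hG.2 v b h2 hb).mono Finset.subset_union_right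

/-- Leaving a set along a path. -/
lemma Reach.exists_step {P : Fin N → Prop} {a b : Fin N} (h : Reach F a b) (ha : P a)
    (hb : ¬ P b) : ∃ x y, {x, y} ∈ F ∧ P x ∧ ¬ P y := by
  induction h with
  | refl => exact absurd ha hb
  | @tail y z _ hyz ih =>
    by_cases hy : P y
    · exact ⟨y, z, hyz, hy, hb⟩
    · exact ih hy

lemma Conn.erase_of_card_ne (hF : Conn F) {σ : Finset (Fin N)} (h1 : σ.card ≠ 1)
    (h2 : σ.card ≠ 2) : Conn (F.erase σ) := by
  obtain ⟨⟨a, ha⟩, h⟩ := hF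
  have hm : ∀ x y : Fin N, {x, y} ∈ F → {x, y} ∈ F.erase σ := fun x y hxy =>
    Finset.mem_erase.2 ⟨fun e => by
      by_cases hxy : x = y
      · subst hxy; rw [← e] at h1; simp at h1
      · rw [← e, Finset.card_pair hxy] at h2; simp at h2, hxy⟩
  refine ⟨⟨a, by simpa using hm a a (by simpa using ha)⟩, fun b c hb hc => ?_⟩
  exact Relation.ReflTransGen.mono hm _ _
    (h b c (Finset.mem_of_mem_erase hb) (Finset.mem_of_mem_erase hc))

open Classical in
/-- The connected component of the vertex `a`. -/
def comp (F : Finset (Finset (Fin N))) (a : Fin N) : Finset (Finset (Fin N)) :=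
  F.filter fun τ => ∃ v ∈ τ, Reach F a v

lemma comp_subset (a : Fin N) : comp F a ⊆ F := by
  classical exact Finset.filter_subset _ _

lemma mem_comp {a : Fin N} {τ : Finset (Fin N)} :
    τ ∈ comp F a ↔ τ ∈ F ∧ ∃ v ∈ τ, Reach F a v := by
  classical exact Finset.mem_filter

lemma mem_comp_singleton {a v : Fin N} : {v} ∈ comp F a ↔ {v} ∈ F ∧ Reach F a v := by
  simp [mem_comp]

lemma reach_of_mem_comp (hF : IsCx F) {a w : Fin N} {τ : Finset (Fin N)} (h : τ ∈ comp F a)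
    (hw : w ∈ τ) : Reach F a w := by
  obtain ⟨h1, v, hv, hr⟩ := mem_comp.1 h
  exact hr.trans (hF.reach h1 hv hw)

lemma comp_isCx (hF : IsCx F) (a : Fin N) : IsCx (comp F a) := by
  refine ⟨fun σ h => hF.nonempty σ (comp_subset a h), fun σ h => hF.card_le σ (comp_subset a h),
    fun σ h τ ht hn => mem_comp.2 ⟨hF.down σ (comp_subset a h) τ ht hn, ?_⟩⟩
  obtain ⟨w, hw⟩ := hn
  exact ⟨w, hw, reach_of_mem_comp hF h (ht hw)⟩

lemma Reach.in_comp {a b : Fin N} (h : Reach F a b) : Reach (comp F a) a b := by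
  induction h with
  | refl => exact .refl a
  | @tail y z hy hyz ih => exact ih.trans (.of_edge (mem_comp.2 ⟨hyz, y, by simp, hy⟩))

lemma comp_conn {a : Fin N} (ha : {a} ∈ F) : Conn (comp F a) :=
  .of_center (mem_comp_singleton.2 ⟨ha, .refl a⟩)
    fun _ hb => (mem_comp_singleton.1 hb).2.in_comp

lemma dg_comp {a : Fin N} {ε : Finset (Fin N)} (h : ε ∈ comp F a) : dg (comp F a) ε = dg F ε := by
  refine le_antisymm (dg_mono (comp_subset a) ε) (Finset.card_le_card fun τ hτ => ?_)
  rw [Finset.mem_filter, mem_tris] at hτ ⊢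
  obtain ⟨-, v, hv, hr⟩ := mem_comp.1 h
  exact ⟨⟨mem_comp.2 ⟨hτ.1.1, v, hτ.2 hv, hr⟩, hτ.1.2⟩, hτ.2⟩

/-- The complex of faces of the members of `T`. -/
def cl (F T : Finset (Finset (Fin N))) : Finset (Finset (Fin N)) :=
  F.filter fun σ => ∃ τ ∈ T, σ ⊆ τ

lemma mem_cl {T : Finset (Finset (Fin N))} {σ : Finset (Fin N)} :
    σ ∈ cl F T ↔ σ ∈ F ∧ ∃ τ ∈ T, σ ⊆ τ := Finset.mem_filter

lemma cl_subset (T : Finset (Finset (Fin N))) : cl F T ⊆ F := Finset.filter_subset _ _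

lemma cl_isCx (hF : IsCx F) (T : Finset (Finset (Fin N))) : IsCx (cl F T) := by
  refine ⟨fun σ h => hF.nonempty σ (cl_subset T h), fun σ h => hF.card_le σ (cl_subset T h),
    fun σ h τ ht hn => ?_⟩
  obtain ⟨h1, ρ, hρ, h2⟩ := mem_cl.1 h
  exact mem_cl.2 ⟨hF.down σ h1 τ ht hn, ρ, hρ, ht.trans h2⟩

lemma tris_cl {T : Finset (Finset (Fin N))} (hT : T ⊆ tris F) : tris (cl F T) = T := by
  ext τ
  rw [mem_tris, mem_cl]
  constructor
  · rintro ⟨⟨_, ρ, hρ, h2⟩, h3⟩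
    rwa [Finset.eq_of_subset_of_card_le h2 (by rw [h3, (mem_tris.1 (hT hρ)).2])]
  · intro h
    exact ⟨⟨(mem_tris.1 (hT h)).1, τ, h, subset_rfl⟩, (mem_tris.1 (hT h)).2⟩

lemma dg_cl {T : Finset (Finset (Fin N))} (hT : T ⊆ tris F) (ε : Finset (Fin N)) :
    dg (cl F T) ε = (T.filter (ε ⊆ ·)).card := by rw [dg, tris_cl hT]

lemma dg_cl_pos {T : Finset (Finset (Fin N))} (hT : T ⊆ tris F) {ε : Finset (Fin N)}
    (h : ε ∈ cl F T) : 1 ≤ dg (cl F T) ε := by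
  rw [dg_cl hT]
  obtain ⟨_, τ, hτ, h2⟩ := mem_cl.1 h
  exact Finset.card_pos.2 ⟨τ, Finset.mem_filter.2 ⟨hτ, h2⟩⟩

/-- A connected complex with a triangle and without free or isolated edges. -/
structure Good (F : Finset (Finset (Fin N))) : Prop where
  isCx : IsCx F
  conn : Conn F
  tri : (tris F).Nonempty
  two_le : ∀ ε ∈ F, ε.card = 2 → 2 ≤ dg F ε

/-- A set of triangles without free edges contains a good complex. -/
lemma good_comp (hF : IsCx F) {T : Finset (Finset (Fin N))} (hT : T ⊆ tris F)
    (h : ∀ ε ∈ F, ε.card = 2 → (T.filter (ε ⊆ ·)).card ≠ 1) {a : Fin N} (ha : {a} ∈ cl F T) :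
    Good (comp (cl F T) a) := by
  have hC := cl_isCx hF T
  refine ⟨comp_isCx hC a, comp_conn ha, ?_, fun ε hε h2 => ?_⟩
  · obtain ⟨_, τ, hτ, h2⟩ := mem_cl.1 ha
    rw [Finset.singleton_subset_iff] at h2
    have := mem_tris.1 (hT hτ)
    exact ⟨τ, mem_tris.2 ⟨mem_comp.2 ⟨mem_cl.2 ⟨this.1, τ, hτ, subset_rfl⟩, a, h2, .refl a⟩,
      this.2⟩⟩
  · rw [dg_comp hε]
    have h3 := dg_cl_pos hT (comp_subset a hε)
    have h4 := h ε (cl_subset T (comp_subset a hε)) h2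
    rw [dg_cl hT] at h3 ⊢
    omega

lemma Conn.eq_singleton (hF : IsCx F) (hc : Conn F) (h : ∀ ε ∈ F, ε.card ≠ 2) :
    ∃ a, F = {{a}} := by
  obtain ⟨⟨a, ha⟩, hr⟩ := hc
  refine ⟨a, ?_⟩
  have key : ∀ b, {b} ∈ F → b = a := by
    intro b hb
    by_contra hne
    obtain ⟨x, y, hxy, hx, hy⟩ := (hr a b ha hb).exists_step (P := (· = a)) rfl hne
    exact h _ hxy (Finset.card_pair (fun e => hy (e ▸ hx)))
  ext σ
  rw [Finset.mem_singleton]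
  constructor
  · intro hσ
    refine Finset.eq_singleton_iff_nonempty_unique_mem.2 ⟨hF.nonempty σ hσ, fun b hb => ?_⟩
    exact key b (hF.vertex_mem hσ hb)
  · rintro rfl; exact ha

lemma Good.of_tri_subset (hF : Good F) (hG : Good G) {v : Fin N} (h1 : {v} ∈ F) (h2 : {v} ∈ G) :
    Good (F ∪ G) := by
  refine ⟨hF.isCx.union hG.isCx, hF.conn.union hG.conn h1 h2, ?_, fun ε hε h => ?_⟩
  · obtain ⟨τ, hτ⟩ := hF.tri
    exact ⟨τ, mem_tris.2 ⟨Finset.mem_union_left _ (mem_tris.1 hτ).1, (mem_tris.1 hτ).2⟩⟩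
  · rcases Finset.mem_union.1 hε with hε | hε
    · exact (hF.two_le ε hε h).trans (dg_mono Finset.subset_union_left ε)
    · exact (hG.two_le ε hε h).trans (dg_mono Finset.subset_union_right ε)

/-- A vertex of degree one exists in a connected graph with more vertices than edges. -/
lemma exists_leaf (hF : IsCx F) (hc : Conn F) (ht : tris F = ∅) (he : 1 ≤ eul F)
    (hne : (edges F).Nonempty) : ∃ v c, c ≠ v ∧ {c, v} ∈ F ∧
      ∀ σ ∈ F, v ∈ σ → σ = {v} ∨ σ = {c, v} := by
  have hV : ((Finset.univ : Finset (Fin N)).filter fun v => {v} ∈ F).card = (verts F).card := by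
    refine Finset.card_bij (fun v _ => {v}) (fun v hv => mem_verts.2
      ⟨(Finset.mem_filter.1 hv).2, Finset.card_singleton v⟩)
      (fun v _ w _ e => Finset.singleton_injective e) fun σ hσ => ?_
    obtain ⟨v, rfl⟩ := Finset.card_eq_one.1 (mem_verts.1 hσ).2
    exact ⟨v, by simp [(mem_verts.1 hσ).1], rfl⟩
  set V := (Finset.univ : Finset (Fin N)).filter fun v => {v} ∈ F
  have hsum := Finset.sum_card_bipartiteAbove_eq_sum_card_bipartiteBelow
    (s := V) (t := edges F) (fun v ε => v ∈ ε)
  have h2 : ∑ ε ∈ edges F, (Finset.bipartiteBelow (fun (v : Fin N) ε => v ∈ ε) V ε).card =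
      (edges F).card * 2 := by
    refine Finset.sum_const_nat fun ε hε => ?_
    rw [show Finset.bipartiteBelow (fun (v : Fin N) ε => v ∈ ε) V ε = ε by
      ext v; simp only [Finset.bipartiteBelow, Finset.mem_filter, V, Finset.mem_univ, true_and]
      exact ⟨fun h => h.2, fun h => ⟨hF.vertex_mem (mem_edges.1 hε).1 h, h⟩⟩]
    exact (mem_edges.1 hε).2
  rw [h2] at hsum
  rw [eul_eq hF, ht, ← hV] at he
  simp only [Finset.card_empty, Nat.cast_zero, add_zero] at he
  obtain ⟨v, hv, hlt⟩ : ∃ v ∈ V, (Finset.bipartiteAbove (fun (v : Fin N) ε => v ∈ ε)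
      (edges F) v).card < 2 := by
    by_contra! hcon
    have := Finset.sum_le_sum hcon
    rw [hsum, Finset.sum_const, smul_eq_mul] at this
    omega
  have hvF : {v} ∈ F := (Finset.mem_filter.1 hv).2
  obtain ⟨ε, hε⟩ := hne
  obtain ⟨w, hw, hwv⟩ : ∃ w ∈ ε, w ≠ v :=
    Finset.exists_mem_ne (by rw [(mem_edges.1 hε).2]; norm_num) v
  obtain ⟨x, c, hxc, rfl, hcx⟩ := (hc.2 v w hvF
    (hF.vertex_mem (mem_edges.1 hε).1 hw)).exists_step (P := (· = v)) rfl hwv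
  rw [Finset.pair_comm] at hxc
  refine ⟨x, c, hcx, hxc, fun σ hσ hx => ?_⟩
  have hcard : σ.card = 1 ∨ σ.card = 2 := by
    have h1 := hF.card_le σ hσ
    have h2 := (hF.nonempty σ hσ).card_pos
    have h3 : σ.card ≠ 3 := fun h => by
      have := mem_tris.2 ⟨hσ, h⟩
      rw [ht] at this
      simp at this
    omega
  rcases hcard with h | h
  · left
    obtain ⟨y, rfl⟩ := Finset.card_eq_one.1 h
    rw [Finset.mem_singleton.1 hx]
  · right
    refine Finset.card_le_one.1 (by omega : (Finset.bipartiteAbove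
      (fun (v : Fin N) ε => v ∈ ε) (edges F) x).card ≤ 1) σ ?_ _ ?_
    · exact Finset.mem_filter.2 ⟨mem_edges.2 ⟨hσ, h⟩, hx⟩
    · exact Finset.mem_filter.2 ⟨mem_edges.2 ⟨hxc, Finset.card_pair hcx⟩, by simp⟩

/-- Connected complexes of positive Euler characteristic without good subcomplexes collapse. -/
lemma contractible_of_no_good (n : ℕ) : ∀ F : Finset (Finset (Fin N)), F.card ≤ n → IsCx F →
    Conn F → 1 ≤ eul F → (∀ R ⊆ F, ¬ Good R) → ContractibleSpace (real F) := by
  induction n with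
  | zero =>
    intro F hn _ hc
    obtain ⟨a, ha⟩ := hc.1
    rw [Finset.card_eq_zero.1 (Nat.le_zero.1 hn)] at ha
    simp at ha
  | succ n ih =>
    intro F hn hF hc he hg
    have step : ∀ (ε : Finset (Fin N)) (c : Fin N), ε.Nonempty → c ∉ ε → insert c ε ∈ F →
        (∀ σ ∈ F, ε ⊆ σ → σ = ε ∨ σ = insert c ε) → ContractibleSpace (real F) := by
      intro ε c hne hc' hτ hfree
      have h1 := inclHE_collapse hF hne hc' hτ hfree
      have h2 := collapse_isCx hF hc' hfree
      refine h1.contractible (ih _ ?_ h2 (h1.conn h2 hF hc) ?_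
        fun R hR => hg R (hR.trans collapse_subset))
      · have := Finset.card_lt_card (collapse_ssubset hτ)
        omega
      · rwa [collapse_eul hc' (hF.down _ hτ _ (Finset.subset_insert _ _) hne) hτ]
    by_cases h1 : ∃ ε ∈ F, ε.card = 2 ∧ dg F ε = 1
    · obtain ⟨ε, -, h2, hd⟩ := h1
      obtain ⟨c, hc', hτ, hfree⟩ := exists_free hF h2 hd
      exact step ε c (Finset.card_pos.1 (by omega)) hc' hτ hfree
    push Not at h1
    have ht : tris F = ∅ := by
      rw [← Finset.not_nonempty_iff_eq_empty]
      rintro ⟨τ, hτ⟩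
      obtain ⟨v, hv⟩ := hF.nonempty τ (mem_tris.1 hτ).1
      refine hg _ ((comp_subset v).trans (cl_subset _)) (good_comp hF subset_rfl h1 (a := v) ?_)
      exact mem_cl.2 ⟨hF.vertex_mem (mem_tris.1 hτ).1 hv, τ, hτ, by simpa using hv⟩
    by_cases hE : (edges F).Nonempty
    · obtain ⟨v, c, hcv, hm, hfree⟩ := exists_leaf hF hc ht he hE
      exact step {v} c (by simp) (by simpa using hcv) hm
        fun σ hσ h => hfree σ hσ (Finset.singleton_subset_iff.1 h)
    · obtain ⟨a, rfl⟩ := hc.eq_singleton hF fun ε hε h => hE ⟨ε, mem_edges.2 ⟨hε, h⟩⟩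
      exact contractible_singleton a

end

noncomputable section
open scoped ContinuousMap

variable {N : ℕ} {F G K D Z R Q : Finset (Finset (Fin N))}

lemma Reach.erase_pair {a b v : Fin N} (h : Reach F a v) :
    Reach (F.erase {a, b}) a v ∨ Reach (F.erase {a, b}) b v := by
  induction h with
  | refl => exact .inl (.refl a)
  | @tail y z _ hyz ih =>
    by_cases he : ({y, z} : Finset (Fin N)) = {a, b}
    · have : z ∈ ({a, b} : Finset (Fin N)) := by rw [← he]; simp
      simp only [Finset.mem_insert, Finset.mem_singleton] at this
      rcases this with rfl | rfl
      exacts [.inl (.refl _), .inr (.refl _)]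
    · have := Reach.of_edge (Finset.mem_erase.2 ⟨he, hyz⟩)
      exact ih.imp (·.trans this) (·.trans this)

lemma Conn.erase_pair {a b : Fin N} (hab : a ≠ b) (hF : IsCx F) (hc : Conn F) (h : {a, b} ∈ F)
    (hr : Reach (F.erase {a, b}) a b) : Conn (F.erase {a, b}) := by
  have hne : ({a} : Finset (Fin N)) ≠ {a, b} := fun e => by
    have := congrArg Finset.card e
    rw [Finset.card_pair hab] at this
    simp at this
  refine .of_center (Finset.mem_erase.2 ⟨hne, hF.left h⟩) fun c hc' => ?_
  rcases (hc.2 a c (hF.left h) (Finset.mem_of_mem_erase hc')).erase_pair (b := b) with h1 | h1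
  · exact h1
  · exact hr.trans h1

/-- Removing a separating edge leaves two connected pieces. -/
lemma exists_split_edge {a b : Fin N} (hab : a ≠ b) (hF : IsCx F) (hc : Conn F) (h : {a, b} ∈ F)
    (hmax : ∀ ρ ∈ F, {a, b} ⊆ ρ → ρ = {a, b}) (hnc : ¬ Conn (F.erase {a, b})) :
    ∃ A B, IsCx A ∧ IsCx B ∧ Conn A ∧ Conn B ∧ A ∪ B = F.erase {a, b} ∧ A ∩ B = ∅ := by
  have hE := erase_isCx hF hmax
  have hcard : ({a, b} : Finset (Fin N)).card = 2 := Finset.card_pair hab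
  have hv : ∀ c, {c} ∈ F → {c} ∈ F.erase {a, b} := fun c hc => Finset.mem_erase.2 ⟨fun e => by
    rw [← e] at hcard; simp at hcard, hc⟩
  refine ⟨comp (F.erase {a, b}) a, comp (F.erase {a, b}) b, comp_isCx hE a, comp_isCx hE b,
    comp_conn (hv a (hF.left h)), comp_conn (hv b (hF.right h)), ?_, ?_⟩
  · refine (Finset.union_subset (comp_subset a) (comp_subset b)).antisymm fun σ hσ => ?_
    obtain ⟨v, hvσ⟩ := hE.nonempty σ hσ
    rcases (hc.2 a v (hF.left h) (hF.vertex_mem (Finset.mem_of_mem_erase hσ) hvσ)).erase_pair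
      (b := b) with h1 | h1
    · exact Finset.mem_union_left _ (mem_comp.2 ⟨hσ, v, hvσ, h1⟩)
    · exact Finset.mem_union_right _ (mem_comp.2 ⟨hσ, v, hvσ, h1⟩)
  · rw [← Finset.not_nonempty_iff_eq_empty]
    rintro ⟨σ, hσ⟩
    rw [Finset.mem_inter] at hσ
    obtain ⟨v, hvσ⟩ := hE.nonempty σ (comp_subset a hσ.1)
    exact hnc (hc.erase_pair hab hF h ((reach_of_mem_comp hE hσ.1 hvσ).trans
      (reach_of_mem_comp hE hσ.2 hvσ).symm))

lemma tris_union (A B : Finset (Finset (Fin N))) : tris (A ∪ B) = tris A ∪ tris B :=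
  Finset.filter_union _ _ _

lemma dg_union (h : Disjoint (tris F) (tris G)) (ε : Finset (Fin N)) :
    dg (F ∪ G) ε = dg F ε + dg G ε := by
  rw [dg, tris_union, Finset.filter_union, Finset.card_union_of_disjoint
    (Finset.disjoint_filter_filter h)]
  rfl

lemma sum_le_exc (h2 : ∀ ε ∈ F, ε.card = 2 → 2 ≤ dg F ε) {S : Finset (Finset (Fin N))}
    (hS : S ⊆ edges F) : ∑ ε ∈ S, ((dg F ε : ℤ) - 2) ≤ exc F := by
  refine Finset.sum_le_sum_of_subset_of_nonneg hS fun ε hε _ => ?_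
  have := h2 ε (mem_edges.1 hε).1 (mem_edges.1 hε).2
  omega

lemma Good.nonempty (h : Good F) : F.Nonempty :=
  let ⟨⟨a, ha⟩, _⟩ := h.conn
  ⟨{a}, ha⟩

lemma Good.exc_nonneg (h : Good F) : 0 ≤ exc F := by
  simpa using sum_le_exc h.two_le (Finset.empty_subset _)

lemma Good.one_le_eul (h : Good F) (hs : Sparse F) : 1 ≤ eul F := by
  have := hs.exc_le h.isCx h.nonempty
  have := h.exc_nonneg
  omega

lemma Good.even (h : Good F) (hs : Sparse F) (he : eul F ≤ 1) {ε : Finset (Fin N)} (hε : ε ∈ F)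
    (h2 : ε.card = 2) : Even (dg F ε) := by
  by_contra hodd
  rw [Nat.not_even_iff_odd] at hodd
  have h3 := (isCyc_odd h.isCx).three_le ⟨ε, Finset.mem_filter.2 ⟨mem_edges.2 ⟨hε, h2⟩, hodd⟩⟩
  have h4 := sum_le_exc h.two_le (Finset.filter_subset (fun ε => Odd (dg F ε)) (edges F))
  have h5 := hs.exc_le h.isCx h.nonempty
  have h6 : (((edges F).filter fun ε => Odd (dg F ε)).card : ℤ) ≤
      ∑ ε ∈ (edges F).filter (fun ε => Odd (dg F ε)), ((dg F ε : ℤ) - 2) := by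
    rw [Finset.card_eq_sum_ones]
    push_cast
    refine Finset.sum_le_sum fun η hη => ?_
    rw [Finset.mem_filter, mem_edges] at hη
    have := h.two_le η hη.1.1 hη.1.2
    have h7 := hη.2
    rw [Nat.odd_iff] at h7
    omega
  omega

/-- A connected complex without free edges splits along a good subcomplex avoiding a given
triangle. -/
lemma exists_good_split (hZ : IsCx Z) (hc : Conn Z)
    (h2 : ∀ ε ∈ Z, ε.card = 2 → 2 ≤ dg Z ε) {σ : Finset (Fin N)} (hσ : σ ∈ tris Z)
    (hex : ∃ R ⊆ Z, Good R ∧ σ ∉ R) :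
    ∃ R Q, Good R ∧ σ ∉ R ∧ IsCx Q ∧ Conn Q ∧ σ ∈ Q ∧ R ∪ Q = Z ∧ Disjoint (tris R) (tris Q) ∧
      (∀ ε ∈ Q, ε.card = 2 → 1 ≤ dg Q ε) ∧ ∃ v, {v} ∈ R ∧ {v} ∈ Q := by
  classical
  obtain ⟨R0, hR0, hg0, hσ0⟩ := hex
  obtain ⟨R, hR, hmax⟩ := Finset.exists_max_image
    (Z.powerset.filter fun R => Good R ∧ σ ∉ R) Finset.card
    ⟨R0, Finset.mem_filter.2 ⟨Finset.mem_powerset.2 hR0, hg0, hσ0⟩⟩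
  rw [Finset.mem_filter, Finset.mem_powerset] at hR
  obtain ⟨hRZ, hg, hσR⟩ := hR
  set T := tris Z \ R with hT
  have hTZ : T ⊆ tris Z := Finset.sdiff_subset
  set Q0 := cl Z T with hQ0
  have hQ0c : IsCx Q0 := cl_isCx hZ T
  have hmemQ0 : ∀ ρ ∈ Z, ρ.card = 2 → ρ ∉ R → ∀ τ ∈ tris Z, ρ ⊆ τ → τ ∈ Q0 := by
    intro ρ hρ h2' hρR τ hτ hs
    have : τ ∉ R := fun h => hρR (hg.isCx.down τ h ρ hs (hZ.nonempty ρ hρ))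
    exact mem_cl.2 ⟨(mem_tris.1 hτ).1, τ, Finset.mem_sdiff.2 ⟨hτ, this⟩, subset_rfl⟩
  have hedge : ∀ ρ ∈ Z, ρ.card = 2 → ρ ∉ R → ρ ∈ Q0 := by
    intro ρ hρ h2' hρR
    obtain ⟨τ, hτ⟩ := Finset.card_pos.1 (by have := h2 ρ hρ h2'; omega : 0 < dg Z ρ)
    rw [Finset.mem_filter] at hτ
    exact hQ0c.down τ (hmemQ0 ρ hρ h2' hρR τ hτ.1 hτ.2) ρ hτ.2 (hZ.nonempty ρ hρ)
  have touch : ∀ t, {t} ∈ Q0 → ∃ v, {v} ∈ R ∧ {v} ∈ comp Q0 t := by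
    intro t ht
    by_contra! hno
    obtain ⟨⟨r, hr⟩, -⟩ := hg.conn
    have hrt : ¬ Reach Q0 t r := fun h => by
      by_cases hrQ : {r} ∈ Q0
      · exact hno r hr (mem_comp_singleton.2 ⟨hrQ, h⟩)
      · rcases Relation.ReflTransGen.cases_tail h with rfl | ⟨y, _, hy⟩
        · exact hrQ ht
        · exact hrQ (hQ0c.right hy)
    obtain ⟨x, y, hxy, hx, hy⟩ := (hc.2 t r (cl_subset T ht) (hRZ hr)).exists_step
      (P := Reach Q0 t) (.refl t) hrt
    have hne : x ≠ y := fun e => hy (e ▸ hx)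
    have hxR : {x, y} ∉ R := fun h => by
      refine hno x (hg.isCx.left h) (mem_comp_singleton.2 ⟨?_, hx⟩)
      rcases Relation.ReflTransGen.cases_tail hx with rfl | ⟨y, _, hy⟩
      · exact ht
      · exact hQ0c.right hy
    exact hy (hx.trans (.of_edge (hedge _ hxy (Finset.card_pair hne) hxR)))
  have hbig : ∀ τ ∈ T, ∀ t ∈ τ, σ ∈ comp Q0 t := by
    intro τ hτ t ht
    have hτQ : τ ∈ Q0 := mem_cl.2 ⟨(mem_tris.1 (hTZ hτ)).1, τ, hτ, subset_rfl⟩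
    have htQ : {t} ∈ Q0 := hQ0c.vertex_mem hτQ ht
    obtain ⟨v, hvR, hvQ⟩ := touch t htQ
    by_contra hσ'
    have hgood : Good (R ∪ comp Q0 t) := by
      refine ⟨hg.isCx.union (comp_isCx hQ0c t), hg.conn.union (comp_conn htQ) hvR hvQ, ?_, ?_⟩
      · obtain ⟨ρ, hρ⟩ := hg.tri
        exact ⟨ρ, mem_tris.2 ⟨Finset.mem_union_left _ (mem_tris.1 hρ).1, (mem_tris.1 hρ).2⟩⟩
      · intro ε hε hε2
        by_cases hεR : ε ∈ R
        · exact (hg.two_le ε hεR hε2).trans (dg_mono Finset.subset_union_left ε)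
        · have hεC : ε ∈ comp Q0 t := (Finset.mem_union.1 hε).resolve_left hεR
          have hεZ : ε ∈ Z := cl_subset T (comp_subset t hεC)
          refine (h2 ε hεZ hε2).trans (le_trans ?_ (dg_mono Finset.subset_union_right ε))
          rw [dg_comp hεC]
          refine Finset.card_le_card fun ρ hρ => ?_
          rw [Finset.mem_filter] at hρ ⊢
          exact ⟨mem_tris.2 ⟨hmemQ0 ε hεZ hε2 hεR ρ hρ.1 hρ.2, (mem_tris.1 hρ.1).2⟩, hρ.2⟩
    have hle := hmax (R ∪ comp Q0 t) (by
      rw [Finset.mem_filter, Finset.mem_powerset]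
      exact ⟨Finset.union_subset hRZ ((comp_subset t).trans (cl_subset T)), hgood, fun h =>
        (Finset.mem_union.1 h).elim hσR hσ'⟩)
    have heq := Finset.eq_of_subset_of_card_le Finset.subset_union_left hle
    have : τ ∈ R := by
      rw [heq]
      exact Finset.mem_union_right _ (mem_comp.2 ⟨hτQ, t, ht, .refl t⟩)
    exact (Finset.mem_sdiff.1 hτ).2 this
  have hσT : σ ∈ T := Finset.mem_sdiff.2 ⟨hσ, hσR⟩
  have hσQ0 : σ ∈ Q0 := mem_cl.2 ⟨(mem_tris.1 hσ).1, σ, hσT, subset_rfl⟩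
  obtain ⟨a, ha⟩ := hZ.nonempty σ (mem_tris.1 hσ).1
  have haQ : {a} ∈ Q0 := hQ0c.vertex_mem hσQ0 ha
  have hTQ : ∀ τ ∈ T, τ ∈ comp Q0 a := by
    intro τ hτ
    have hτQ : τ ∈ Q0 := mem_cl.2 ⟨(mem_tris.1 (hTZ hτ)).1, τ, hτ, subset_rfl⟩
    obtain ⟨t, ht⟩ := hQ0c.nonempty τ hτQ
    exact mem_comp.2 ⟨hτQ, t, ht, (reach_of_mem_comp hQ0c (hbig τ hτ t ht) ha).symm⟩
  have hQc := comp_isCx hQ0c a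
  refine ⟨R, comp Q0 a, hg, hσR, hQc, comp_conn haQ, hTQ σ hσT, ?_, ?_, ?_, touch a haQ⟩
  · refine (Finset.union_subset hRZ ((comp_subset a).trans (cl_subset T))).antisymm fun ρ hρ => ?_
    have htri : ∀ τ ∈ tris Z, τ ∈ R ∪ comp Q0 a := fun τ hτ => by
      by_cases hτR : τ ∈ R
      · exact Finset.mem_union_left _ hτR
      · exact Finset.mem_union_right _ (hTQ τ (Finset.mem_sdiff.2 ⟨hτ, hτR⟩))
    have hU := hg.isCx.union hQc
    have hed : ∀ ε ∈ Z, ε.card = 2 → ε ∈ R ∪ comp Q0 a := fun ε hε hε2 => by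
      obtain ⟨τ, hτ⟩ := Finset.card_pos.1 (by have := h2 ε hε hε2; omega : 0 < dg Z ε)
      rw [Finset.mem_filter] at hτ
      exact hU.down τ (htri τ hτ.1) ε hτ.2 (hZ.nonempty ε hε)
    have h1 := hZ.card_le ρ hρ
    have h3 := (hZ.nonempty ρ hρ).card_pos
    have : ρ.card = 1 ∨ ρ.card = 2 ∨ ρ.card = 3 := by omega
    rcases this with h | h | h
    · obtain ⟨v, rfl⟩ := Finset.card_eq_one.1 h
      obtain ⟨⟨r, hr⟩, -⟩ := hg.conn
      by_cases hvr : r = v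
      · exact Finset.mem_union_left _ (hvr ▸ hr)
      · obtain ⟨x, y, hxy, rfl, hy⟩ := (hc.2 v r hρ (hRZ hr)).exists_step (P := (· = v)) rfl hvr
        exact hU.left (hed _ hxy (Finset.card_pair (Ne.symm hy)))
    · exact hed ρ hρ h
    · exact htri ρ (mem_tris.2 ⟨hρ, h⟩)
  · rw [Finset.disjoint_left]
    intro τ hτ hτ'
    have h1 := (mem_tris.1 hτ').1
    have : τ ∈ tris Q0 := mem_tris.2 ⟨comp_subset a h1, (mem_tris.1 hτ).2⟩
    rw [hQ0, tris_cl hTZ, hT, Finset.mem_sdiff] at this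
    exact this.2 (mem_tris.1 hτ).1
  · intro ε hε hε2
    rw [dg_comp hε]
    exact dg_cl_pos hTZ (comp_subset a hε)

/-- With small excess the only cycle of overloaded edges is the odd one. -/
lemma eq_odd_of_isCyc (hF : IsCx F) (h2 : ∀ ε ∈ F, ε.card = 2 → 2 ≤ dg F ε) (he : exc F ≤ 5)
    {C : Finset (Finset (Fin N))} (hC : IsCyc C) (hne : C.Nonempty)
    (h3 : ∀ ε ∈ C, ε ∈ F ∧ 3 ≤ dg F ε) : C = (edges F).filter fun ε => Odd (dg F ε) := by
  set O := (edges F).filter fun ε => Odd (dg F ε) with hO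
  have hOc : IsCyc O := isCyc_odd hF
  by_contra hne'
  have hsd : (symmDiff C O).Nonempty := by
    rw [Finset.nonempty_iff_ne_empty]
    exact fun e => hne' (symmDiff_eq_bot.1 e)
  have n1 := (hC.symm_diff hOc).three_le hsd
  have n2 := hC.three_le hne
  have n3 : (symmDiff C O).card = (C \ O).card + (O \ C).card :=
    Finset.card_union_of_disjoint disjoint_sdiff_sdiff
  have n4 := Finset.card_sdiff_add_card_inter C O
  have n5 := Finset.card_sdiff_add_card_inter O C
  have hCE : C ⊆ edges F := fun ε hε => mem_edges.2 ⟨(h3 ε hε).1, hC.1 ε hε⟩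
  have n6 := sum_le_exc h2 (Finset.union_subset (Finset.sdiff_subset.trans hCE : C \ O ⊆ edges F)
    (Finset.filter_subset (fun ε => Odd (dg F ε)) (edges F)))
  rw [← hO, Finset.sum_union Finset.sdiff_disjoint] at n6
  have n7 : ((C \ O).card : ℤ) * 2 ≤ ∑ ε ∈ C \ O, ((dg F ε : ℤ) - 2) := by
    rw [← nsmul_eq_mul, ← Finset.sum_const]
    refine Finset.sum_le_sum fun ε hε => ?_
    rw [Finset.mem_sdiff] at hε
    have h4 := (h3 ε hε.1).2
    have h5 : ¬ Odd (dg F ε) := fun h => hε.2 (Finset.mem_filter.2 ⟨hCE hε.1, h⟩)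
    rw [Nat.odd_iff] at h5
    omega
  have n8 : (O.card : ℤ) ≤ ∑ ε ∈ O, ((dg F ε : ℤ) - 2) := by
    rw [Finset.card_eq_sum_ones]
    push_cast
    refine Finset.sum_le_sum fun ε hε => ?_
    rw [hO, Finset.mem_filter, mem_edges] at hε
    have h4 := h2 ε hε.1.1 hε.1.2
    have h5 := hε.2
    rw [Nat.odd_iff] at h5
    omega
  rw [Finset.inter_comm] at n5
  omega

end

noncomputable section
open scoped ContinuousMap

variable {N : ℕ} {F G K D Z R Q : Finset (Finset (Fin N))}

lemma card_verts (F : Finset (Finset (Fin N))) :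
    ((Finset.univ : Finset (Fin N)).filter fun v => {v} ∈ F).card = (verts F).card := by
  refine Finset.card_bij (fun v _ => {v}) (fun v hv => mem_verts.2
    ⟨(Finset.mem_filter.1 hv).2, Finset.card_singleton v⟩)
    (fun v _ w _ e => Finset.singleton_injective e) fun σ hσ => ?_
  obtain ⟨v, rfl⟩ := Finset.card_eq_one.1 (mem_verts.1 hσ).2
  exact ⟨v, by simp [(mem_verts.1 hσ).1], rfl⟩

/-- A set of edges at least as large as the vertex set of the ambient complex contains a cycle. -/
lemma exists_cyc_of_card_le (hF : IsCx F) {v : Fin N} (hv : {v} ∈ F)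
    {E : Finset (Finset (Fin N))} (hE : E ⊆ edges F) (h : (verts F).card ≤ E.card) :
    ∃ C ⊆ E, C.Nonempty ∧ IsCyc C := by
  refine exists_cyc (V := Finset.univ.filter fun v => {v} ∈ F) (fun ε hε => (mem_edges.1 (hE hε)).2)
    (fun ε hε w hw => ?_) ⟨v, by simpa using hv⟩ ?_
  · simpa using hF.vertex_mem (mem_edges.1 (hE hε)).1 hw
  · rwa [card_verts]

lemma dg_eq_zero_of_notMem (hF : IsCx F) {ε : Finset (Fin N)} (hε : ε ∉ F) (hne : ε.Nonempty) :
    dg F ε = 0 := by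
  rw [dg, Finset.card_eq_zero, Finset.filter_eq_empty_iff]
  exact fun τ hτ h => hε (hF.down τ (mem_tris.1 hτ).1 ε h hne)

/-- A minimal complex of Euler characteristic at least two is closed. -/
lemma two_le_dg_of_minimal (hZ : IsCx Z) (hc : Conn Z) (he : 2 ≤ eul Z)
    (hmin : ∀ Y ⊂ Z, IsCx Y → Conn Y → eul Y ≤ 1) : ∀ ε ∈ Z, ε.card = 2 → 2 ≤ dg Z ε := by
  intro ε hε h2
  by_contra! hlt
  have : dg Z ε = 0 ∨ dg Z ε = 1 := by omega
  rcases this with hd | hd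
  · have hmax := eq_of_dg_zero hZ h2 hd
    obtain ⟨a, b, hab, rfl⟩ := Finset.card_eq_two.1 h2
    have h1 := eul_erase hε
    rw [h2] at h1
    by_cases hcon : Conn (Z.erase {a, b})
    · have := hmin _ (Finset.erase_ssubset hε) (erase_isCx hZ hmax) hcon
      norm_num at h1
      omega
    · obtain ⟨A, B, hA, hB, hAc, hBc, hu, hi⟩ := exists_split_edge hab hZ hc hε hmax hcon
      have h3 := eul_union_inter A B
      have hAs : A ⊂ Z := (Finset.subset_union_left.trans hu.le).trans_ssubset
        (Finset.erase_ssubset hε)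
      have hBs : B ⊂ Z := (Finset.subset_union_right.trans hu.le).trans_ssubset
        (Finset.erase_ssubset hε)
      have h4 := hmin A hAs hA hAc
      have h5 := hmin B hBs hB hBc
      rw [hu, hi, show eul (∅ : Finset (Finset (Fin N))) = 0 from rfl] at h3
      norm_num at h1
      omega
  · obtain ⟨c, hc', hτ, hfree⟩ := exists_free hZ h2 hd
    have h1 := inclHE_collapse hZ (Finset.card_pos.1 (by omega)) hc' hτ hfree
    have h3 := collapse_isCx hZ hc' hfree
    have h4 := hmin _ (collapse_ssubset hτ) h3 (h1.conn h3 hZ hc)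
    rw [collapse_eul hc' hε hτ] at h4
    omega

/-- A minimal complex of Euler characteristic at least two becomes contractible after removing a
suitable triangle. -/
lemma exists_contractible_erase (hZ : IsCx Z) (hc : Conn Z) (hs : Sparse Z) (he : 2 ≤ eul Z)
    (hmin : ∀ Y ⊂ Z, IsCx Y → Conn Y → eul Y ≤ 1) :
    ∃ σ ∈ tris Z, ContractibleSpace (real (Z.erase σ)) := by
  have h2 := two_le_dg_of_minimal hZ hc he hmin
  have htri : (tris Z).Nonempty := by
    rw [Finset.nonempty_iff_ne_empty]
    intro ht
    obtain ⟨a, rfl⟩ := hc.eq_singleton hZ fun ε hε h => by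
      have := h2 ε hε h
      rw [dg, ht] at this
      simp at this
    simp [eul] at he
  have herase : ∀ σ ∈ tris Z, Conn (Z.erase σ) ∧ IsCx (Z.erase σ) ∧
      eul (Z.erase σ) = eul Z - 1 := by
    intro σ hσ
    obtain ⟨h1, h3⟩ := mem_tris.1 hσ
    refine ⟨hc.erase_of_card_ne (by omega) (by omega), hZ.erase_tri h3, ?_⟩
    rw [eul_erase h1, h3]
    norm_num
  have heul : eul Z = 2 := by
    obtain ⟨σ, hσ⟩ := htri
    obtain ⟨h1, h3, h4⟩ := herase σ hσ
    have := hmin _ (Finset.erase_ssubset (mem_tris.1 hσ).1) h3 h1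
    omega
  by_contra! hcon
  have hZne : Z.Nonempty := htri.mono (Finset.filter_subset _ _)
  have hexc : exc Z ≤ 5 := by
    have := hs.exc_le hZ hZne
    omega
  have hproper : ∀ R, Good R → R ⊂ Z → eul R = 1 ∧
      ∀ ε : Finset (Fin N), ε.card = 2 → Even (dg R ε) := by
    intro R hR hRZ
    have h1 := hmin R hRZ hR.isCx hR.conn
    have h3 := hR.one_le_eul (hs.mono hRZ.1)
    refine ⟨by omega, fun ε h4 => ?_⟩
    by_cases h5 : ε ∈ R
    · exact hR.even (hs.mono hRZ.1) h1 h5 h4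
    · rw [dg_eq_zero_of_notMem hR.isCx h5 (Finset.card_pos.1 (by omega))]
      exact Even.zero
  set O := (edges Z).filter fun ε => Odd (dg Z ε) with hO
  have split : ∀ σ ∈ tris Z, ∃ R Q, Good R ∧ R ⊂ Z ∧ σ ∉ R ∧ IsCx Q ∧ Conn Q ∧ σ ∈ Q ∧
      R ∪ Q = Z ∧ Disjoint (tris R) (tris Q) ∧ O ⊆ R ∩ Q ∧
      (∀ ε ∈ Q, ε.card = 2 → 1 ≤ dg Q ε) ∧ O.Nonempty := by
    intro σ hσ
    obtain ⟨h1, h3, h4⟩ := herase σ hσ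
    have hex : ∃ R ⊆ Z, Good R ∧ σ ∉ R := by
      by_contra! hno
      refine hcon σ hσ (contractible_of_no_good _ _ le_rfl h3 h1 (by omega) fun R hR hg => ?_)
      exact (Finset.mem_erase.1 (hR (hno R (hR.trans (Finset.erase_subset _ _)) hg))).1 rfl
    obtain ⟨R, Q, hR, hσR, hQ, hQc, hσQ, hu, hd, hpos, v, hvR, hvQ⟩ :=
      exists_good_split hZ hc h2 hσ hex
    have hRZ : R ⊂ Z := (Finset.ssubset_iff_of_subset (hu ▸ Finset.subset_union_left)).2
      ⟨σ, (mem_tris.1 hσ).1, hσR⟩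
    have hQZ : Q ⊂ Z := by
      obtain ⟨τ, hτ⟩ := hR.tri
      refine (Finset.ssubset_iff_of_subset (hu ▸ Finset.subset_union_right)).2
        ⟨τ, hRZ.1 (mem_tris.1 hτ).1, fun h => ?_⟩
      exact Finset.disjoint_left.1 hd hτ (mem_tris.2 ⟨h, (mem_tris.1 hτ).2⟩)
    have e1 := (hproper R hR hRZ).1
    have e2 := hmin Q hQZ hQ hQc
    have e3 := eul_union_inter R Q
    have hI := hR.isCx.inter hQ
    have e4 := eul_eq hI
    have e5 : tris (R ∩ Q) = ∅ := by
      rw [← Finset.not_nonempty_iff_eq_empty]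
      rintro ⟨τ, hτ⟩
      obtain ⟨hτ, h5⟩ := mem_tris.1 hτ
      rw [Finset.mem_inter] at hτ
      exact Finset.disjoint_left.1 hd (mem_tris.2 ⟨hτ.1, h5⟩) (mem_tris.2 ⟨hτ.2, h5⟩)
    rw [hu] at e3
    rw [e5] at e4
    simp only [Finset.card_empty, Nat.cast_zero, add_zero] at e4
    obtain ⟨C, hC, hCne, hCc⟩ := exists_cyc_of_card_le hI (Finset.mem_inter.2 ⟨hvR, hvQ⟩)
      (subset_refl (edges (R ∩ Q))) (by omega)
    have hCO : C = O := by
      refine eq_odd_of_isCyc hZ h2 hexc hCc hCne fun ε hε => ?_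
      obtain ⟨h5, h6⟩ := mem_edges.1 (hC hε)
      rw [Finset.mem_inter] at h5
      refine ⟨hRZ.1 h5.1, ?_⟩
      rw [← hu, dg_union hd]
      have := hR.two_le ε h5.1 h6
      have := hpos ε h5.2 h6
      omega
    exact ⟨R, Q, hR, hRZ, hσR, hQ, hQc, hσQ, hu, hd,
      hCO ▸ hC.trans (Finset.filter_subset _ _), hpos, hCO ▸ hCne⟩
  have hOne : O.Nonempty := by
    obtain ⟨σ, hσ⟩ := htri
    obtain ⟨-, -, -, -, -, -, -, -, -, -, -, -, h⟩ := split σ hσ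
    exact h
  obtain ⟨ε, hεO, hε3⟩ : ∃ ε ∈ O, dg Z ε = 3 := by
    by_contra! hno
    have n1 := (isCyc_odd hZ).three_le hOne
    have n2 := sum_le_exc h2 (Finset.filter_subset (fun ε => Odd (dg Z ε)) (edges Z))
    have n3 : (O.card : ℤ) * 3 ≤ ∑ ε ∈ O, ((dg Z ε : ℤ) - 2) := by
      rw [← nsmul_eq_mul, ← Finset.sum_const]
      refine Finset.sum_le_sum fun η hη => ?_
      have h3 := hno η hη
      rw [hO, Finset.mem_filter, mem_edges] at hη
      have h4 := h2 η hη.1.1 hη.1.2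
      have h5 := hη.2
      rw [Nat.odd_iff] at h5
      omega
    rw [← hO] at n1 n2
    omega
  have hεZ := (Finset.mem_filter.1 hεO).1
  have hε2 := (mem_edges.1 hεZ).2
  have hεne : ε.Nonempty := Finset.card_pos.1 (by omega)
  -- the degree of `ε` in a good part missing one of its triangles is two
  have hRd : ∀ R, Good R → R ⊂ Z → O ⊆ R → ∀ t ∈ tris Z, ε ⊆ t → t ∉ R →
      (tris R).filter (ε ⊆ ·) = ((tris Z).filter (ε ⊆ ·)).erase t := by
    intro R hR hRZ hOR t ht hεt htR
    have hsub : (tris R).filter (ε ⊆ ·) ⊆ ((tris Z).filter (ε ⊆ ·)).erase t := by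
      intro τ hτ
      rw [Finset.mem_filter, mem_tris] at hτ
      refine Finset.mem_erase.2 ⟨fun h => htR (h ▸ hτ.1.1), ?_⟩
      exact Finset.mem_filter.2 ⟨mem_tris.2 ⟨hRZ.1 hτ.1.1, hτ.1.2⟩, hτ.2⟩
    refine Finset.eq_of_subset_of_card_le hsub ?_
    rw [Finset.card_erase_of_mem (Finset.mem_filter.2 ⟨ht, hεt⟩)]
    have h3 := hR.two_le ε (hOR hεO) hε2
    change dg Z ε - 1 ≤ dg R ε
    omega
  obtain ⟨t1, ht1⟩ := Finset.card_pos.1 (by omega : 0 < dg Z ε)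
  rw [Finset.mem_filter] at ht1
  obtain ⟨R1, Q1, hR1, hRZ1, ht1R, hQ1, hQc1, ht1Q, hu1, hd1, hO1, hpos1, -⟩ := split t1 ht1.1
  have hR1ε := hRd R1 hR1 hRZ1 (hO1.trans Finset.inter_subset_left) t1 ht1.1 ht1.2 ht1R
  obtain ⟨t2, ht2⟩ := Finset.card_pos.1
    (by have := hR1.two_le ε (Finset.mem_inter.1 (hO1 hεO)).1 hε2; omega : 0 < dg R1 ε)
  rw [Finset.mem_filter] at ht2
  have ht2Z : t2 ∈ tris Z := mem_tris.2 ⟨hRZ1.1 (mem_tris.1 ht2.1).1, (mem_tris.1 ht2.1).2⟩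
  have ht12 : t1 ≠ t2 := fun h => ht1R (h ▸ (mem_tris.1 ht2.1).1)
  obtain ⟨R2, Q2, hR2, hRZ2, ht2R, hQ2, hQc2, ht2Q, hu2, hd2, hO2, hpos2, -⟩ := split t2 ht2Z
  have hR2ε := hRd R2 hR2 hRZ2 (hO2.trans Finset.inter_subset_left) t2 ht2Z ht2.2 ht2R
  obtain ⟨w, hw⟩ := hεne
  have hεR1 := (Finset.mem_inter.1 (hO1 hεO)).1
  have hεQ1 := (Finset.mem_inter.1 (hO1 hεO)).2
  have hεR2 := (Finset.mem_inter.1 (hO2 hεO)).1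
  have hεQ2 := (Finset.mem_inter.1 (hO2 hεO)).2
  have hR12 : Good (R1 ∪ R2) := hR1.of_tri_subset hR2 (hR1.isCx.vertex_mem hεR1 hw)
    (hR2.isCx.vertex_mem hεR2 hw)
  have hR12Z : R1 ∪ R2 = Z := by
    by_contra hne
    have hss := (Finset.union_subset hRZ1.1 hRZ2.1).ssubset_of_ne hne
    have hev := (hproper _ hR12 hss).2 ε hε2
    have : dg (R1 ∪ R2) ε = 3 := by
      rw [dg, tris_union, Finset.filter_union, hR1ε, hR2ε, ← hε3]
      congr 1
      ext τ
      simp only [Finset.mem_union, Finset.mem_erase]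
      constructor
      · rintro (h | h) <;> exact h.2
      · intro h
        by_cases h1 : τ = t1
        · exact .inr ⟨h1 ▸ ht12, h⟩
        · exact .inl ⟨h1, h⟩
    rw [this] at hev
    exact absurd hev (by decide)
  have hdQ : Disjoint (tris Q1) (tris Q2) := by
    rw [Finset.disjoint_left]
    intro τ h1 h3
    have hτZ : τ ∈ Z := hu1 ▸ Finset.mem_union_right _ (mem_tris.1 h1).1
    rw [← hR12Z, Finset.mem_union] at hτZ
    rcases hτZ with h | h
    · exact Finset.disjoint_left.1 hd1 (mem_tris.2 ⟨h, (mem_tris.1 h1).2⟩) h1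
    · exact Finset.disjoint_left.1 hd2 (mem_tris.2 ⟨h, (mem_tris.1 h1).2⟩) h3
  have hdsum : ∀ η, dg (Q1 ∪ Q2) η + dg R1 η + dg R2 η = 2 * dg Z η := by
    intro η
    have e1 := dg_union hd1 η
    have e2 := dg_union hd2 η
    rw [hu1] at e1
    rw [hu2] at e2
    rw [dg_union hdQ]
    omega
  set R3 := Q1 ∪ Q2 with hR3
  have hQ1Z : Q1 ⊆ Z := hu1 ▸ Finset.subset_union_right
  have hQ2Z : Q2 ⊆ Z := hu2 ▸ Finset.subset_union_right
  have hgood3 : Good R3 := by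
    refine ⟨hQ1.union hQ2, hQc1.union hQc2 (hQ1.vertex_mem hεQ1 hw) (hQ2.vertex_mem hεQ2 hw),
      ⟨t1, mem_tris.2 ⟨Finset.mem_union_left _ ht1Q, (mem_tris.1 ht1.1).2⟩⟩, fun η hη hη2 => ?_⟩
    have e1 := hdsum η
    have e2 := (hproper R1 hR1 hRZ1).2 η hη2
    have e3 := (hproper R2 hR2 hRZ2).2 η hη2
    have e4 := h2 η (Finset.union_subset hQ1Z hQ2Z hη) hη2
    rw [Nat.even_iff] at e2 e3
    have e5 : dg R1 η ≤ dg Z η := dg_mono hRZ1.1 η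
    have e6 : dg R2 η ≤ dg Z η := dg_mono hRZ2.1 η
    suffices 0 < dg R3 η by omega
    rcases Finset.mem_union.1 hη with h | h
    · exact (hpos1 η h hη2).trans (dg_mono Finset.subset_union_left η)
    · exact (hpos2 η h hη2).trans (dg_mono Finset.subset_union_right η)
  have hR3Z : R3 ⊂ Z := by
    refine (Finset.union_subset hQ1Z hQ2Z).ssubset_of_ne fun heq => ?_
    have hcard : 0 < ((((tris Z).filter (ε ⊆ ·)).erase t1).erase t2).card := by
      have h3 : ((tris Z).filter (ε ⊆ ·)).card = 3 := hε3
      rw [Finset.card_erase_of_mem, Finset.card_erase_of_mem (Finset.mem_filter.2 ht1), h3]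
      · norm_num
      · exact Finset.mem_erase.2 ⟨ht12.symm, Finset.mem_filter.2 ⟨ht2Z, ht2.2⟩⟩
    obtain ⟨t3, ht3⟩ := Finset.card_pos.1 hcard
    rw [Finset.mem_erase, Finset.mem_erase] at ht3
    obtain ⟨h3, h4, h5⟩ := ht3
    have h6 : t3 ∈ tris R1 := (Finset.mem_filter.1 (hR1ε ▸ Finset.mem_erase.2 ⟨h4, h5⟩)).1
    have h7 : t3 ∈ tris R2 := (Finset.mem_filter.1 (hR2ε ▸ Finset.mem_erase.2 ⟨h3, h5⟩)).1
    have h8 : t3 ∈ R3 := heq.symm.subset (hRZ1.1 (mem_tris.1 h6).1)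
    rcases Finset.mem_union.1 h8 with h | h
    · exact Finset.disjoint_left.1 hd1 h6 (mem_tris.2 ⟨h, (mem_tris.1 h6).2⟩)
    · exact Finset.disjoint_left.1 hd2 h7 (mem_tris.2 ⟨h, (mem_tris.1 h7).2⟩)
  have hIK := (hR1.isCx.inter hR2.isCx).inter hgood3.isCx
  set K := R1 ∩ R2 ∩ R3 with hK
  have hKeul : eul K = -1 := by
    have e1 := eul_union_inter R1 R2
    have e2 := eul_union_inter (R1 ∩ R2) R3
    have e3 : R1 ∩ R2 ∪ R3 = Z := by
      refine (Finset.union_subset (Finset.inter_subset_left.trans hRZ1.1) hR3Z.1).antisymm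
        fun ρ hρ => ?_
      have h3 : ρ ∈ R1 ∪ Q1 := hu1.symm ▸ hρ
      have h4 : ρ ∈ R2 ∪ Q2 := hu2.symm ▸ hρ
      simp only [hR3, Finset.mem_union, Finset.mem_inter] at h3 h4 ⊢
      tauto
    rw [hR12Z, (hproper R1 hR1 hRZ1).1, (hproper R2 hR2 hRZ2).1] at e1
    rw [e3, (hproper R3 hgood3 hR3Z).1, ← hK] at e2
    omega
  have hKtri : tris K = ∅ := by
    rw [← Finset.not_nonempty_iff_eq_empty]
    rintro ⟨τ, hτ⟩
    obtain ⟨hτ, h5⟩ := mem_tris.1 hτ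
    simp only [hK, hR3, Finset.mem_inter, Finset.mem_union] at hτ
    rcases hτ.2 with h | h
    · exact Finset.disjoint_left.1 hd1 (mem_tris.2 ⟨hτ.1.1, h5⟩) (mem_tris.2 ⟨h, h5⟩)
    · exact Finset.disjoint_left.1 hd2 (mem_tris.2 ⟨hτ.1.2, h5⟩) (mem_tris.2 ⟨h, h5⟩)
  have hKcard := eul_eq hIK
  rw [hKtri, hKeul] at hKcard
  simp only [Finset.card_empty, Nat.cast_zero, add_zero] at hKcard
  have hwK : {w} ∈ K := by
    refine hIK.vertex_mem (Finset.mem_inter.2 ⟨Finset.mem_inter.2 ⟨hεR1, hεR2⟩, ?_⟩) hw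
    exact Finset.mem_union_left _ hεQ1
  have hcyc : ∀ E ⊆ edges K, (verts K).card ≤ E.card → O ⊆ E := by
    intro E hE hcard
    obtain ⟨C, hC, hCne, hCc⟩ := exists_cyc_of_card_le hIK hwK hE hcard
    suffices hCO : C = O from hCO ▸ hC
    refine eq_odd_of_isCyc hZ h2 hexc hCc hCne fun η hη => ?_
    obtain ⟨h5, h6⟩ := mem_edges.1 (hE (hC hη))
    simp only [hK, Finset.mem_inter] at h5
    have e1 := hdsum η
    have e2 := hR1.two_le η h5.1.1 h6
    have e3 := hR2.two_le η h5.1.2 h6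
    have e4 := hgood3.two_le η h5.2 h6
    exact ⟨hRZ1.1 h5.1.1, by omega⟩
  have hεK : ε ∈ edges K := hcyc _ (subset_refl _) (by omega) hεO
  refine Finset.notMem_erase ε (edges K) (hcyc _ (Finset.erase_subset _ _) ?_ hεO)
  rw [Finset.card_erase_of_mem hεK]
  omega

end

noncomputable section
open scoped ContinuousMap

variable {N : ℕ} {F G K D Z R Q Y : Finset (Finset (Fin N))}

/-- The number of times a word in the oriented edges runs through the edge `ε`. -/
def occ (L : List (Fin N × Fin N)) (ε : Finset (Fin N)) : ℕ :=
  L.countP fun p => ({p.1, p.2} : Finset (Fin N)) = ε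

/-- The boundary word of the triangle `abc` can be rewritten over `G` into a word in the edges of
`Y`, whose occurrence numbers complement the degrees of all edges but `e` to two. -/
def HasWord (G Y : Finset (Finset (Fin N))) (e : Finset (Fin N)) (a b c : Fin N) : Prop :=
  ∃ L : List (Fin N × Fin N), (∀ p ∈ L, p.1 ≠ p.2 ∧ {p.1, p.2} ∈ Y) ∧
    (∀ ε ∈ Y, ε.card = 2 → ε ≠ e → occ L ε + dg Y ε = 2) ∧
    ∀ (H : Type) [Group H] (x : Fin N → Fin N → H),
      (∀ i j k, {i, j, k} ∈ G → x i j * x j k = x i k) →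
      (L.map fun p => x p.1 p.2).prod = x a b * x b c * x c a

lemma dg_erase {σ : Finset (Fin N)} (h : σ ∈ tris F) (ε : Finset (Fin N)) :
    dg (F.erase σ) ε + (if ε ⊆ σ then 1 else 0) = dg F ε := by
  have h1 : tris (F.erase σ) = (tris F).erase σ := by
    ext τ; simp only [mem_tris, Finset.mem_erase]; tauto
  rw [dg, dg, h1, Finset.filter_erase]
  split_ifs with hs
  · rw [Finset.card_erase_add_one]
    exact Finset.mem_filter.2 ⟨h, hs⟩
  · rw [Finset.erase_eq_of_notMem, add_zero]
    simp [hs]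

lemma dg_erase_of_card_ne {σ : Finset (Fin N)} (h : σ.card ≠ 3) (ε : Finset (Fin N)) :
    dg (F.erase σ) ε = dg F ε := by
  have h1 : tris (F.erase σ) = tris F := by
    ext τ
    simp only [mem_tris, Finset.mem_erase]
    constructor
    · tauto
    · rintro ⟨h2, h3⟩
      exact ⟨⟨fun e => h (e ▸ h3), h2⟩, h3⟩
  rw [dg, dg, h1]

lemma subset_triple_iff {a b c : Fin N} (hab : a ≠ b) (hac : a ≠ c) (hbc : b ≠ c)
    {ε : Finset (Fin N)} (h2 : ε.card = 2) :
    ε ⊆ {a, b, c} ↔ ε = {a, b} ∨ ε = {b, c} ∨ ε = {c, a} := by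
  obtain ⟨p, q, hpq, rfl⟩ := Finset.card_eq_two.1 h2
  constructor
  · intro h
    have hp := h (Finset.mem_insert_self p {q})
    have hq := h (Finset.mem_insert_of_mem (Finset.mem_singleton_self q))
    simp only [Finset.mem_insert, Finset.mem_singleton] at hp hq
    rcases hp with rfl | rfl | rfl <;> rcases hq with rfl | rfl | rfl <;>
      simp_all [Finset.pair_comm]
  · rintro (h | h | h) <;> rw [h] <;> intro x <;> simp <;> tauto

lemma pair_ne_pair {a b c : Fin N} (hab : a ≠ b) (hac : a ≠ c) :
    ({a, c} : Finset (Fin N)) ≠ {b, c} := by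
  intro h
  have : a ∈ ({b, c} : Finset (Fin N)) := h ▸ Finset.mem_insert_self a _
  simp_all

lemma hasWord_start {e : Finset (Fin N)} {a b c : Fin N} (hF : IsCx F)
    (hab : a ≠ b) (hac : a ≠ c) (hbc : b ≠ c)
    (h : {a, b, c} ∈ F) (h2 : ∀ ε ∈ F, ε.card = 2 → ε ≠ e → dg F ε = 2) :
    HasWord G (F.erase {a, b, c}) e a b c := by
  have hcard : ({a, b, c} : Finset (Fin N)).card = 3 := Finset.card_eq_three.2
    ⟨a, b, c, hab, hac, hbc, rfl⟩
  have hmem : ∀ i j, i ∈ ({a, b, c} : Finset (Fin N)) → j ∈ ({a, b, c} : Finset (Fin N)) →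
      {i, j} ∈ F.erase {a, b, c} := fun i j hi hj => by
    refine Finset.mem_erase.2 ⟨fun e => ?_, hF.down _ h _ ?_ (by simp)⟩
    · have := Finset.card_le_two (a := i) (b := j)
      rw [e, hcard] at this; omega
    · intro l hl
      simp only [Finset.mem_insert, Finset.mem_singleton] at hl
      rcases hl with rfl | rfl <;> assumption
  refine ⟨[(a, b), (b, c), (c, a)], ?_, fun ε hε hε2 hne => ?_, fun H _ x _ => ?_⟩
  · intro p hp
    simp only [List.mem_cons, List.not_mem_nil, or_false] at hp
    rcases hp with rfl | rfl | rfl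
    · exact ⟨hab, hmem _ _ (by simp) (by simp)⟩
    · exact ⟨hbc, hmem _ _ (by simp) (by simp)⟩
    · exact ⟨hac.symm, hmem _ _ (by simp) (by simp)⟩
  · rw [← h2 ε (Finset.mem_of_mem_erase hε) hε2 hne, ← dg_erase (mem_tris.2 ⟨h, hcard⟩) ε,
      add_comm]
    congr 1
    simp only [occ, List.countP_cons, List.countP_nil, decide_eq_true_eq,
      subset_triple_iff hab hac hbc hε2]
    have n1 := pair_ne_pair hac hab
    have n2 := pair_ne_pair hab.symm hbc
    have n3 := pair_ne_pair hbc.symm hac.symm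
    rw [Finset.pair_comm c b] at n1
    rw [Finset.pair_comm a c] at n2
    rw [Finset.pair_comm b a] at n3
    by_cases e1 : ε = {a, b}
    · subst e1; simp [n1.symm, n3]
    by_cases e2 : ε = {b, c}
    · subst e2; simp [n1, n2.symm]
    by_cases e3 : ε = {c, a}
    · subst e3; simp [n2, n3.symm]
    · simp [e1, e2, e3, Ne.symm e1, Ne.symm e2, Ne.symm e3]
  · simp [mul_assoc]

/-- Rewriting a word by pushing it across a triangle. -/
def push (a b c : Fin N) (p : Fin N × Fin N) : List (Fin N × Fin N) :=
  if p = (a, b) then [(a, c), (c, b)] else if p = (b, a) then [(b, c), (c, a)] else [p]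

lemma pair_eq_pair_iff {a b i j : Fin N} :
    ({i, j} : Finset (Fin N)) = {a, b} ↔ (i, j) = (a, b) ∨ (i, j) = (b, a) := by
  rw [← Finset.coe_inj]
  simp only [Finset.coe_pair, Set.pair_eq_pair_iff, Prod.mk.injEq]

lemma occ_append (L L' : List (Fin N × Fin N)) (η : Finset (Fin N)) :
    occ (L ++ L') η = occ L η + occ L' η := List.countP_append

lemma occ_cons (p : Fin N × Fin N) (L : List (Fin N × Fin N)) (η : Finset (Fin N)) :
    occ (p :: L) η = occ L η + if ({p.1, p.2} : Finset (Fin N)) = η then 1 else 0 := by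
  simp [occ, List.countP_cons]

lemma occ_flatMap_push {a b c : Fin N} (hab : a ≠ b) (hac : a ≠ c) (hbc : b ≠ c)
    {η : Finset (Fin N)} (hη : η ≠ {a, b}) (L : List (Fin N × Fin N)) :
    occ (L.flatMap (push a b c)) η =
      occ L η + if η = {b, c} ∨ η = {c, a} then occ L {a, b} else 0 := by
  induction L with
  | nil => simp [occ]
  | cons p L ih =>
    obtain ⟨i, j⟩ := p
    rw [List.flatMap_cons, occ_append, ih, occ_cons, occ_cons]
    have n1 := pair_ne_pair hab hac
    simp only [pair_eq_pair_iff, push]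
    have hη' : ¬ ({b, a} : Finset (Fin N)) = η := fun e => hη (by rw [← e, Finset.pair_comm])
    have n2 : ¬ ({b, c} : Finset (Fin N)) = {c, a} := fun e => n1 (by rw [e, Finset.pair_comm])
    by_cases e1 : (i, j) = (a, b)
    · simp only [e1, if_true, true_or]
      rw [Prod.mk.injEq] at e1
      obtain ⟨rfl, rfl⟩ := e1
      rw [if_neg (Ne.symm hη)]
      simp only [occ, List.countP_cons, List.countP_nil, decide_eq_true_eq,
        Finset.pair_comm i c, Finset.pair_comm c j]
      by_cases e2 : η = {j, c}
      · subst e2; simp [Ne.symm n2]; omega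
      · by_cases e3 : η = {c, i}
        · subst e3; simp [n2]; omega
        · simp [e2, e3, Ne.symm e2, Ne.symm e3]
    · by_cases e1' : (i, j) = (b, a)
      · simp only [e1', if_true, or_true]
        rw [if_neg (by simp [hab.symm])]
        have hη2 : ¬ ({i, j} : Finset (Fin N)) = η := by
          rw [Prod.mk.injEq] at e1'
          rwa [e1'.1, e1'.2]
        rw [if_neg hη2]
        simp only [occ, List.countP_cons, List.countP_nil, decide_eq_true_eq]
        by_cases e2 : η = {b, c}
        · subst e2; simp [Ne.symm n2]; omega
        · by_cases e3 : η = {c, a}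
          · subst e3; simp [n2]; omega
          · simp [e2, e3, Ne.symm e2, Ne.symm e3]
      · simp only [e1, e1', if_false, or_false, add_zero]
        rw [occ_cons]
        simp [occ]
        omega

lemma HasWord.collapse {e : Finset (Fin N)} {a b c : Fin N} (h : HasWord G Y e a b c)
    (hY : IsCx Y) (hYG : Y ⊆ G) {ε : Finset (Fin N)} {z : Fin N} (hε : ε ∈ Y) (h2 : ε.card = 2)
    (hz : z ∉ ε) (hτ : insert z ε ∈ Y) (hd : dg Y ε = 1) (hne : ε ≠ e) :
    HasWord G ((Y.erase (insert z ε)).erase ε) e a b c := by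
  obtain ⟨L, hL, hocc, hprod⟩ := h
  have hcard : (insert z ε).card = 3 := by rw [Finset.card_insert_of_notMem hz, h2]
  obtain ⟨p, q, hpq, rfl⟩ := Finset.card_eq_two.1 h2
  have hzp : p ≠ z := by rintro rfl; simp at hz
  have hzq : q ≠ z := by rintro rfl; simp at hz
  have htri : insert z {p, q} = ({p, q, z} : Finset (Fin N)) := by
    ext; simp; tauto
  have hmem : ∀ i j, i ≠ j → i ∈ ({p, q, z} : Finset (Fin N)) → j ∈ ({p, q, z} : Finset (Fin N)) →
      ({i, j} : Finset (Fin N)) ≠ {p, q} →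
      {i, j} ∈ (Y.erase (insert z {p, q})).erase {p, q} := fun i j hij hi hj hn => by
    refine Finset.mem_erase.2 ⟨hn, Finset.mem_erase.2 ⟨fun e => ?_, hY.down _ hτ _ ?_ (by simp)⟩⟩
    · have := Finset.card_le_two (a := i) (b := j)
      rw [e, hcard] at this; omega
    · intro l hl
      simp only [Finset.mem_insert, Finset.mem_singleton] at hl
      rw [htri]
      rcases hl with rfl | rfl <;> assumption
  have m1 : ({p, z} : Finset (Fin N)) ≠ {p, q} := by
    intro e; apply hz; rw [← e]; simp
  have m2 : ({q, z} : Finset (Fin N)) ≠ {p, q} := by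
    intro e; apply hz; rw [← e]; simp
  refine ⟨L.flatMap (push p q z), fun r hr => ?_, fun η hη hη2 hηe => ?_, fun H _ x hx => ?_⟩
  · obtain ⟨⟨i, j⟩, hs, hr⟩ := List.mem_flatMap.1 hr
    have hk := hL _ hs
    simp only [push] at hr
    split_ifs at hr with e1 e2
    · simp only [List.mem_cons, List.not_mem_nil, or_false] at hr
      rcases hr with rfl | rfl
      · exact ⟨hzp, hmem _ _ hzp (by simp) (by simp) m1⟩
      · exact ⟨hzq.symm, hmem _ _ hzq.symm (by simp) (by simp) (Finset.pair_comm z q ▸ m2)⟩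
    · simp only [List.mem_cons, List.not_mem_nil, or_false] at hr
      rcases hr with rfl | rfl
      · exact ⟨hzq, hmem _ _ hzq (by simp) (by simp) m2⟩
      · exact ⟨hzp.symm, hmem _ _ hzp.symm (by simp) (by simp) (Finset.pair_comm z p ▸ m1)⟩
    · simp only [List.mem_cons, List.not_mem_nil, or_false] at hr
      subst hr
      refine ⟨hk.1, Finset.mem_erase.2 ⟨fun h' => ?_, Finset.mem_erase.2 ⟨fun h' => ?_, hk.2⟩⟩⟩
      · rcases pair_eq_pair_iff.1 h' with h' | h'
        exacts [e1 h', e2 h']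
      · have := Finset.card_le_two (a := i) (b := j)
        simp only at h'
        rw [h', hcard] at this; omega
  · obtain ⟨k1, k2⟩ := Finset.mem_erase.1 hη
    have k3 := Finset.mem_of_mem_erase k2
    rw [occ_flatMap_push hpq hzp hzq k1, dg_erase_of_card_ne (by omega)]
    have k4 := hocc η k3 hη2 hηe
    have k5 := hocc _ hε h2 hne
    have k6 := dg_erase (mem_tris.2 ⟨hτ, hcard⟩) η
    rw [htri] at k6 ⊢
    simp only [subset_triple_iff hpq hzp hzq hη2, k1, false_or] at k6
    split_ifs at k6 ⊢ <;> omega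
  · rw [← hprod H x hx]
    clear hL hocc hprod
    induction L with
    | nil => rfl
    | cons r L ih =>
      rw [List.flatMap_cons, List.map_append, List.prod_append, ih, List.map_cons, List.prod_cons]
      congr 1
      simp only [push]
      have t1 : ({p, z, q} : Finset (Fin N)) = insert z {p, q} := by ext; simp; tauto
      have t2 : ({q, z, p} : Finset (Fin N)) = insert z {p, q} := by ext; simp; tauto
      split_ifs with e1 e2
      · subst e1; simpa using hx p z q (hYG (t1 ▸ hτ))
      · subst e2; simpa using hx q z p (hYG (t2 ▸ hτ))
      · simp

lemma prod_eq_of_occ {H : Type} [Group H] (x : Fin N → Fin N → H) {p q : Fin N} (hpq : p ≠ q)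
    (hinv : x p q * x q p = 1) : ∀ L : List (Fin N × Fin N),
    (∀ r ∈ L, ({r.1, r.2} : Finset (Fin N)) ≠ {p, q} → x r.1 r.2 = 1) →
    (occ L {p, q} = 0 → (L.map fun r => x r.1 r.2).prod = 1) ∧
    (occ L {p, q} = 1 → (L.map fun r => x r.1 r.2).prod = x p q ∨
      (L.map fun r => x r.1 r.2).prod * x p q = 1) ∧
    (occ L {p, q} = 2 → (L.map fun r => x r.1 r.2).prod = 1 ∨
      (L.map fun r => x r.1 r.2).prod = x p q * x p q ∨
      (L.map fun r => x r.1 r.2).prod * (x p q * x p q) = 1) := by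
  have hq : x q p = (x p q)⁻¹ := (inv_eq_of_mul_eq_one_right hinv).symm
  intro L
  induction L with
  | nil => intro _; simp [occ]
  | cons r L ih =>
    intro h
    obtain ⟨h0, h1, h2⟩ := ih fun s hs => h s (List.mem_cons_of_mem _ hs)
    rw [occ_cons, List.map_cons, List.prod_cons]
    obtain ⟨i, j⟩ := r
    by_cases hr : ({i, j} : Finset (Fin N)) = {p, q}
    · simp only [hr, if_true]
      refine ⟨fun hh => by omega, fun hh => ?_, fun hh => ?_⟩
      · have h3 := h0 (by omega)
        rcases pair_eq_pair_iff.1 hr with e | e <;> rw [Prod.mk.injEq] at e <;>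
          obtain ⟨rfl, rfl⟩ := e
        · left; rw [h3, mul_one]
        · right; rw [h3, hq]; simp
      · rcases pair_eq_pair_iff.1 hr with e | e <;> rw [Prod.mk.injEq] at e <;>
          obtain ⟨rfl, rfl⟩ := e <;> rcases h1 (by omega) with h3 | h3
        · right; left; rw [h3]
        · left; rw [eq_inv_of_mul_eq_one_left h3]; simp
        · left; rw [h3, hq]; simp
        · right; right; rw [eq_inv_of_mul_eq_one_left h3, hq]; group
    · have h3 : x i j = 1 := h (i, j) (List.mem_cons_self) hr
      simp only [hr, if_false, add_zero, h3, one_mul]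
      exact ⟨h0, h1, h2⟩

/-- On a graph, the word condition yields a square word in any edge outside a maximal tree. -/
lemma HasWord.sqWord {e : Finset (Fin N)} {a b c p q : Fin N} (h : HasWord G Y e a b c)
    (hYG : Y ⊆ G) (htri : tris Y = ∅) (hpq : p ≠ q) (hpqY : {p, q} ∈ Y) (hne : {p, q} ≠ e) :
    SqWord G (Y.erase {p, q}) a b c p q := by
  obtain ⟨L, hL, hocc, hprod⟩ := h
  intro H _ x h1 h2 h3
  rw [← hprod H x h2]
  refine (prod_eq_of_occ x hpq (h1 p q (hYG hpqY)) L fun r hr hn => ?_).2.2 ?_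
  · exact h3 _ _ (Finset.mem_erase.2 ⟨hn, (hL r hr).2⟩)
  · have := hocc _ hpqY (Finset.card_pair hpq) hne
    rwa [dg, htri, Finset.filter_empty, Finset.card_empty, add_zero] at this

end

noncomputable section
open scoped ContinuousMap

variable {N : ℕ} {F G K D Z R Q Y X B : Finset (Finset (Fin N))}

/-- The end points of an edge of a cycle remain connected after removing the edge. -/
lemma IsCyc.reach_erase {C : Finset (Finset (Fin N))} (hC : IsCyc C) (hCF : C ⊆ F) {p q : Fin N}
    (hpq : p ≠ q) (h : {p, q} ∈ C) : Reach (F.erase {p, q}) p q := by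
  classical
  by_contra hn
  set S : Finset (Fin N) := Finset.univ.filter fun v => Reach (F.erase {p, q}) p v with hS
  have h1 := Finset.sum_card_bipartiteAbove_eq_sum_card_bipartiteBelow (s := S) (t := C)
    (fun v ε => v ∈ ε)
  have h2 : Even (∑ v ∈ S, (Finset.bipartiteAbove (fun v ε => v ∈ ε) C v).card) :=
    Finset.even_sum _ fun v _ => hC.2 v
  rw [h1, ← Finset.add_sum_erase _ _ h] at h2
  have h3 : Even (∑ ε ∈ C.erase {p, q}, (Finset.bipartiteBelow (fun v ε => v ∈ ε) S ε).card) := by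
    refine Finset.even_sum _ fun ε hε => ?_
    obtain ⟨hne, hε⟩ := Finset.mem_erase.1 hε
    obtain ⟨i, j, hij, rfl⟩ := Finset.card_eq_two.1 (hC.1 ε hε)
    have hm : {i, j} ∈ F.erase {p, q} := Finset.mem_erase.2 ⟨hne, hCF hε⟩
    have hiff : i ∈ S ↔ j ∈ S := by
      simp only [hS, Finset.mem_filter, Finset.mem_univ, true_and]
      exact ⟨fun h => h.tail hm, fun h => h.tail (Finset.pair_comm i j ▸ hm)⟩
    by_cases hi : i ∈ S
    · have : Finset.bipartiteBelow (fun v ε => v ∈ ε) S ({i, j} : Finset (Fin N)) = {i, j} := by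
        ext k
        simp only [Finset.mem_bipartiteBelow, Finset.mem_insert, Finset.mem_singleton]
        constructor
        · exact fun h => h.2
        · rintro (rfl | rfl)
          exacts [⟨hi, .inl rfl⟩, ⟨hiff.1 hi, .inr rfl⟩]
      rw [this, Finset.card_pair hij]
      exact even_two
    · have : Finset.bipartiteBelow (fun v ε => v ∈ ε) S ({i, j} : Finset (Fin N)) = ∅ := by
        rw [Finset.eq_empty_iff_forall_notMem]
        intro k hk
        simp only [Finset.mem_bipartiteBelow, Finset.mem_insert, Finset.mem_singleton] at hk
        obtain ⟨hk, rfl | rfl⟩ := hk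
        exacts [hi hk, hi (hiff.2 hk)]
      rw [this, Finset.card_empty]
      exact Even.zero
  have h4 : Finset.bipartiteBelow (fun v ε => v ∈ ε) S ({p, q} : Finset (Fin N)) = {p} := by
    ext k
    simp only [Finset.mem_bipartiteBelow, Finset.mem_insert, Finset.mem_singleton]
    constructor
    · rintro ⟨hk, rfl | rfl⟩
      · rfl
      · exact absurd (by simpa [hS] using hk) hn
    · rintro rfl
      exact ⟨by simpa [hS] using Reach.refl _, .inl rfl⟩
  rw [h4, Finset.card_singleton, add_comm] at h2
  exact (Nat.even_add_one.1 h2) h3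

/-- Collapsing triangles one after the other while keeping track of the boundary word. -/
lemma exists_graph (n : ℕ) {e : Finset (Fin N)} {a b c : Fin N} (hB : IsCx B) :
    ∀ Y : Finset (Finset (Fin N)), Y.card ≤ n → IsCx Y → Conn Y → B ∪ Y ⊆ G →
    InclHE (B ∪ Y) G → HasWord G Y e a b c → (∀ ε ∈ Y, ε.card = 2 → ε ≠ e → ε ∉ B) →
    (∀ T ⊆ tris Y, T.Nonempty → ∃ ε ∈ Y, ε.card = 2 ∧ ε ≠ e ∧ (T.filter (ε ⊆ ·)).card = 1) →
    ∃ Γ ⊆ Y, IsCx Γ ∧ Conn Γ ∧ eul Γ = eul Y ∧ tris Γ = ∅ ∧ InclHE (B ∪ Γ) G ∧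
      HasWord G Γ e a b c := by
  induction n with
  | zero =>
    intro Y hn _ hc
    obtain ⟨a, ha⟩ := hc.1
    exact absurd (Finset.card_pos.2 ⟨_, ha⟩) (by omega)
  | succ n ih =>
    intro Y hn hY hc hBG hHE hw hBe hfree
    rcases (tris Y).eq_empty_or_nonempty with ht | ht
    · exact ⟨Y, subset_rfl, hY, hc, rfl, ht, hHE, hw⟩
    obtain ⟨ε, hε, h2, hne, hd⟩ := hfree _ subset_rfl ht
    have hεB := hBe ε hε h2 hne
    have hεn : ε.Nonempty := Finset.card_pos.1 (by omega)
    obtain ⟨z, hz, hτ, hfr⟩ := exists_free hY h2 hd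
    have hτB : insert z ε ∉ B := fun h => hεB (hB.down _ h _ (Finset.subset_insert _ _) hεn)
    have hYG : Y ⊆ G := Finset.subset_union_right.trans hBG
    set Y' := (Y.erase (insert z ε)).erase ε with hY'
    have hsub : Y' ⊆ Y := collapse_subset
    have hY'c := collapse_isCx hY hz hfr
    have hconn := (inclHE_collapse hY hεn hz hτ hfr).conn hY'c hY hc
    have hu : ((B ∪ Y).erase (insert z ε)).erase ε = B ∪ Y' := by
      ext ρ
      simp only [hY', Finset.mem_erase, Finset.mem_union]
      constructor
      · tauto
      · rintro (h | h)
        · exact ⟨fun e => hεB (e ▸ h), fun e => hτB (e ▸ h), .inl h⟩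
        · tauto
    have hcol := inclHE_collapse (hB.union hY) hεn hz (Finset.mem_union_right _ hτ) fun ρ hρ h => by
      rcases Finset.mem_union.1 hρ with h' | h'
      · exact absurd (hB.down _ h' _ h hεn) hεB
      · exact hfr ρ h' h
    rw [hu] at hcol
    obtain ⟨Γ, h3, h4, h5, h6, h7⟩ := ih Y'
      (by have : Y'.card < Y.card := Finset.card_lt_card (collapse_ssubset hτ); omega) hY'c hconn
      ((Finset.union_subset_union_right hsub).trans hBG) (hcol.trans hHE)
      (hw.collapse hY hYG hε h2 hz hτ hd hne) (fun η hη => hBe η (hsub hη)) (fun T hT hTn => by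
        obtain ⟨η, hη, k2, k3, k4⟩ := hfree T
          (hT.trans (Finset.filter_subset_filter _ hsub)) hTn
        refine ⟨η, ?_, k2, k3, k4⟩
        obtain ⟨t, ht⟩ := Finset.card_pos.1 (k4.symm ▸ Nat.one_pos)
        rw [Finset.mem_filter] at ht
        exact hY'c.down t (mem_tris.1 (hT ht.1)).1 η ht.2 (Finset.card_pos.1 (by omega)))
    exact ⟨Γ, h3.trans hsub, h4, h5, h6.trans (collapse_eul hz hε hτ), h7⟩

/-- A complex without triangles and of Euler characteristic zero is a tree plus one edge. -/
lemma exists_unicyclic (hF : IsCx F) (hc : Conn F) (he : eul F = 0) (ht : tris F = ∅)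
    (e : Finset (Fin N)) : ∃ p q, p ≠ q ∧ {p, q} ∈ F ∧ {p, q} ≠ e ∧ IsCx (F.erase {p, q}) ∧
      Reach (F.erase {p, q}) p q ∧ ContractibleSpace (real (F.erase {p, q})) := by
  have h1 := eul_eq hF
  rw [he, ht] at h1
  simp only [Finset.card_empty, Nat.cast_zero, add_zero] at h1
  obtain ⟨v, hv⟩ := hc.1
  obtain ⟨C, hCF, hne, hC⟩ := exists_cyc_of_card_le hF hv (subset_refl (edges F)) (by omega)
  have h3 := hC.three_le hne
  obtain ⟨ε, hε⟩ : (C.erase e).Nonempty := by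
    rw [← Finset.card_pos]
    have := Finset.pred_card_le_card_erase (s := C) (a := e)
    omega
  obtain ⟨hεe, hε⟩ := Finset.mem_erase.1 hε
  obtain ⟨hεF, h2⟩ := mem_edges.1 (hCF hε)
  have hd : dg F ε = 0 := by rw [dg, ht]; simp
  have hmax := eq_of_dg_zero hF h2 hd
  have heu := eul_erase hεF
  obtain ⟨p, q, hpq, rfl⟩ := Finset.card_eq_two.1 h2
  have hr := hC.reach_erase (hCF.trans (Finset.filter_subset _ _)) hpq hε
  have hcx := erase_isCx hF hmax
  rw [h2, he] at heu
  norm_num at heu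
  refine ⟨p, q, hpq, hεF, hεe, hcx, hr, ?_⟩
  refine contractible_of_no_good _ _ le_rfl hcx (hc.erase_pair hpq hF hεF hr) (by omega)
    fun R hR hg => ?_
  obtain ⟨t, ht'⟩ := hg.tri
  have : t ∈ tris F := mem_tris.2 ⟨(hR.trans (Finset.erase_subset _ _)) (mem_tris.1 ht').1,
    (mem_tris.1 ht').2⟩
  rw [ht] at this
  simp at this

end

noncomputable section
open scoped ContinuousMap

variable {N : ℕ} {F G K D Z R Q Y X B : Finset (Finset (Fin N))}

/-- Connected subcomplexes in which every edge is covered twice or is isolated in `X`. -/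
structure Nice (X B : Finset (Finset (Fin N))) : Prop where
  sub : B ⊆ X
  isCx : IsCx B
  conn : Conn B
  deg : ∀ ε ∈ B, ε.card = 2 → 2 ≤ dg B ε ∨ dg X ε = 0

lemma nice_singleton {a : Fin N} (h : {a} ∈ X) : Nice X {{a}} := by
  refine ⟨by simpa using h, ⟨?_, ?_, ?_⟩, ?_, ?_⟩
  · simp
  · simp
  · intro σ hσ τ hτ hn
    rw [Finset.mem_singleton] at hσ ⊢
    subst hσ
    exact (Finset.subset_singleton_iff.1 hτ).resolve_left hn.ne_empty
  · refine Conn.of_center (a := a) (by simp) fun b hb => ?_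
    rw [Finset.mem_singleton, Finset.singleton_inj] at hb
    exact hb ▸ Reach.refl _
  · intro ε hε h2
    rw [Finset.mem_singleton] at hε
    subst hε
    simp at h2

lemma Nice.union_good (hB : Nice X B) (hR : Good R) (hRX : R ⊆ X) {v : Fin N} (h1 : {v} ∈ B)
    (h2 : {v} ∈ R) : Nice X (B ∪ R) := by
  refine ⟨Finset.union_subset hB.sub hRX, hB.isCx.union hR.isCx, hB.conn.union hR.conn h1 h2,
    fun ε hε hc => ?_⟩
  rcases Finset.mem_union.1 hε with h | h
  · exact (hB.deg ε h hc).imp_left fun h' => h'.trans (dg_mono Finset.subset_union_left ε)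
  · exact .inl ((hR.two_le ε h hc).trans (dg_mono Finset.subset_union_right ε))

/-- A proper nonempty subcomplex of a connected complex misses a face touching it. -/
lemma exists_touching (hX : IsCx X) (hc : Conn X) (hB : IsCx B) (hBX : B ⊂ X) {w : Fin N}
    (hw : {w} ∈ B) : ∃ τ ∈ X, τ ∉ B ∧ 2 ≤ τ.card ∧ ∃ v ∈ τ, {v} ∈ B := by
  obtain ⟨τ, hτX, hτB⟩ := Finset.exists_of_ssubset hBX
  by_cases hv : ∃ u : Fin N, {u} ∈ X ∧ {u} ∉ B
  · obtain ⟨u, hu, huB⟩ := hv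
    obtain ⟨x, y, hxy, hx, hy⟩ := (hc.2 w u (hBX.1 hw) hu).exists_step (P := fun v => {v} ∈ B)
      hw huB
    refine ⟨{x, y}, hxy, fun h => hy (hB.right h), ?_, x, by simp, hx⟩
    rw [Finset.card_pair]
    rintro rfl
    exact hy hx
  · push Not at hv
    have hn := hX.nonempty τ hτX
    refine ⟨τ, hτX, hτB, ?_, ?_⟩
    · by_contra! hlt
      have h1 : τ.card = 1 := by have := hn.card_pos; omega
      obtain ⟨u, rfl⟩ := Finset.card_eq_one.1 h1
      exact hτB (hv u hτX)
    · obtain ⟨v, hv'⟩ := hn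
      exact ⟨v, hv', hv v (hX.vertex_mem hτX hv')⟩

lemma exists_maximal_nice (hc : Conn X) (hX : ∀ a, X ≠ {{a}}) :
    ∃ B, Nice X B ∧ B ≠ X ∧ ∀ B', Nice X B' → B ⊆ B' → B ≠ B' → B' = X := by
  classical
  obtain ⟨a, ha⟩ := hc.1
  obtain ⟨B, hB, hmax⟩ := Finset.exists_max_image
    (X.powerset.filter fun B => Nice X B ∧ B ≠ X) Finset.card
    ⟨{{a}}, Finset.mem_filter.2 ⟨Finset.mem_powerset.2 (nice_singleton ha).sub,
      nice_singleton ha, (hX a).symm⟩⟩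
  obtain ⟨-, hB, hne⟩ := Finset.mem_filter.1 hB
  refine ⟨B, hB, hne, fun B' hB' hsub hne' => ?_⟩
  by_contra hcon
  have h1 := hmax B' (Finset.mem_filter.2 ⟨Finset.mem_powerset.2 hB'.sub, hB', hcon⟩)
  have h2 := Finset.card_lt_card (hsub.ssubset_of_ne hne')
  omega

/-- An isolated edge touching a maximal nice complex is a leaf. -/
lemma isWedge_of_isolated (hX : IsCx X)
    (IH : ∀ Y ⊂ X, IsCx Y → Conn Y → IsWedge (real Y)) (hB : Nice X B) (hne : B ≠ X)
    (hmax : ∀ B', Nice X B' → B ⊆ B' → B ≠ B' → B' = X) {a b : Fin N} (hab : a ≠ b)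
    (h : {a, b} ∈ X) (hd : dg X {a, b} = 0) (hnc : ¬ Conn (X.erase {a, b}))
    (habB : {a, b} ∉ B) (ha : {a} ∈ B) : IsWedge (real X) := by
  have hm := eq_of_dg_zero hX (Finset.card_pair hab) hd
  set P : Finset (Finset (Fin N)) := {{a}, {b}, {a, b}} with hP
  have hPcx : IsCx P := by
    refine ⟨?_, ?_, ?_⟩
    · simp [hP]
    · simp only [hP, Finset.mem_insert, Finset.mem_singleton]
      rintro σ (rfl | rfl | rfl)
      · simp
      · simp
      · exact Finset.card_le_two.trans (by norm_num)
    · intro σ hσ τ hτ hn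
      have h1 : τ ⊆ {a, b} := by
        refine hτ.trans ?_
        simp only [hP, Finset.mem_insert, Finset.mem_singleton] at hσ
        rcases hσ with rfl | rfl | rfl <;> simp
      have h3 : τ ∈ ({a, b} : Finset (Fin N)).powerset := Finset.mem_powerset.2 h1
      rw [Finset.powerset_insert] at h3
      simp only [Finset.mem_union, Finset.mem_powerset, Finset.subset_singleton_iff,
        Finset.mem_image] at h3
      simp only [hP, Finset.mem_insert, Finset.mem_singleton]
      rcases h3 with (rfl | rfl) | ⟨ρ, rfl | rfl, rfl⟩
      · exact absurd rfl hn.ne_empty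
      · tauto
      · simp
      · simp
  have hPc : Conn P := by
    refine Conn.of_center (a := a) (by simp [hP]) fun v hv => ?_
    by_cases hva : v = a
    · exact hva ▸ Reach.refl _
    · have hvb : v = b := by
        simp only [hP, Finset.mem_insert, Finset.mem_singleton, Finset.singleton_inj] at hv
        rcases hv with h | h | h
        · exact absurd h hva
        · exact h
        · have := congrArg Finset.card h
          rw [Finset.card_pair hab] at this
          simp at this
      subst hvb
      exact Reach.of_edge (by simp [hP])
  have hPX : P ⊆ X := by
    intro σ hσ
    simp only [hP, Finset.mem_insert, Finset.mem_singleton] at hσ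
    rcases hσ with rfl | rfl | rfl
    exacts [hX.left h, hX.right h, h]
  have hnice : Nice X (B ∪ P) := by
    refine ⟨Finset.union_subset hB.sub hPX, hB.isCx.union hPcx,
      hB.conn.union hPc ha (by simp [hP]), fun ε hε hc => ?_⟩
    rcases Finset.mem_union.1 hε with h' | h'
    · exact (hB.deg ε h' hc).imp_left fun h'' => h''.trans (dg_mono Finset.subset_union_left ε)
    · simp only [hP, Finset.mem_insert, Finset.mem_singleton] at h'
      rcases h' with rfl | rfl | rfl
      · simp at hc
      · simp at hc
      · exact .inr hd
  have hXe : B ∪ P = X := hmax _ hnice Finset.subset_union_left fun e => habB (by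
    rw [e]; simp [hP])
  by_cases hb : {b} ∈ B
  · refine absurd ?_ hnc
    have : X.erase {a, b} = B := by
      ext σ
      rw [Finset.mem_erase, ← hXe, Finset.mem_union]
      constructor
      · rintro ⟨h1, h2 | h2⟩
        · exact h2
        · simp only [hP, Finset.mem_insert, Finset.mem_singleton] at h2
          rcases h2 with rfl | rfl | rfl
          exacts [ha, hb, absurd rfl h1]
      · exact fun h => ⟨fun e => habB (e ▸ h), .inl h⟩
    rw [this]
    exact hB.conn
  · have hfree : ∀ σ ∈ X, {b} ⊆ σ → σ = {b} ∨ σ = insert a {b} := by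
      intro σ hσ hbσ
      rw [← hXe, Finset.mem_union] at hσ
      rcases hσ with hσ | hσ
      · exact absurd (hB.isCx.vertex_mem hσ (Finset.singleton_subset_iff.1 hbσ)) hb
      · simp only [hP, Finset.mem_insert, Finset.mem_singleton] at hσ
        rcases hσ with rfl | rfl | rfl
        · rw [Finset.singleton_subset_singleton] at hbσ
          exact absurd hbσ.symm hab
        · exact .inl rfl
        · exact .inr rfl
    have hcol := inclHE_collapse hX (Finset.singleton_nonempty b) (by simpa using hab) h hfree
    have hE : (X.erase (insert a {b})).erase {b} = B := by
      ext σ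
      rw [Finset.mem_erase, Finset.mem_erase, ← hXe, Finset.mem_union]
      constructor
      · rintro ⟨h0, h1, h2 | h2⟩
        · exact h2
        · simp only [hP, Finset.mem_insert, Finset.mem_singleton] at h2
          rcases h2 with rfl | rfl | rfl
          exacts [ha, absurd rfl h0, absurd rfl h1]
      · exact fun h => ⟨fun e => hb (e ▸ h), fun e => habB (e ▸ h), .inl h⟩
    rw [hE] at hcol
    exact hcol.isWedge (IH B (hB.sub.ssubset_of_ne hne) hB.isCx hB.conn)

/-- The situation left when a maximal nice complex is completed by a pseudo-surface glued along a
graph. -/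
lemma isWedge_of_surface (hX : IsCx X) (hc : Conn X)
    (IH : ∀ Y ⊂ X, IsCx Y → Conn Y → IsWedge (real Y)) (hB : IsCx B) (hZ : IsCx Z) (hZc : Conn Z)
    (hu : B ∪ Z = X) {e : Finset (Fin N)} (he : eul Z = 1)
    (hBe : ∀ ε ∈ Z, ε.card = 2 → ε ≠ e → ε ∉ B ∧ dg Z ε = 2) (htB : ∀ t ∈ tris Z, t ∉ B)
    (htri : (tris Z).Nonempty)
    (hind : ∀ T ⊂ tris Z, T.Nonempty →
      ∃ ε ∈ Z, ε.card = 2 ∧ (T.filter (ε ⊆ ·)).card = 1) : IsWedge (real X) := by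
  obtain ⟨σ, hσ⟩ := htri
  have hσB := htB σ hσ
  have hσc := (mem_tris.1 hσ).2
  have hσZ := (mem_tris.1 hσ).1
  have hZX : Z ⊆ X := hu ▸ Finset.subset_union_right
  have hfree : ∀ T ⊂ tris Z, T.Nonempty →
      ∃ ε ∈ Z, ε.card = 2 ∧ ε ≠ e ∧ (T.filter (ε ⊆ ·)).card = 1 := by
    intro T hT hTn
    by_contra! hno
    obtain ⟨ε, hε, h2, h1⟩ := hind T hT hTn
    have hεe : ε = e := by
      by_contra hne
      exact hno ε hε h2 hne h1
    have hodd := isCyc_odd (cl_isCx hZ T)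
    have hεm : ε ∈ (edges (cl Z T)).filter fun ε => Odd (dg (cl Z T) ε) := by
      refine Finset.mem_filter.2 ⟨mem_edges.2 ⟨mem_cl.2 ⟨hε, ?_⟩, h2⟩, ?_⟩
      · obtain ⟨t, ht⟩ := Finset.card_pos.1 (h1.symm ▸ Nat.one_pos)
        exact ⟨t, (Finset.mem_filter.1 ht).1, (Finset.mem_filter.1 ht).2⟩
      · rw [dg_cl hT.1, h1]
        exact odd_one
    have h3 := hodd.three_le ⟨ε, hεm⟩
    have h4 : ((edges (cl Z T)).filter fun ε => Odd (dg (cl Z T) ε)) ⊆ {e} := by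
      intro η hη
      obtain ⟨h5, h6⟩ := Finset.mem_filter.1 hη
      obtain ⟨h7, h8⟩ := mem_edges.1 h5
      rw [Finset.mem_singleton]
      by_contra hne
      have h9 := hno η (cl_subset T h7) h8 hne
      have h10 := (hBe η (cl_subset T h7) h8 hne).2
      have h11 := dg_mono (cl_subset T : cl Z T ⊆ Z) η
      rw [dg_cl hT.1] at h6 h11
      rw [Nat.odd_iff] at h6
      omega
    have := Finset.card_le_card h4
    rw [Finset.card_singleton] at this
    omega
  obtain ⟨a, b, c, hab, hac, hbc, rfl⟩ := Finset.card_eq_three.1 hσc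
  have hG := hX.erase_tri hσc
  have hcG : Conn (X.erase {a, b, c}) := hc.erase_of_card_ne (by omega) (by omega)
  have hsub : X.erase {a, b, c} ⊂ X := Finset.erase_ssubset (hZX hσZ)
  have hu' : B ∪ Z.erase {a, b, c} = X.erase {a, b, c} := by
    rw [← hu, Finset.erase_union_distrib, Finset.erase_eq_of_notMem hσB]
  obtain ⟨Γ, hΓZ, hΓ, hΓc, hΓe, hΓt, hΓh, hΓw⟩ := exists_graph (e := e) (a := a) (b := b) (c := c) _
    hB (Z.erase {a, b, c}) le_rfl (hZ.erase_tri hσc)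
    (hZc.erase_of_card_ne (by omega) (by omega)) hu'.le (hu' ▸ InclHE.refl _)
    (hasWord_start hZ hab hac hbc hσZ fun ε hε h2 hne => (hBe ε hε h2 hne).2)
    (fun ε hε h2 hne => (hBe ε (Finset.mem_of_mem_erase hε) h2 hne).1)
    (fun T hT hTn => by
      have hTs : T ⊂ tris Z := by
        refine (Finset.ssubset_iff_of_subset
          (hT.trans (Finset.filter_subset_filter _ (Finset.erase_subset _ _)))).2
          ⟨_, hσ, fun h => ?_⟩
        exact (Finset.mem_erase.1 (mem_tris.1 (hT h)).1).1 rfl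
      obtain ⟨ε, h1, h2, h3⟩ := hfree T hTs hTn
      exact ⟨ε, Finset.mem_erase.2 ⟨fun h => by rw [h] at h2; omega, h1⟩, h2, h3⟩)
  have hΓ0 : eul Γ = 0 := by
    have := eul_erase hσZ
    rw [hσc, he] at this
    norm_num at this
    omega
  obtain ⟨p, q, hpq, hm, hne, hD, hr, hDc⟩ := exists_unicyclic hΓ hΓc hΓ0 hΓt e
  have hΓG : Γ ⊆ X.erase {a, b, c} :=
    hΓZ.trans (Finset.erase_subset_erase _ hZX)
  have hKG : B ∪ Γ ⊆ X.erase {a, b, c} :=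
    (Finset.union_subset_union_right hΓZ).trans hu'.le
  have hpqB : {p, q} ∉ B :=
    (hBe _ (Finset.mem_of_mem_erase (hΓZ hm)) (Finset.card_pair hpq) hne).1
  have hK := hB.union hΓ
  have hKm : {p, q} ∈ B ∪ Γ := Finset.mem_union_right _ hm
  have hmaxK : ∀ τ ∈ B ∪ Γ, {p, q} ⊆ τ → τ = {p, q} := by
    intro τ hτ h
    rcases Finset.mem_union.1 hτ with h' | h'
    · exact absurd (hB.down _ h' _ h (Finset.insert_nonempty _ _)) hpqB
    · exact eq_of_dg_zero hΓ (Finset.card_pair hpq) (by rw [dg, hΓt]; simp) τ h' h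
  have hDK : Γ.erase {p, q} ⊆ (B ∪ Γ).erase {p, q} :=
    Finset.erase_subset_erase _ Finset.subset_union_right
  have hKe := (hΓh.conn hK hG hcG).erase_pair hpq hK hKm (hr.mono hDK)
  have hpm : ∀ v ∈ ({p, q} : Finset (Fin N)), {v} ∈ Γ.erase {p, q} := by
    intro v hv
    refine Finset.mem_erase.2 ⟨fun h => ?_, hΓ.vertex_mem hm hv⟩
    have := congrArg Finset.card h
    rw [Finset.card_pair hpq, Finset.card_singleton] at this
    omega
  refine IsWedge.of_sqWord hX hab hac hbc (hZX hσZ) hcG (IH _ hsub hG hcG) hK hKG hΓh hpq hKm hmaxK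
    hKe (IH _ ?_ (erase_isCx hK hmaxK) hKe) hD hDK hDc (hpm p (by simp)) (hpm q (by simp))
    (hΓw.sqWord hΓG hΓt hpq hm hne)
  exact ((Finset.erase_subset _ _).trans hKG).trans_ssubset hsub

end

noncomputable section
open scoped ContinuousMap

variable {N : ℕ} {F G K D Z R Q Y X B : Finset (Finset (Fin N))}

lemma Good.deg_even (h : Good F) (hs : Sparse F) (he : eul F ≤ 1) {ε : Finset (Fin N)}
    (h2 : ε.card = 2) : Even (dg F ε) := by
  by_cases h5 : ε ∈ F
  · exact h.even hs he h5 h2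
  · rw [dg_eq_zero_of_notMem h.isCx h5 (Finset.card_pos.1 (by omega))]
    exact Even.zero

lemma dg_eq_add_sdiff (h : G ⊆ F) (ε : Finset (Fin N)) :
    dg F ε = dg G ε + ((tris F \ tris G).filter (ε ⊆ ·)).card := by
  have hs : tris G ⊆ tris F := Finset.filter_subset_filter _ h
  rw [dg, dg, ← Finset.card_union_of_disjoint, ← Finset.filter_union,
    Finset.union_sdiff_of_subset hs]
  exact Finset.disjoint_filter_filter Finset.disjoint_sdiff

set_option maxHeartbeats 1000000 in
/-- If all connected subcomplexes have Euler characteristic at most one, a triangle touching a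
maximal nice complex spans a pseudo-surface completing it. -/
lemma isWedge_of_triangle (hX : IsCx X) (hc : Conn X) (hs : Sparse X)
    (IH : ∀ Y ⊂ X, IsCx Y → Conn Y → IsWedge (real Y))
    (hflat : ∀ Y ⊆ X, IsCx Y → Conn Y → eul Y ≤ 1)
    (h1 : ∀ ε ∈ X, ε.card = 2 → dg X ε ≠ 1) (hB : Nice X B)
    (hmax : ∀ B', Nice X B' → B ⊆ B' → B ≠ B' → B' = X) {τ : Finset (Fin N)} (hτ : τ ∈ tris X)
    (hτB : τ ∉ B) {v : Fin N} (hvτ : v ∈ τ) (hvB : {v} ∈ B) : IsWedge (real X) := by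
  classical
  set T1 := tris X \ tris B with hT1
  have hT1X : T1 ⊆ tris X := Finset.sdiff_subset
  have hτT1 : τ ∈ T1 := Finset.mem_sdiff.2 ⟨hτ, fun h => hτB (mem_tris.1 h).1⟩
  have hτX := (mem_tris.1 hτ).1
  have hvX := hX.vertex_mem hτX hvτ
  have hvτ' : {v} ⊆ τ := Finset.singleton_subset_iff.2 hvτ
  have hcl := cl_isCx hX T1
  have hvcl : {v} ∈ cl X T1 := mem_cl.2 ⟨hvX, τ, hτT1, hvτ'⟩
  set Z := comp (cl X T1) v with hZdef
  have hZ : IsCx Z := comp_isCx hcl v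
  have hZc : Conn Z := comp_conn hvcl
  have hZcl : Z ⊆ cl X T1 := comp_subset v
  have hZX : Z ⊆ X := hZcl.trans (cl_subset _)
  have hvZ : {v} ∈ Z := mem_comp_singleton.2 ⟨hvcl, .refl v⟩
  have hτZ : τ ∈ Z := mem_comp.2 ⟨mem_cl.2 ⟨hτX, τ, hτT1, subset_rfl⟩, v, hvτ, .refl v⟩
  have htZ : ∀ t ∈ tris Z, t ∉ B := by
    intro t ht
    have h2 : t ∈ tris (cl X T1) := mem_tris.2 ⟨hZcl (mem_tris.1 ht).1, (mem_tris.1 ht).2⟩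
    rw [tris_cl hT1X] at h2
    exact fun h => (Finset.mem_sdiff.1 h2).2 (mem_tris.2 ⟨h, (mem_tris.1 ht).2⟩)
  have hdgZ : ∀ ε ∈ Z, dg Z ε = (T1.filter (ε ⊆ ·)).card := fun ε hε => by
    rw [hZdef, dg_comp hε, dg_cl hT1X]
  have hpos : ∀ ε ∈ Z, 1 ≤ dg Z ε := fun ε hε => by
    rw [hZdef, dg_comp hε]
    exact dg_cl_pos hT1X (hZcl hε)
  have hsum : ∀ ε ∈ Z, dg X ε = dg B ε + dg Z ε := fun ε hε => by
    rw [hdgZ ε hε]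
    exact dg_eq_add_sdiff hB.sub ε
  have hBne : B ≠ B ∪ Z := fun e => hτB (e ▸ Finset.mem_union_right _ hτZ)
  have hu : B ∪ Z = X := by
    refine hmax _ ⟨Finset.union_subset hB.sub hZX, hB.isCx.union hZ, hB.conn.union hZc hvB hvZ,
      fun ε hε h2 => ?_⟩ Finset.subset_union_left hBne
    by_cases hεB : ε ∈ B
    · exact (hB.deg ε hεB h2).imp_left fun h' => h'.trans (dg_mono Finset.subset_union_left ε)
    · have hεZ := (Finset.mem_union.1 hε).resolve_left hεB
      have e1 := hsum ε hεZ
      rw [dg_eq_zero_of_notMem hB.isCx hεB (Finset.card_pos.1 (by omega))] at e1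
      have e2 := hpos ε hεZ
      have e3 := h1 ε (hZX hεZ) h2
      have e4 := dg_mono (Finset.subset_union_right : Z ⊆ B ∪ Z) ε
      left
      omega
  -- the component of all triangles
  have hvclX : {v} ∈ cl X (tris X) := mem_cl.2 ⟨hvX, τ, hτ, hvτ'⟩
  have hR : Good (comp (cl X (tris X)) v) := good_comp hX subset_rfl h1 hvclX
  set R := comp (cl X (tris X)) v with hRdef
  have hRX : R ⊆ X := (comp_subset v).trans (cl_subset _)
  have hclsub : cl X T1 ⊆ cl X (tris X) := fun ρ hρ => by
    obtain ⟨h2, t, ht, h3⟩ := mem_cl.1 hρ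
    exact mem_cl.2 ⟨h2, t, hT1X ht, h3⟩
  have hZR : Z ⊆ R := by
    intro ρ hρ
    obtain ⟨h2, w, hw, h3⟩ := mem_comp.1 hρ
    exact mem_comp.2 ⟨hclsub h2, w, hw, h3.mono hclsub⟩
  have hdgR : ∀ ε ∈ R, dg R ε = dg X ε := fun ε hε => by
    rw [hRdef, dg_comp hε, dg_cl subset_rfl, dg]
  have hRe := hflat R hRX hR.isCx hR.conn
  have hexc : exc R ≤ 2 := by
    have := (hs.mono hRX).exc_le hR.isCx hR.nonempty
    omega
  have heven : ∀ ε ∈ Z, ε.card = 2 → Even (dg X ε) := fun ε hε h2 => by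
    rw [← hdgR ε (hZR hε)]
    exact hR.deg_even (hs.mono hRX) hRe h2
  have htwo : ∀ ε ∈ Z, ε.card = 2 → 2 ≤ dg X ε := fun ε hε h2 => by
    rw [← hdgR ε (hZR hε)]
    exact hR.two_le ε (hZR hε) h2
  obtain ⟨e, he⟩ : ∃ e : Finset (Fin N), ∀ ε ∈ Z, ε.card = 2 → ε ≠ e → dg X ε = 2 := by
    by_contra! hno
    obtain ⟨ε, hε, h2, -, hε3⟩ := hno ∅
    obtain ⟨η, hη, h2', hne, hη3⟩ := hno ε
    have k1 := heven ε hε h2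
    have k2 := heven η hη h2'
    have k3 := htwo ε hε h2
    have k4 := htwo η hη h2'
    rw [Nat.even_iff] at k1 k2
    have hsub : ({ε, η} : Finset (Finset (Fin N))) ⊆ edges R := by
      intro ρ hρ
      simp only [Finset.mem_insert, Finset.mem_singleton] at hρ
      rcases hρ with rfl | rfl
      exacts [mem_edges.2 ⟨hZR hε, h2⟩, mem_edges.2 ⟨hZR hη, h2'⟩]
    have k5 := sum_le_exc hR.two_le hsub
    rw [Finset.sum_pair hne.symm, hdgR ε (hZR hε), hdgR η (hZR hη)] at k5
    omega
  have hBe : ∀ ε ∈ Z, ε.card = 2 → ε ≠ e → ε ∉ B ∧ dg Z ε = 2 := by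
    intro ε hε h2 hne
    have e1 := hsum ε hε
    have e2 := he ε hε h2 hne
    have e3 := hpos ε hε
    have hεB : ε ∉ B := fun h => by
      rcases hB.deg ε h h2 with h' | h' <;> omega
    refine ⟨hεB, ?_⟩
    rw [dg_eq_zero_of_notMem hB.isCx hεB (Finset.card_pos.1 (by omega))] at e1
    omega
  have hZeven : ∀ ε ∈ Z, ε.card = 2 → Even (dg Z ε) := by
    intro ε hε h2
    by_contra hodd
    rw [Nat.not_even_iff_odd] at hodd
    have h3 := (isCyc_odd hZ).three_le ⟨ε, Finset.mem_filter.2 ⟨mem_edges.2 ⟨hε, h2⟩, hodd⟩⟩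
    have h4 : ((edges Z).filter fun ε => Odd (dg Z ε)) ⊆ {e} := by
      intro η hη
      obtain ⟨h5, h6⟩ := Finset.mem_filter.1 hη
      obtain ⟨h7, h8⟩ := mem_edges.1 h5
      rw [Finset.mem_singleton]
      by_contra hne
      rw [(hBe η h7 h8 hne).2] at h6
      exact absurd h6 (by decide)
    have := Finset.card_le_card h4
    rw [Finset.card_singleton] at this
    omega
  have hZg : Good Z := ⟨hZ, hZc, ⟨τ, mem_tris.2 ⟨hτZ, (mem_tris.1 hτ).2⟩⟩, fun ε hε h2 => by
    have e1 := hZeven ε hε h2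
    have e2 := hpos ε hε
    rw [Nat.even_iff] at e1
    omega⟩
  have hZe : eul Z = 1 :=
    le_antisymm (hflat Z hZX hZ hZc) (hZg.one_le_eul (hs.mono hZX))
  have hall : ∀ R' ⊆ Z, Good R' → ∀ x : Fin N, {x} ∈ R' → {x} ∈ B → tris Z ⊆ tris R' := by
    intro R' hR'Z hR' x hxR hxB t ht
    have hn := hB.union_good hR' (hR'Z.trans hZX) hxB hxR
    obtain ⟨s, hs'⟩ := hR'.tri
    have hsB := htZ s (mem_tris.2 ⟨hR'Z (mem_tris.1 hs').1, (mem_tris.1 hs').2⟩)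
    have hXe := hmax _ hn Finset.subset_union_left fun e => hsB (by
      rw [e]; exact Finset.mem_union_right _ (mem_tris.1 hs').1)
    have htX : t ∈ B ∪ R' := hXe.symm ▸ hZX (mem_tris.1 ht).1
    exact mem_tris.2 ⟨(Finset.mem_union.1 htX).resolve_left (htZ t ht), (mem_tris.1 ht).2⟩
  refine isWedge_of_surface hX hc IH hB.isCx hZ hZc hu hZe hBe htZ hZg.tri fun T hT hTn => ?_
  by_contra! hno
  obtain ⟨t, ht⟩ := hTn
  obtain ⟨htZ', ht3⟩ := mem_tris.1 (hT.1 ht)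
  obtain ⟨u, hut⟩ := hZ.nonempty t htZ'
  have hucl : {u} ∈ cl Z T :=
    mem_cl.2 ⟨hZ.vertex_mem htZ' hut, t, ht, Finset.singleton_subset_iff.2 hut⟩
  have hR' : Good (comp (cl Z T) u) := good_comp hZ hT.1 hno hucl
  set R' := comp (cl Z T) u with hR'def
  have hR'Z : R' ⊆ Z := (comp_subset u).trans (cl_subset _)
  have htR : t ∈ tris R' := mem_tris.2
    ⟨mem_comp.2 ⟨mem_cl.2 ⟨htZ', t, ht, subset_rfl⟩, u, hut, .refl u⟩, ht3⟩
  by_cases hmeet : ∃ x : Fin N, {x} ∈ R' ∧ {x} ∈ B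
  · obtain ⟨x, hx, hxB⟩ := hmeet
    have h3 := hall R' hR'Z hR' x hx hxB
    obtain ⟨s, hsZ, hsT⟩ := Finset.exists_of_ssubset hT
    have h4 : s ∈ tris (cl Z T) := mem_tris.2
      ⟨comp_subset u (mem_tris.1 (h3 hsZ)).1, (mem_tris.1 hsZ).2⟩
    rw [tris_cl hT.1] at h4
    exact hsT h4
  · push Not at hmeet
    have hτR' : τ ∉ R' := fun h => hmeet v (hR'.isCx.vertex_mem h hvτ) hvB
    set T' := tris Z \ tris R' with hT'
    have hT'Z : T' ⊆ tris Z := Finset.sdiff_subset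
    have hτT' : τ ∈ T' := Finset.mem_sdiff.2 ⟨mem_tris.2 ⟨hτZ, (mem_tris.1 hτ).2⟩,
      fun h => hτR' (mem_tris.1 h).1⟩
    have hdT' : ∀ ε ∈ Z, ε.card = 2 → (T'.filter (ε ⊆ ·)).card ≠ 1 := by
      intro ε hε h2 hone
      have e1 := hZeven ε hε h2
      have e2 := hR'.deg_even (hs.mono (hR'Z.trans hZX))
        (hflat _ (hR'Z.trans hZX) hR'.isCx hR'.conn) h2
      have e3 : dg Z ε = dg R' ε + (T'.filter (ε ⊆ ·)).card := dg_eq_add_sdiff hR'Z ε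
      rw [Nat.even_iff] at e1 e2
      omega
    have hvcl' : {v} ∈ cl Z T' := mem_cl.2 ⟨hvZ, τ, hτT', hvτ'⟩
    have hR2 := good_comp hZ hT'Z hdT' hvcl'
    have h3 := hall _ ((comp_subset v).trans (cl_subset _)) hR2 v
      (mem_comp_singleton.2 ⟨hvcl', .refl v⟩) hvB (hT.1 ht)
    have h4 : t ∈ tris (cl Z T') := mem_tris.2 ⟨comp_subset v (mem_tris.1 h3).1, ht3⟩
    rw [tris_cl hT'Z] at h4
    exact (Finset.mem_sdiff.1 h4).2 htR

/-- The case in which all connected subcomplexes have Euler characteristic at most one. -/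
lemma isWedge_of_flat (hX : IsCx X) (hc : Conn X) (hs : Sparse X)
    (IH : ∀ Y ⊂ X, IsCx Y → Conn Y → IsWedge (real Y))
    (hflat : ∀ Y ⊆ X, IsCx Y → Conn Y → eul Y ≤ 1)
    (h1 : ∀ ε ∈ X, ε.card = 2 → dg X ε ≠ 1)
    (h0 : ∀ a b : Fin N, a ≠ b → {a, b} ∈ X → dg X {a, b} = 0 → ¬ Conn (X.erase {a, b})) :
    IsWedge (real X) := by
  by_cases hsing : ∃ a, X = {{a}}
  · obtain ⟨a, rfl⟩ := hsing
    exact isWedge_singleton a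
  push Not at hsing
  obtain ⟨B, hB, hne, hmax⟩ := exists_maximal_nice hc hsing
  obtain ⟨w, hw⟩ := hB.conn.1
  obtain ⟨τ, hτ, hτB, h2, v, hvτ, hvB⟩ :=
    exists_touching hX hc hB.isCx (hB.sub.ssubset_of_ne hne) hw
  have h3 := hX.card_le τ hτ
  by_cases hcard : τ.card = 3
  · exact isWedge_of_triangle hX hc hs IH hflat h1 hB hmax (mem_tris.2 ⟨hτ, hcard⟩) hτB hvτ hvB
  have hcard2 : τ.card = 2 := by omega
  by_cases hd : dg X τ = 0
  · obtain ⟨b, hb⟩ := Finset.card_eq_one.1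
      (show (τ.erase v).card = 1 by rw [Finset.card_erase_of_mem hvτ, hcard2])
    have hτe : τ = {v, b} := by rw [← Finset.insert_erase hvτ, hb]
    have hvb : v ≠ b := by
      rintro rfl
      exact Finset.notMem_erase v τ (hb ▸ Finset.mem_singleton_self v)
    subst hτe
    exact isWedge_of_isolated hX IH hB hne hmax hvb hτ hd (h0 v b hvb hτ hd) hτB hvB
  · obtain ⟨t, ht⟩ := Finset.card_pos.1 (Nat.pos_of_ne_zero hd)
    obtain ⟨ht, hτt⟩ := Finset.mem_filter.1 ht
    exact isWedge_of_triangle hX hc hs IH hflat h1 hB hmax ht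
      (fun h => hτB (hB.isCx.down t h τ hτt (hX.nonempty τ hτ))) (hτt hvτ) hvB

/-- Attaching the triangle whose removal makes a subcomplex contractible. -/
lemma isWedge_of_contractible_erase (hX : IsCx X) (hc : Conn X) (hZ : IsCx Z) (hZX : Z ⊆ X)
    {σ : Finset (Fin N)} (hσ : σ ∈ tris Z) (hcon : ContractibleSpace (real (Z.erase σ)))
    (hw : IsWedge (real (X.erase σ))) : IsWedge (real X) := by
  obtain ⟨hσZ, hσc⟩ := mem_tris.1 hσ
  obtain ⟨a, b, c, hab, hac, hbc, rfl⟩ := Finset.card_eq_three.1 hσc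
  have hmem : ∀ i j, i ∈ ({a, b, c} : Finset (Fin N)) → j ∈ ({a, b, c} : Finset (Fin N)) →
      {i, j} ∈ Z.erase {a, b, c} := fun i j hi hj => by
    refine Finset.mem_erase.2 ⟨fun e => ?_, hZ.pair_mem hσZ hi hj⟩
    have := Finset.card_le_two (a := i) (b := j)
    rw [e, hσc] at this
    omega
  have h1 := hmem a b (by simp) (by simp)
  have h2 := hmem b c (by simp) (by simp)
  have h3 := hmem c a (by simp) (by simp)
  have hsub : Z.erase {a, b, c} ⊆ X.erase {a, b, c} := Finset.erase_subset_erase _ hZX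
  have hG := hX.erase_tri hσc
  have hZ' := hZ.erase_tri hσc
  refine IsWedge.sphere_attach hX hab hac hbc (hZX hσZ) hG (hsub h1) (hsub h2) (hsub h3)
    (hc.erase_of_card_ne (by omega) (by omega)) hw ?_
  rw [← triLoop_map hZ' hG hsub h1 h2 h3]
  have : (triLoop hZ' h1 h2 h3).Homotopic (.refl _) := SimplyConnectedSpace.paths_homotopic _ _
  exact this.map (realIncl hsub)

theorem isWedge_of_sparse (n : ℕ) : ∀ X : Finset (Finset (Fin N)), X.card ≤ n → IsCx X → Conn X →
    Sparse X → IsWedge (real X) := by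
  classical
  induction n with
  | zero =>
    intro X hn _ hc
    obtain ⟨a, ha⟩ := hc.1
    exact absurd (Finset.card_pos.2 ⟨_, ha⟩) (by omega)
  | succ n ih =>
    intro X hn hX hc hs
    have IH : ∀ Y ⊂ X, IsCx Y → Conn Y → IsWedge (real Y) := fun Y hY h1 h2 =>
      ih Y (by have := Finset.card_lt_card hY; omega) h1 h2 (hs.mono hY.1)
    by_cases h1 : ∃ ε ∈ X, ε.card = 2 ∧ dg X ε = 1
    · obtain ⟨ε, hε, h2, hd⟩ := h1
      obtain ⟨z, hz, hτ, hfree⟩ := exists_free hX h2 hd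
      have hcol := inclHE_collapse hX (Finset.card_pos.1 (by omega)) hz hτ hfree
      have hcx := collapse_isCx hX hz hfree
      exact hcol.isWedge (IH _ (collapse_ssubset hτ) hcx (hcol.conn hcx hX hc))
    push Not at h1
    by_cases h0 : ∃ a b : Fin N, a ≠ b ∧ {a, b} ∈ X ∧ dg X {a, b} = 0 ∧ Conn (X.erase {a, b})
    · obtain ⟨a, b, hab, h, hd, hcon⟩ := h0
      have hmax := eq_of_dg_zero hX (Finset.card_pair hab) hd
      exact .circle_attach hX hab h hmax hcon
        (IH _ (Finset.erase_ssubset h) (erase_isCx hX hmax) hcon)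
    push Not at h0
    by_cases hflat : ∀ Y ⊆ X, IsCx Y → Conn Y → eul Y ≤ 1
    · exact isWedge_of_flat hX hc hs IH hflat h1 h0
    push Not at hflat
    obtain ⟨Y, hYX, hY, hYc, hYe⟩ := hflat
    obtain ⟨Z, hZm, hmin⟩ := Finset.exists_min_image
      (X.powerset.filter fun Y => IsCx Y ∧ Conn Y ∧ 1 < eul Y) Finset.card
      ⟨Y, Finset.mem_filter.2 ⟨Finset.mem_powerset.2 hYX, hY, hYc, hYe⟩⟩
    obtain ⟨hZX, hZ, hZc, hZe⟩ := Finset.mem_filter.1 hZm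
    rw [Finset.mem_powerset] at hZX
    obtain ⟨σ, hσ, hcon⟩ := exists_contractible_erase hZ hZc (hs.mono hZX) (by omega)
      fun W hW hWcx hWc => by
        by_contra! hlt
        have k1 := hmin W (Finset.mem_filter.2
          ⟨Finset.mem_powerset.2 (hW.1.trans hZX), hWcx, hWc, hlt⟩)
        have k2 := Finset.card_lt_card hW
        omega
    obtain ⟨hσZ, hσc⟩ := mem_tris.1 hσ
    exact isWedge_of_contractible_erase hX hc hZ hZX hσ hcon
      (IH _ (Finset.erase_ssubset (hZX hσZ)) (hX.erase_tri hσc)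
        (hc.erase_of_card_ne (by omega) (by omega)))

end

noncomputable section
open scoped ContinuousMap

variable {N : ℕ}

/-- Reindexing a wedge of standard pieces. -/
lemma pieceWedge_reindex {ι κ : Type} (e : κ ≃ ι) (c : ι → WedgePiece) :
    Nonempty (PieceWedge c ≃ₜ PieceWedge (c ∘ e)) := by
  let K : C(PieceWedge (c ∘ e), PieceWedge c) :=
    Wedge.lift (PieceWedge.base c) (fun k => Wedge.inc (fun i => (c i).pt) (e k))
      (fun k => Wedge.inc_base (b := fun i => (c i).pt) (e k))
  have hf : ∀ i, ∃ f : C((c i).space, PieceWedge (c ∘ e)), f (c i).pt = PieceWedge.base (c ∘ e) ∧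
      (∀ x, K (f x) = Wedge.inc (fun i => (c i).pt) i x) ∧
      ∀ k, e k = i → ∀ (x : (c (e k)).space) (y : (c i).space), HEq x y →
        f y = Wedge.inc (fun k => ((c ∘ e) k).pt) k x := by
    intro i
    obtain ⟨k, rfl⟩ := e.surjective i
    refine ⟨Wedge.inc (fun k => ((c ∘ e) k).pt) k, Wedge.inc_base (b := fun k => ((c ∘ e) k).pt) k,
      fun x => rfl, fun l hl x y hxy => ?_⟩
    obtain rfl := e.injective hl
    rw [eq_of_heq hxy]
  choose f hb hK hf using hf
  let L : C(PieceWedge c, PieceWedge (c ∘ e)) := Wedge.lift (PieceWedge.base (c ∘ e)) f hb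
  have hLK : L.comp K = .id _ := Wedge.hom_ext rfl fun k x => hf (e k) k rfl x x HEq.rfl
  have hKL : K.comp L = .id _ := Wedge.hom_ext rfl fun i x => hK i x
  exact ⟨⟨⟨L, K, fun x => DFunLike.congr_fun hKL x, fun x => DFunLike.congr_fun hLK x⟩,
    L.continuous, K.continuous⟩⟩

lemma sparse_of_ratio (X : SimplicialComplex2 N)
    (h : ∀ Y : SimplicialComplex2 N, Y.IsSubcomplex X → 1 ≤ SimplicialComplex2.f 1 Y →
      (1 : ℝ) / 3 < (SimplicialComplex2.f 0 Y : ℝ) / (SimplicialComplex2.f 1 Y)) :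
    Sparse X.faces := by
  intro Y hYX hY hne
  have hv : 1 ≤ (verts Y).card := by
    obtain ⟨σ, hσ⟩ := hne
    obtain ⟨a, ha⟩ := hY.nonempty σ hσ
    exact Finset.card_pos.2 ⟨{a}, Finset.mem_filter.2
      ⟨hY.vertex_mem hσ ha, Finset.card_singleton a⟩⟩
  rcases Nat.eq_zero_or_pos (edges Y).card with h0 | h0
  · omega
  · have h1 : (1 : ℝ) / 3 < ((verts Y).card : ℝ) / (edges Y).card :=
      h ⟨Y, hY.nonempty, hY.card_le, hY.down⟩ hYX h0
    rw [div_lt_div_iff₀ (by norm_num) (by exact_mod_cast h0)] at h1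
    have h2 : 1 * (edges Y).card < (verts Y).card * 3 := by exact_mod_cast h1
    omega

lemma IsWedge.exists_fin {A : Type} [TopologicalSpace A] (h : IsWedge A) :
    ∃ (k : ℕ) (c : Fin k → WedgePiece), Nonempty (A ≃ₕ PieceWedge c) := by
  obtain ⟨ι, hι, c, ⟨E⟩⟩ := h
  obtain ⟨k, ⟨e⟩⟩ := Finite.exists_equiv_fin ι
  obtain ⟨F⟩ := pieceWedge_reindex e.symm c
  exact ⟨k, c ∘ e.symm, ⟨E.trans F.toHomotopyEquiv⟩⟩

end

open SimplicialComplex2 in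
theorem realization_homotopyEquiv_wedge {N : ℕ} (X : SimplicialComplex2 N)
    (hconn : IsConnected (realization X))
    (hsparse : ∀ Y : SimplicialComplex2 N, Y.IsSubcomplex X → 1 ≤ f 1 Y →
      (1 : ℝ) / 3 < (f 0 Y : ℝ) / (f 1 Y)) :
    ∃ (k : ℕ) (c : Fin k → WedgePiece),
      Nonempty (ContinuousMap.HomotopyEquiv (↥(realization X))
        (Wedge (fun i => (c i).space) (fun i => (c i).pt))) := by
  have hX := isCx_faces X
  rw [realization_eq] at hconn ⊢
  exact (isWedge_of_sparse _ X.faces le_rfl hX (conn_of_isConnected hX hconn)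
    (sparse_of_ratio X hsparse)).exists_fin
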